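/- For every s ∈ (1/2,1), with d, θ_0, ξ_0, p_0 as defined, there exist a compact set A ⊂ [1,2] and a Borel probability measure ν on ℝ whose support equals A such that ν is Ahlfors s-regular (in particular A has Hausdorff dimension s) and such that for every p > p_0 and every q with p ≤ q ≤ p/(p_0 − 1), the restricted maximal operator M_ν is bounded from L^p(ℝ) to L^q(ℝ). -/

import Mathlib

open MeasureTheory Set

/-- The restricted maximal operator `M_ν f(x) = sup_{r ∈ [1,2]} ∫ |f(x+ry)| dν(y)`. -/
noncomputable def restrictedMax (ν : Measure ℝ) (f : ℝ → ℝ) (x : ℝ) : ℝ :=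
  ⨆ r : Icc (1 : ℝ) 2, ∫ y, |f (x + (r : ℝ) * y)| ∂ν

/-- The (topological) support of a measure on `ℝ`. -/
def msupport (ν : Measure ℝ) : Set ℝ :=
  {x | ∀ ε > 0, 0 < ν (Metric.ball x ε)}

/-- Ahlfors `s`-regularity of a measure on `ℝ`. -/
def IsAhlforsRegular (ν : Measure ℝ) (s : ℝ) : Prop :=
  ∃ C : ℝ, 1 ≤ C ∧ ∀ x ∈ msupport ν, ∀ r : ℝ, 0 < r → r ≤ 1 →
    ENNReal.ofReal (C⁻¹ * r ^ s) ≤ ν (Icc (x - r) (x + r)) ∧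
      ν (Icc (x - r) (x + r)) ≤ ENNReal.ofReal (C * r ^ s)

/-- Boundedness of the restricted maximal operator from `L^p(ℝ)` to `L^q(ℝ)`. -/
def BoundedLpLq (ν : Measure ℝ) (p q : ℝ) : Prop :=
  ∃ C : ℝ, 0 ≤ C ∧ ∀ f : ℝ → ℝ, Measurable f →
    eLpNorm (restrictedMax ν f) (ENNReal.ofReal q) volume ≤
      ENNReal.ofReal C * eLpNorm f (ENNReal.ofReal p) volume

/-- The Walsh polynomial with coefficients `c` on subsets of `V`, as a function of the set `B` of
coordinates at which the sign is `-1`. -/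
noncomputable def walsh (V : Finset ℕ) (c : Finset ℕ → ℝ) (B : Finset ℕ) : ℝ :=
  ∑ A ∈ V.powerset, c A * (-1) ^ (A ∩ B).card

/-- The average of `g` over all subsets of `V`. -/
noncomputable def signAvg (V : Finset ℕ) (g : Finset ℕ → ℝ) : ℝ :=
  (∑ B ∈ V.powerset, g B) / 2 ^ V.card

theorem signAvg_mono {V : Finset ℕ} {g g' : Finset ℕ → ℝ} (h : ∀ B ∈ V.powerset, g B ≤ g' B) :
    signAvg V g ≤ signAvg V g' := by
  unfold signAvg
  gcongr with B hB
  exact h B hB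

theorem signAvg_insert {V : Finset ℕ} {v : ℕ} (hv : v ∉ V) (g : Finset ℕ → ℝ) :
    signAvg (insert v V) g = signAvg V (fun B => (g B + g (insert v B)) / 2) := by
  unfold signAvg
  rw [Finset.sum_powerset_insert hv, Finset.card_insert_of_notMem hv, ← Finset.sum_div,
    Finset.sum_add_distrib, pow_succ]
  field_simp

theorem walsh_insert_of_subset {V B : Finset ℕ} {v : ℕ} (hv : v ∉ V) (hB : B ⊆ V)
    (c : Finset ℕ → ℝ) :
    walsh (insert v V) c B = walsh V c B + walsh V (fun A => c (insert v A)) B := by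
  unfold walsh
  rw [Finset.sum_powerset_insert hv]
  congr 1
  refine Finset.sum_congr rfl fun A _ => ?_
  rw [Finset.insert_inter_of_notMem (fun h => hv (hB h))]

theorem walsh_insert_insert {V B : Finset ℕ} {v : ℕ} (hv : v ∉ V) (hB : B ⊆ V)
    (c : Finset ℕ → ℝ) :
    walsh (insert v V) c (insert v B) = walsh V c B - walsh V (fun A => c (insert v A)) B := by
  unfold walsh
  rw [Finset.sum_powerset_insert hv, sub_eq_add_neg, ← Finset.sum_neg_distrib]
  congr 1
  · refine Finset.sum_congr rfl fun A hA => ?_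
    rw [Finset.inter_insert_of_notMem (fun h => hv (Finset.mem_powerset.1 hA h))]
  · refine Finset.sum_congr rfl fun A hA => ?_
    have h1 : v ∉ A ∩ B := fun h => hv (hB (Finset.mem_inter.1 h).2)
    rw [← Finset.insert_inter_distrib, Finset.card_insert_of_notMem h1, pow_succ]
    ring

theorem two_point_inequality (j : ℕ) (a b : ℝ) :
    ((a + b) ^ 2 ^ (j + 1) + (a - b) ^ 2 ^ (j + 1)) / 2 ≤
      (a ^ 2 + (2 ^ (j + 1) - 1) * b ^ 2) ^ 2 ^ j := by
  induction j generalizing a b with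
  | zero => norm_num; nlinarith
  | succ j ih =>
    have h := ih (a ^ 2 + b ^ 2) (2 * a * b)
    have e1 : (a + b) ^ 2 ^ (j + 1 + 1) = (a ^ 2 + b ^ 2 + 2 * a * b) ^ 2 ^ (j + 1) := by
      rw [pow_succ' 2 (j + 1), pow_mul]; ring_nf
    have e2 : (a - b) ^ 2 ^ (j + 1 + 1) = (a ^ 2 + b ^ 2 - 2 * a * b) ^ 2 ^ (j + 1) := by
      rw [pow_succ' 2 (j + 1), pow_mul]; ring_nf
    have e3 (x : ℝ) : x ^ 2 ^ (j + 1) = (x ^ 2) ^ 2 ^ j := by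
      rw [pow_succ' 2 j, pow_mul]
    rw [e1, e2, e3 (a ^ 2 + _)]
    refine h.trans ?_
    have hK : (1 : ℝ) ≤ 2 ^ (j + 1) := one_le_pow₀ (by norm_num)
    refine pow_le_pow_left₀ ?_ ?_ _
    · have : 0 ≤ (2 ^ (j + 1) - 1 : ℝ) := by linarith
      positivity
    · rw [pow_succ (2 : ℝ) (j + 1)]
      generalize (2 : ℝ) ^ (j + 1) = K at hK
      have h4 : 0 ≤ b ^ 4 := by positivity
      nlinarith [mul_nonneg (mul_nonneg (by linarith : (0 : ℝ) ≤ K)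
        (by linarith : (0 : ℝ) ≤ K - 1)) h4]

theorem signAvg_add_pow_le {V : Finset ℕ} {X Y : Finset ℕ → ℝ} (hX : ∀ B, 0 ≤ X B)
    (hY : ∀ B, 0 ≤ Y B) {α β : ℝ} (hα : 0 ≤ α) (hβ : 0 ≤ β) {M : ℕ} (hM : 1 ≤ M)
    (h1 : signAvg V (fun B => X B ^ M) ≤ α ^ M) (h2 : signAvg V (fun B => Y B ^ M) ≤ β ^ M) :
    signAvg V (fun B => (X B + Y B) ^ M) ≤ (α + β) ^ M := by
  have hM0 : (M : ℝ) ≠ 0 := by positivity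
  have hM0' : M ≠ 0 := by omega
  set N : ℝ := 2 ^ V.card with hN
  have hNpos : 0 < N := by positivity
  have key := Real.Lp_add_le_of_nonneg V.powerset (f := X) (g := Y) (p := M)
    (by exact_mod_cast hM) (fun B _ => hX B) (fun B _ => hY B)
  simp only [Real.rpow_natCast] at key
  unfold signAvg at *
  rw [div_le_iff₀ hNpos] at *
  have aux (S γ : ℝ) (hγ : 0 ≤ γ) (hS0 : 0 ≤ S) (hS : S ≤ γ ^ M * N) :
      S ^ (1 / (M : ℝ)) ≤ γ * N ^ (1 / (M : ℝ)) := by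
    refine (Real.rpow_le_rpow hS0 hS (by positivity)).trans_eq ?_
    rw [Real.mul_rpow (by positivity) hNpos.le, one_div, Real.pow_rpow_inv_natCast hγ hM0']
  have hs0 : 0 ≤ ∑ B ∈ V.powerset, (X B + Y B) ^ M :=
    Finset.sum_nonneg fun B _ => pow_nonneg (add_nonneg (hX B) (hY B)) _
  have h3 := key.trans (add_le_add
    (aux _ α hα (Finset.sum_nonneg fun B _ => pow_nonneg (hX B) _) h1)
    (aux _ β hβ (Finset.sum_nonneg fun B _ => pow_nonneg (hY B) _) h2))
  rw [← add_mul] at h3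
  have h4 := pow_le_pow_left₀ (Real.rpow_nonneg hs0 _) h3 M
  rwa [one_div, Real.rpow_inv_natCast_pow hs0 hM0', mul_pow,
    Real.rpow_inv_natCast_pow hNpos.le hM0'] at h4

/-- Hypercontractivity for Walsh polynomials of degree at most `D`. -/
theorem signAvg_walsh_pow_le (j : ℕ) (V : Finset ℕ) (D : ℕ) (c : Finset ℕ → ℝ)
    (hc : ∀ A ⊆ V, D < A.card → c A = 0) :
    signAvg V (fun B => walsh V c B ^ 2 ^ (j + 1)) ≤
      ((2 ^ (j + 1) - 1) ^ D * ∑ A ∈ V.powerset, c A ^ 2) ^ 2 ^ j := by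
  have hK : (1 : ℝ) ≤ 2 ^ (j + 1) - 1 := by
    have : (1 : ℝ) ≤ 2 ^ j := one_le_pow₀ (by norm_num)
    rw [pow_succ]; linarith
  induction V using Finset.induction_on generalizing D c with
  | empty =>
    simp only [signAvg, walsh, Finset.powerset_empty, Finset.sum_singleton, Finset.empty_inter,
      Finset.card_empty, pow_zero, mul_one, div_one]
    rw [pow_succ' 2 j, pow_mul]
    refine pow_le_pow_left₀ (by positivity) ?_ _
    exact le_mul_of_one_le_left (by positivity) (one_le_pow₀ hK)
  | insert v V hv ih =>
    rw [signAvg_insert hv, Finset.sum_powerset_insert hv]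
    set K : ℝ := 2 ^ (j + 1) - 1 with hKdef
    set b : Finset ℕ → ℝ := fun A => c (insert v A) with hb
    have hA := ih D c fun A hA hD => hc A (hA.trans (Finset.subset_insert _ _)) hD
    have hpow (x : ℝ) : x ^ 2 ^ (j + 1) = (x ^ 2) ^ 2 ^ j := by rw [pow_succ' 2 j, pow_mul]
    have h1 : signAvg V (fun B => (walsh (insert v V) c B ^ 2 ^ (j + 1) +
        walsh (insert v V) c (insert v B) ^ 2 ^ (j + 1)) / 2) ≤
        signAvg V (fun B => (walsh V c B ^ 2 + K * walsh V b B ^ 2) ^ 2 ^ j) := by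
      refine signAvg_mono fun B hB => ?_
      rw [Finset.mem_powerset] at hB
      rw [walsh_insert_of_subset hv hB, walsh_insert_insert hv hB]
      exact two_point_inequality j _ _
    refine h1.trans ?_
    have hK0 : 0 ≤ K := by linarith
    rw [mul_add]
    refine signAvg_add_pow_le (fun B => by positivity) (fun B => by positivity)
      (mul_nonneg (by positivity) (Finset.sum_nonneg fun _ _ => by positivity))
      (mul_nonneg (by positivity) (Finset.sum_nonneg fun _ _ => by positivity))
      Nat.one_le_two_pow ?_ ?_
    · simpa only [hpow] using hA
    · rcases D with _ | D
      · have hz : ∀ A ∈ V.powerset, b A = 0 := fun A hA => by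
          have hA' := Finset.mem_powerset.1 hA
          exact hc _ (Finset.insert_subset_insert v hA')
            (by rw [Finset.card_insert_of_notMem fun h => hv (hA' h)]; omega)
        have hw : ∀ B, walsh V b B = 0 := fun B =>
          Finset.sum_eq_zero fun A hA => by rw [hz A hA, zero_mul]
        have hs : ∑ A ∈ V.powerset, c (insert v A) ^ 2 = 0 :=
          Finset.sum_eq_zero fun A hA => by simpa using hz A hA
        simp [signAvg, hw, hs]
      · have hB := ih D b fun A hA hD => hc _ (Finset.insert_subset_insert v hA)
          (by rw [Finset.card_insert_of_notMem fun h => hv (hA h)]; omega)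
        have e : signAvg V (fun B => (K * walsh V b B ^ 2) ^ 2 ^ j) =
            K ^ 2 ^ j * signAvg V (fun B => walsh V b B ^ 2 ^ (j + 1)) := by
          simp only [signAvg, mul_pow, hpow, ← Finset.mul_sum, mul_div_assoc]
        rw [e, pow_succ' K D, mul_assoc K, mul_pow K]
        exact mul_le_mul_of_nonneg_left hB (by positivity)

/-- If the averages of finitely many nonnegative functions add up to less than `1`, some sign
pattern makes all of them less than `1`. -/
theorem exists_forall_lt_one_of_sum_signAvg {ι : Type*} (I : Finset ι) (V : Finset ℕ)
    (F : ι → Finset ℕ → ℝ) (hF : ∀ i B, 0 ≤ F i B) (h : ∑ i ∈ I, signAvg V (F i) < 1) :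
    ∃ B ⊆ V, ∀ i ∈ I, F i B < 1 := by
  by_contra! hcon
  have h1 : ∀ B ∈ V.powerset, 1 ≤ ∑ i ∈ I, F i B := fun B hB => by
    obtain ⟨i, hi, h1⟩ := hcon B (Finset.mem_powerset.1 hB)
    exact h1.trans (Finset.single_le_sum (f := fun i => F i B) (fun i _ => hF i B) hi)
  have h2 : (2 : ℝ) ^ V.card ≤ ∑ B ∈ V.powerset, ∑ i ∈ I, F i B := by
    have := Finset.sum_le_sum h1
    simpa [Finset.card_powerset] using this
  have h3 : ∑ i ∈ I, signAvg V (F i) = (∑ B ∈ V.powerset, ∑ i ∈ I, F i B) / 2 ^ V.card := by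
    unfold signAvg
    rw [← Finset.sum_div, Finset.sum_comm]
  rw [h3, div_lt_one (by positivity)] at h
  linarith

/-- The index of the dyadic interval `[a / 2 ^ k, (a + 1) / 2 ^ k)` containing `y`. -/
noncomputable def dyadicIdx (k : ℕ) (y : ℝ) : ℕ := ⌊2 ^ k * y⌋₊

/-- The step function equal to `h` on the dyadic intervals of level `k` with index in `E`. -/
noncomputable def stepFun (k : ℕ) (h : ℝ) (E : Finset ℕ) (y : ℝ) : ℝ :=
  if dyadicIdx k y ∈ E then h else 0

/-- The sign taking the values `1` and `-1` on the left and right halves of level-`k` intervals. -/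
noncomputable def haarSign (k : ℕ) (y : ℝ) : ℝ := (-1) ^ dyadicIdx (k + 1) y

/-- The signed Haar-type step function with sign pattern `B`. -/
noncomputable def signedStep (k : ℕ) (h : ℝ) (E B : Finset ℕ) (y : ℝ) : ℝ :=
  stepFun k h E y * haarSign k y * (if dyadicIdx k y ∈ B then -1 else 1)

/-- A family of dyadic intervals of level `k` in `[1, 2)` whose normalised density `h` satisfies an
upper `s`-regularity bound. -/
structure LevelRegular (s C₀ : ℝ) (k : ℕ) (h : ℝ) (E : Finset ℕ) : Prop where
  subset : E ⊆ Finset.Ico (2 ^ k) (2 ^ (k + 1))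
  one_le : 1 ≤ h
  scale_le : ((2 : ℝ) ^ k)⁻¹ ^ s ≤ h * ((2 : ℝ) ^ k)⁻¹
  mass_le : ∀ u v : ℝ, ((2 : ℝ) ^ k)⁻¹ ≤ v - u → ∫ y in Icc u v, stepFun k h E y ≤ C₀ * (v - u) ^ s

theorem measurable_dyadicIdx (k : ℕ) : Measurable (dyadicIdx k) :=
  Nat.measurable_floor.comp (measurable_const_mul _)

theorem measurable_stepFun (k : ℕ) (h : ℝ) (E : Finset ℕ) : Measurable (stepFun k h E) :=
  Measurable.ite (measurable_dyadicIdx k (Set.toFinite (E : Set ℕ)).measurableSet)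
    measurable_const measurable_const

theorem measurable_haarSign (k : ℕ) : Measurable (haarSign k) :=
  (measurable_of_countable (fun a : ℕ => (-1 : ℝ) ^ a)).comp (measurable_dyadicIdx (k + 1))

theorem measurable_signedStep (k : ℕ) (h : ℝ) (E B : Finset ℕ) :
    Measurable (signedStep k h E B) :=
  ((measurable_stepFun k h E).mul (measurable_haarSign k)).mul
    (Measurable.ite (measurable_dyadicIdx k (Set.toFinite (B : Set ℕ)).measurableSet)
      measurable_const measurable_const)

theorem stepFun_nonneg {k : ℕ} {h : ℝ} (hh : 0 ≤ h) (E : Finset ℕ) (y : ℝ) :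
    0 ≤ stepFun k h E y := by
  unfold stepFun; split_ifs <;> simp [hh]

theorem stepFun_le {k : ℕ} {h : ℝ} (hh : 0 ≤ h) (E : Finset ℕ) (y : ℝ) :
    stepFun k h E y ≤ h := by
  unfold stepFun; split_ifs <;> simp [hh]

theorem abs_haarSign (k : ℕ) (y : ℝ) : |haarSign k y| = 1 := by
  simp [haarSign, abs_pow]

theorem abs_signedStep {k : ℕ} {h : ℝ} (hh : 0 ≤ h) (E B : Finset ℕ) (y : ℝ) :
    |signedStep k h E B y| = stepFun k h E y := by
  have : |if dyadicIdx k y ∈ B then (-1 : ℝ) else 1| = 1 := by split_ifs <;> simp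
  rw [signedStep, abs_mul, abs_mul, this, abs_haarSign, abs_of_nonneg (stepFun_nonneg hh E y)]
  ring

theorem mem_Ico_of_dyadicIdx_mem {k : ℕ} {E : Finset ℕ}
    (hE : E ⊆ Finset.Ico (2 ^ k) (2 ^ (k + 1))) {y : ℝ} (hy : dyadicIdx k y ∈ E) :
    y ∈ Ico (1 : ℝ) 2 := by
  have h := Finset.mem_Ico.1 (hE hy)
  unfold dyadicIdx at h
  have hk : (0 : ℝ) < 2 ^ k := by positivity
  have h1 : (2 ^ k : ℝ) ≤ 2 ^ k * y := by
    have := (Nat.le_floor_iff' (by positivity)).1 h.1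
    exact_mod_cast this
  have h2 : 2 ^ k * y < (2 : ℝ) ^ (k + 1) := by
    have := (Nat.floor_lt' (by positivity)).1 h.2
    exact_mod_cast this
  constructor
  · nlinarith
  · rw [pow_succ] at h2
    nlinarith

theorem abs_sub_lt_of_dyadicIdx_eq {k : ℕ} {y y' : ℝ} (hy : 0 ≤ y) (hy' : 0 ≤ y')
    (h : dyadicIdx k y = dyadicIdx k y') : |y - y'| < ((2 : ℝ) ^ k)⁻¹ := by
  unfold dyadicIdx at h
  have hk : (0 : ℝ) < 2 ^ k := by positivity
  have a1 := Nat.floor_le (show 0 ≤ 2 ^ k * y by positivity)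
  have a2 := Nat.floor_le (show 0 ≤ 2 ^ k * y' by positivity)
  have b1 := Nat.lt_floor_add_one (2 ^ k * y)
  have b2 := Nat.lt_floor_add_one (2 ^ k * y')
  rw [h] at a1 b1
  rw [← one_div, lt_div_iff₀ hk, ← abs_of_pos hk, ← abs_mul, abs_lt]
  constructor <;> linarith

theorem dyadicIdx_eq_iff {k a : ℕ} (ha : a ≠ 0) {y : ℝ} :
    dyadicIdx k y = a ↔ (a : ℝ) / 2 ^ k ≤ y ∧ y < (a + 1) / 2 ^ k := by
  unfold dyadicIdx
  have hk : (0 : ℝ) < 2 ^ k := by positivity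
  rw [Nat.floor_eq_iff' ha, div_le_iff₀ hk, lt_div_iff₀ hk, mul_comm]

theorem abs_stepFun_le {k : ℕ} {h : ℝ} (hh : 0 ≤ h) (E : Finset ℕ) (y : ℝ) :
    |stepFun k h E y| ≤ h := by
  rw [abs_of_nonneg (stepFun_nonneg hh E y)]
  exact stepFun_le hh E y

theorem integrable_stepFun {k : ℕ} {h : ℝ} (hh : 0 ≤ h) {E : Finset ℕ}
    (hE : E ⊆ Finset.Ico (2 ^ k) (2 ^ (k + 1))) : Integrable (stepFun k h E) := by
  have : IntegrableOn (stepFun k h E) (Ico 1 2) :=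
    Integrable.of_bound (measurable_stepFun k h E).aestronglyMeasurable h
      (Filter.Eventually.of_forall fun y => by
        rw [Real.norm_eq_abs]; exact abs_stepFun_le hh E y)
  refine (integrableOn_iff_integrable_of_support_subset fun y hy => ?_).1 this
  by_contra hcon
  refine hy ?_
  unfold stepFun
  rw [if_neg fun hm => hcon (mem_Ico_of_dyadicIdx_mem hE hm)]

theorem integral_comp_affine_le {G : ℝ → ℝ} (hG : Integrable G) (hG0 : ∀ y, 0 ≤ G y) {x r : ℝ}
    (hr : r ∈ Icc (1 : ℝ) 2) (S : Set ℝ) :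
    ∫ z in S, G ((z - x) / r) ≤ 2 * ∫ y, G y := by
  have hr0 : r ≠ 0 := by linarith [hr.1]
  have hInt : Integrable fun z => G ((z - x) / r) := (hG.comp_div hr0).comp_sub_right x
  have h1 : ∫ z in S, G ((z - x) / r) ≤ ∫ z, G ((z - x) / r) :=
    setIntegral_le_integral hInt (Filter.Eventually.of_forall fun _ => hG0 _)
  have h2 : ∫ z, G ((z - x) / r) = |r| • ∫ y, G y := by
    rw [integral_sub_right_eq_self (fun z => G (z / r)) x, Measure.integral_comp_div]
  rw [h2, abs_of_nonneg (by linarith [hr.1]), smul_eq_mul] at h1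
  exact h1.trans (mul_le_mul_of_nonneg_right hr.2 (integral_nonneg hG0))

theorem exists_interval_of_near {δ x₁ x₂ r₁ r₂ : ℝ} (hδ : 0 < δ) (hδ1 : δ ≤ 1)
    (hx₁ : x₁ ∈ Icc (0 : ℝ) 1) (hx₂ : x₂ ∈ Icc (0 : ℝ) 1) (hr₁ : r₁ ∈ Icc (1 : ℝ) 2)
    (hr₂ : r₂ ∈ Icc (1 : ℝ) 2) :
    ∃ u v : ℝ, δ ≤ v - u ∧ v - u ≤ 32 * (δ / (|x₁ - x₂| + δ)) ∧
      ∀ z, (z - x₁) / r₁ ∈ Icc (1 : ℝ) 2 → |(z - x₁) / r₁ - (z - x₂) / r₂| < δ →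
        (z - x₁) / r₁ ∈ Icc u v := by
  set ρ := |x₁ - x₂| with hρ
  have hρ0 : 0 ≤ ρ := abs_nonneg _
  have hρ1 : ρ ≤ 1 := abs_le.2 ⟨by linarith [hx₁.1, hx₂.2], by linarith [hx₁.2, hx₂.1]⟩
  have hr₁0 : 0 < r₁ := by linarith [hr₁.1]
  have hr₂0 : 0 < r₂ := by linarith [hr₂.1]
  by_cases hcase : ρ ≤ 8 * δ
  · refine ⟨1, 2, by linarith, ?_, fun z hz _ => hz⟩
    rw [← mul_div_assoc, le_div_iff₀ (by positivity)]
    linarith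
  push Not at hcase
  have near : ∀ z, |(z - x₁) / r₁ - (z - x₂) / r₂| < δ →
      |(r₂ - r₁) * ((z - x₁) / r₁) - (x₁ - x₂)| < 2 * δ := by
    intro z hz
    have e : (r₂ - r₁) * ((z - x₁) / r₁) - (x₁ - x₂) =
        r₂ * ((z - x₁) / r₁ - (z - x₂) / r₂) := by field_simp; ring
    rw [e, abs_mul, abs_of_pos hr₂0]
    nlinarith [hr₂.2, abs_nonneg ((z - x₁) / r₁ - (z - x₂) / r₂)]
  by_cases hc : |r₂ - r₁| < ρ / 4
  · refine ⟨1, 1 + δ, by linarith, ?_, fun z hz hn => ?_⟩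
    · rw [← mul_div_assoc, le_div_iff₀ (by positivity)]
      nlinarith
    · exfalso
      have h1 := near z hn
      have h2 : |(r₂ - r₁) * ((z - x₁) / r₁)| ≤ ρ / 4 * 2 := by
        rw [abs_mul, abs_of_nonneg (by linarith [hz.1] : 0 ≤ (z - x₁) / r₁)]
        exact mul_le_mul hc.le hz.2 (by linarith [hz.1]) (by positivity)
      have h3 : ρ ≤ |(r₂ - r₁) * ((z - x₁) / r₁)| +
          |(r₂ - r₁) * ((z - x₁) / r₁) - (x₁ - x₂)| := by
        rw [hρ]
        have := abs_sub_abs_le_abs_sub (x₁ - x₂) ((r₂ - r₁) * ((z - x₁) / r₁))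
        rw [abs_sub_comm (x₁ - x₂)] at this
        linarith
      linarith
  push Not at hc
  set c := r₂ - r₁ with hcdef
  have hc0 : 0 < |c| := by linarith
  have hc0' : c ≠ 0 := abs_pos.1 hc0
  have hc1 : |c| ≤ 1 := abs_le.2 ⟨by linarith [hr₁.2, hr₂.1], by linarith [hr₁.1, hr₂.2]⟩
  refine ⟨(x₁ - x₂) / c - 2 * δ / |c|, (x₁ - x₂) / c + 2 * δ / |c|, ?_, ?_, fun z hz hn => ?_⟩
  · have : δ ≤ 2 * δ / |c| := by rw [le_div_iff₀ hc0]; nlinarith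
    linarith
  · have h1 : 2 * δ / |c| ≤ 16 * (δ / (ρ + δ)) := by
      rw [← mul_div_assoc, div_le_div_iff₀ hc0 (by positivity)]
      nlinarith
    linarith
  · have h1 := near z hn
    have h2 : |(z - x₁) / r₁ - (x₁ - x₂) / c| ≤ 2 * δ / |c| := by
      rw [le_div_iff₀ hc0, ← abs_mul]
      have : ((z - x₁) / r₁ - (x₁ - x₂) / c) * c = c * ((z - x₁) / r₁) - (x₁ - x₂) := by
        field_simp
      rw [this]; exact h1.le
    rw [abs_le] at h2
    exact ⟨by linarith [h2.1], by linarith [h2.2]⟩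

theorem integral_near_le {s C₀ h : ℝ} {k : ℕ} {E : Finset ℕ} (hs0 : 0 ≤ s) (hs1 : s ≤ 1)
    (hE : LevelRegular s C₀ k h E) {x₁ x₂ r₁ r₂ : ℝ} (hC₀ : 0 ≤ C₀)
    (hx₁ : x₁ ∈ Icc (0 : ℝ) 1) (hx₂ : x₂ ∈ Icc (0 : ℝ) 1) (hr₁ : r₁ ∈ Icc (1 : ℝ) 2)
    (hr₂ : r₂ ∈ Icc (1 : ℝ) 2) :
    ∫ z in Icc (0 : ℝ) 6, (if dyadicIdx k ((z - x₁) / r₁) = dyadicIdx k ((z - x₂) / r₂)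
        then stepFun k h E ((z - x₁) / r₁) else 0) ≤
      64 * C₀ * (((2 : ℝ) ^ k)⁻¹ / (|x₁ - x₂| + ((2 : ℝ) ^ k)⁻¹)) ^ s := by
  set δ : ℝ := ((2 : ℝ) ^ k)⁻¹ with hδ
  have hδ0 : 0 < δ := by positivity
  have hδ1 : δ ≤ 1 := inv_le_one_of_one_le₀ (one_le_pow₀ (by norm_num))
  have hh : 0 ≤ h := by linarith [hE.one_le]
  obtain ⟨u, v, huv, huv', hnear⟩ := exists_interval_of_near hδ0 hδ1 hx₁ hx₂ hr₁ hr₂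
  have hG : Integrable ((Icc u v).indicator (stepFun k h E)) :=
    (integrable_stepFun hh hE.subset).indicator measurableSet_Icc
  have hG0 : ∀ y, 0 ≤ (Icc u v).indicator (stepFun k h E) y := fun y =>
    indicator_nonneg (fun y _ => stepFun_nonneg hh E y) y
  have hr₁0 : r₁ ≠ 0 := by linarith [hr₁.1]
  calc _ ≤ ∫ z in Icc (0 : ℝ) 6, (Icc u v).indicator (stepFun k h E) ((z - x₁) / r₁) := by
        refine integral_mono_of_nonneg (Filter.Eventually.of_forall fun z => ?_)
          ((hG.comp_div hr₁0).comp_sub_right x₁).integrableOn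
          (Filter.Eventually.of_forall fun z => ?_)
        · dsimp only [Pi.zero_apply]
          split_ifs
          · exact stepFun_nonneg hh E _
          · exact le_rfl
        · dsimp only
          split_ifs with hq
          · by_cases hm : dyadicIdx k ((z - x₁) / r₁) ∈ E
            · have h1 := mem_Ico_of_dyadicIdx_mem hE.subset hm
              have h2 := mem_Ico_of_dyadicIdx_mem hE.subset (hq ▸ hm)
              rw [indicator_of_mem (hnear z (Ico_subset_Icc_self h1)
                (abs_sub_lt_of_dyadicIdx_eq (by linarith [h1.1]) (by linarith [h2.1]) hq))]
            · rw [stepFun, if_neg hm]; exact hG0 _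
          · exact hG0 _
    _ ≤ 2 * ∫ y, (Icc u v).indicator (stepFun k h E) y := integral_comp_affine_le hG hG0 hr₁ _
    _ = 2 * ∫ y in Icc u v, stepFun k h E y := by rw [integral_indicator measurableSet_Icc]
    _ ≤ 2 * (C₀ * (v - u) ^ s) := by gcongr; exact hE.mass_le u v huv
    _ ≤ 2 * (C₀ * (32 * (δ / (|x₁ - x₂| + δ)) ^ s)) := by
        gcongr
        refine (Real.rpow_le_rpow (by linarith) huv' hs0).trans ?_
        rw [Real.mul_rpow (by norm_num) (by positivity)]
        gcongr
        calc (32 : ℝ) ^ s ≤ 32 ^ (1 : ℝ) := Real.rpow_le_rpow_of_exponent_le (by norm_num) hs1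
          _ = 32 := Real.rpow_one _
    _ = _ := by ring

/-- The set of `a ∈ E` hit an odd number of times by `v` on `S`. -/
def oddHits {n : ℕ} (E : Finset ℕ) (S : Finset (Fin n)) (v : Fin n → ℕ) : Finset ℕ :=
  E.filter fun a => Odd (S.filter fun i => v i = a).card

theorem oddHits_subset {n : ℕ} (E : Finset ℕ) (S : Finset (Fin n)) (v : Fin n → ℕ) :
    oddHits E S v ⊆ E := Finset.filter_subset _ _

theorem oddHits_card_le {n : ℕ} (E : Finset ℕ) (S : Finset (Fin n)) (v : Fin n → ℕ) :
    (oddHits E S v).card ≤ n := by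
  have h : oddHits E S v ⊆ S.image v := fun a ha => by
    obtain ⟨i, hi⟩ := Finset.card_pos.1 (Finset.mem_filter.1 ha).2.pos
    rw [Finset.mem_filter] at hi
    exact Finset.mem_image.2 ⟨i, hi⟩
  calc _ ≤ (S.image v).card := Finset.card_le_card h
    _ ≤ S.card := Finset.card_image_le
    _ ≤ n := by simpa using Finset.card_le_univ S

theorem prod_sign_eq {n : ℕ} {E : Finset ℕ} (B : Finset ℕ) (S : Finset (Fin n)) {v : Fin n → ℕ}
    (hv : ∀ i, v i ∈ E) :
    ∏ i ∈ S, (if v i ∈ B then (-1 : ℝ) else 1) = (-1) ^ (oddHits E S v ∩ B).card := by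
  rw [← Finset.prod_fiberwise_of_maps_to (t := E) (fun i _ => hv i)]
  have h1 : ∀ a ∈ E, ∏ i ∈ S with v i = a, (if v i ∈ B then (-1 : ℝ) else 1) =
      if Odd (S.filter fun i => v i = a).card then (if a ∈ B then (-1 : ℝ) else 1) else 1 := by
    intro a _
    rw [Finset.prod_congr rfl (g := fun _ => if a ∈ B then (-1 : ℝ) else 1)
      (fun i hi => by rw [(Finset.mem_filter.1 hi).2]), Finset.prod_const]
    split_ifs with hB ho ho
    · exact ho.neg_one_pow
    · exact (Nat.not_odd_iff_even.1 ho).neg_one_pow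
    · exact one_pow _
    · exact one_pow _
  rw [Finset.prod_congr rfl h1, ← Finset.prod_filter]
  change ∏ a ∈ oddHits E S v, _ = _
  rw [← Finset.prod_filter, Finset.prod_const, Finset.filter_mem_eq_inter]

theorem exists_ne_of_oddHits_eq_empty {n : ℕ} {E : Finset ℕ} {S : Finset (Fin n)} {v : Fin n → ℕ}
    (hv : ∀ i, v i ∈ E) (hS : S.Nonempty) (h : oddHits E S v = ∅) :
    ∃ i j, i ≠ j ∧ v i = v j := by
  obtain ⟨i, hi⟩ := hS
  have h1 : ¬ Odd (S.filter fun j => v j = v i).card := fun ho => by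
    have : v i ∈ oddHits E S v := Finset.mem_filter.2 ⟨hv i, ho⟩
    simp [h] at this
  have h2 : 0 < (S.filter fun j => v j = v i).card :=
    Finset.card_pos.2 ⟨i, Finset.mem_filter.2 ⟨hi, rfl⟩⟩
  have h3 : 1 < (S.filter fun j => v j = v i).card := by
    rcases Nat.lt_or_ge 1 (S.filter fun j => v j = v i).card with h | h
    · exact h
    · exact absurd (show Odd _ by rw [show (S.filter fun j => v j = v i).card = 1 by omega]; simp) h1
  obtain ⟨j, hj, hji⟩ := Finset.exists_mem_ne h3 i
  exact ⟨j, i, hji, (Finset.mem_filter.1 hj).2⟩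

/-- The correlation integrand: signed factors for `i ∈ S`, unsigned factors otherwise. -/
noncomputable def corrFun {n : ℕ} (k : ℕ) (h : ℝ) (E B : Finset ℕ) (S : Finset (Fin n))
    (x r : Fin n → ℝ) (z : ℝ) : ℝ :=
  ∏ i, if i ∈ S then signedStep k h E B ((z - x i) / r i) else stepFun k h E ((z - x i) / r i)

/-- The correlation integral. -/
noncomputable def corr {n : ℕ} (k : ℕ) (h : ℝ) (E B : Finset ℕ) (S : Finset (Fin n))
    (x r : Fin n → ℝ) : ℝ :=
  ∫ z in Icc (0 : ℝ) 6, corrFun k h E B S x r z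

/-- The integral of the product of unsigned factors. -/
noncomputable def prodInt {n : ℕ} (k : ℕ) (h : ℝ) (E : Finset ℕ) (x r : Fin n → ℝ) : ℝ :=
  ∫ z in Icc (0 : ℝ) 6, ∏ i, stepFun k h E ((z - x i) / r i)

/-- The singular weight controlling correlations. -/
noncomputable def weight {n : ℕ} (s : ℝ) (k : ℕ) (x : Fin n → ℝ) : ℝ :=
  1 + ∑ p ∈ (Finset.univ : Finset (Fin n)).offDiag, (|x p.1 - x p.2| + ((2 : ℝ) ^ k)⁻¹) ^ (-s)

theorem measurable_corrFun {n : ℕ} (k : ℕ) (h : ℝ) (E B : Finset ℕ) (S : Finset (Fin n))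
    (x r : Fin n → ℝ) : Measurable (corrFun k h E B S x r) := by
  refine Finset.measurable_fun_prod _ fun i _ => ?_
  split_ifs
  · exact (measurable_signedStep k h E B).comp ((measurable_id.sub_const _).div_const _)
  · exact (measurable_stepFun k h E).comp ((measurable_id.sub_const _).div_const _)

theorem abs_corrFun {n : ℕ} {k : ℕ} {h : ℝ} (hh : 0 ≤ h) (E B : Finset ℕ) (S : Finset (Fin n))
    (x r : Fin n → ℝ) (z : ℝ) :
    |corrFun k h E B S x r z| = ∏ i, stepFun k h E ((z - x i) / r i) := by
  rw [corrFun, Finset.abs_prod]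
  refine Finset.prod_congr rfl fun i _ => ?_
  split_ifs
  · exact abs_signedStep hh E B _
  · exact abs_of_nonneg (stepFun_nonneg hh E _)

theorem prod_stepFun_le {n : ℕ} {k : ℕ} {h : ℝ} (hh : 0 ≤ h) (E : Finset ℕ)
    (x r : Fin n → ℝ) (z : ℝ) :
    ∏ i, stepFun k h E ((z - x i) / r i) ≤ h ^ n := by
  calc _ ≤ ∏ _i : Fin n, h := Finset.prod_le_prod (fun i _ => stepFun_nonneg hh E _)
        fun i _ => stepFun_le hh E _
    _ = h ^ n := by simp

theorem prod_stepFun_nonneg {n : ℕ} {k : ℕ} {h : ℝ} (hh : 0 ≤ h) (E : Finset ℕ)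
    (x r : Fin n → ℝ) (z : ℝ) : 0 ≤ ∏ i, stepFun k h E ((z - x i) / r i) :=
  Finset.prod_nonneg fun _ _ => stepFun_nonneg hh E _

theorem integrableOn_of_abs_le {g : ℝ → ℝ} (hg : Measurable g) {C : ℝ} (h : ∀ z, |g z| ≤ C)
    (a b : ℝ) : IntegrableOn g (Icc a b) :=
  Integrable.of_bound hg.aestronglyMeasurable C (Filter.Eventually.of_forall h)

theorem prodInt_nonneg {n : ℕ} {k : ℕ} {h : ℝ} (hh : 0 ≤ h) (E : Finset ℕ)
    (x r : Fin n → ℝ) : 0 ≤ prodInt k h E x r :=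
  integral_nonneg fun z => prod_stepFun_nonneg hh E x r z

/-- The coefficients of the Walsh expansion of the correlation integral. -/
noncomputable def corrCoeff {n : ℕ} (k : ℕ) (h : ℝ) (E : Finset ℕ) (S : Finset (Fin n))
    (x r : Fin n → ℝ) (A : Finset ℕ) : ℝ :=
  ∫ z in Icc (0 : ℝ) 6, if oddHits E S (fun i => dyadicIdx k ((z - x i) / r i)) = A then
    (∏ i, stepFun k h E ((z - x i) / r i)) * ∏ i ∈ S, haarSign k ((z - x i) / r i) else 0

theorem measurableSet_oddHits_eq {n : ℕ} (k : ℕ) (E : Finset ℕ) (S : Finset (Fin n))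
    (x r : Fin n → ℝ) (A : Finset ℕ) :
    MeasurableSet {z : ℝ | oddHits E S (fun i => dyadicIdx k ((z - x i) / r i)) = A} := by
  have h : Measurable fun z : ℝ => fun i => dyadicIdx k ((z - x i) / r i) :=
    measurable_pi_lambda _ fun i => (measurable_dyadicIdx k).comp
      ((measurable_id.sub_const _).div_const _)
  exact h (t := {v | oddHits E S v = A}) (Set.to_countable _).measurableSet

theorem measurable_coeffFun {n : ℕ} (k : ℕ) (h : ℝ) (E : Finset ℕ) (S : Finset (Fin n))
    (x r : Fin n → ℝ) (A : Finset ℕ) :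
    Measurable fun z : ℝ => if oddHits E S (fun i => dyadicIdx k ((z - x i) / r i)) = A then
      (∏ i, stepFun k h E ((z - x i) / r i)) * ∏ i ∈ S, haarSign k ((z - x i) / r i) else 0 := by
  refine Measurable.ite (measurableSet_oddHits_eq k E S x r A) (Measurable.mul ?_ ?_)
    measurable_const
  · exact Finset.measurable_fun_prod _ fun i _ => (measurable_stepFun k h E).comp
      ((measurable_id.sub_const _).div_const _)
  · exact Finset.measurable_fun_prod _ fun i _ => (measurable_haarSign k).comp
      ((measurable_id.sub_const _).div_const _)

theorem abs_coeffFun {n : ℕ} {k : ℕ} {h : ℝ} (hh : 0 ≤ h) (E : Finset ℕ) (S : Finset (Fin n))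
    (x r : Fin n → ℝ) (A : Finset ℕ) (z : ℝ) :
    |if oddHits E S (fun i => dyadicIdx k ((z - x i) / r i)) = A then
      (∏ i, stepFun k h E ((z - x i) / r i)) * ∏ i ∈ S, haarSign k ((z - x i) / r i) else 0| =
    if oddHits E S (fun i => dyadicIdx k ((z - x i) / r i)) = A then
      ∏ i, stepFun k h E ((z - x i) / r i) else 0 := by
  split_ifs
  · rw [abs_mul, abs_of_nonneg (prod_stepFun_nonneg hh E x r z), Finset.abs_prod]
    simp [abs_haarSign]
  · simp

theorem abs_coeffFun_le {n : ℕ} {k : ℕ} {h : ℝ} (hh : 0 ≤ h) (E : Finset ℕ) (S : Finset (Fin n))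
    (x r : Fin n → ℝ) (A : Finset ℕ) (z : ℝ) :
    |if oddHits E S (fun i => dyadicIdx k ((z - x i) / r i)) = A then
      (∏ i, stepFun k h E ((z - x i) / r i)) * ∏ i ∈ S, haarSign k ((z - x i) / r i) else 0| ≤
    h ^ n := by
  rw [abs_coeffFun hh]
  split_ifs
  · exact prod_stepFun_le hh E x r z
  · positivity

theorem corr_eq_walsh {n : ℕ} {k : ℕ} {h : ℝ} (hh : 0 ≤ h) (E B : Finset ℕ) (S : Finset (Fin n))
    (x r : Fin n → ℝ) : corr k h E B S x r = walsh E (corrCoeff k h E S x r) B := by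
  unfold corr walsh corrCoeff
  simp_rw [← integral_mul_const]
  rw [← integral_finsetSum _ fun A _ => (integrableOn_of_abs_le (measurable_coeffFun k h E S x r A)
    (abs_coeffFun_le hh E S x r A) 0 6).mul_const _]
  congr 1
  funext z
  simp_rw [ite_mul, zero_mul]
  rw [Finset.sum_ite_eq, if_pos (Finset.mem_powerset.2 (oddHits_subset _ _ _))]
  by_cases hv : ∀ i, dyadicIdx k ((z - x i) / r i) ∈ E
  · rw [← prod_sign_eq B S hv, mul_assoc, ← Finset.prod_mul_distrib, corrFun]
    have : ∏ i ∈ S, haarSign k ((z - x i) / r i) *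
        (if dyadicIdx k ((z - x i) / r i) ∈ B then (-1 : ℝ) else 1) =
        ∏ i, if i ∈ S then haarSign k ((z - x i) / r i) *
        (if dyadicIdx k ((z - x i) / r i) ∈ B then (-1 : ℝ) else 1) else 1 := by
      rw [Finset.prod_ite_mem, Finset.univ_inter]
    rw [this, ← Finset.prod_mul_distrib]
    refine Finset.prod_congr rfl fun i _ => ?_
    split_ifs <;> simp [signedStep, *]
  · push Not at hv
    obtain ⟨i, hi⟩ := hv
    have h0 : stepFun k h E ((z - x i) / r i) = 0 := if_neg hi
    rw [Finset.prod_eq_zero (Finset.mem_univ i) h0, zero_mul, zero_mul, corrFun,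
      Finset.prod_eq_zero (Finset.mem_univ i)]
    split_ifs
    · rw [signedStep, h0]; ring
    · exact h0

theorem corrCoeff_eq_zero {n : ℕ} (k : ℕ) (h : ℝ) (E : Finset ℕ) (S : Finset (Fin n))
    (x r : Fin n → ℝ) {A : Finset ℕ} (hA : n < A.card) : corrCoeff k h E S x r A = 0 := by
  unfold corrCoeff
  rw [integral_congr_ae (g := fun _ => 0) (Filter.Eventually.of_forall fun z => if_neg fun he => ?_)]
  · simp
  · have := oddHits_card_le E S (fun i => dyadicIdx k ((z - x i) / r i))
    rw [he] at this
    omega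

theorem abs_corrCoeff_le_integral {n : ℕ} {k : ℕ} {h : ℝ} (hh : 0 ≤ h) (E : Finset ℕ)
    (S : Finset (Fin n)) (x r : Fin n → ℝ) (A : Finset ℕ) :
    |corrCoeff k h E S x r A| ≤
      ∫ z in Icc (0 : ℝ) 6, if oddHits E S (fun i => dyadicIdx k ((z - x i) / r i)) = A then
        ∏ i, stepFun k h E ((z - x i) / r i) else 0 := by
  refine (abs_integral_le_integral_abs).trans_eq ?_
  simp_rw [abs_coeffFun hh]

theorem sum_abs_corrCoeff_le {n : ℕ} {k : ℕ} {h : ℝ} (hh : 0 ≤ h) (E : Finset ℕ)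
    (S : Finset (Fin n)) (x r : Fin n → ℝ) :
    ∑ A ∈ E.powerset, |corrCoeff k h E S x r A| ≤ prodInt k h E x r := by
  refine (Finset.sum_le_sum fun A _ => abs_corrCoeff_le_integral hh E S x r A).trans_eq ?_
  rw [← integral_finsetSum]
  · unfold prodInt
    congr 1
    funext z
    rw [Finset.sum_ite_eq, if_pos (Finset.mem_powerset.2 (oddHits_subset _ _ _))]
  · intro A _
    refine integrableOn_of_abs_le (C := h ^ n) ?_ (fun z => ?_) 0 6
    · refine Measurable.ite (measurableSet_oddHits_eq k E S x r A) ?_ measurable_const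
      exact Finset.measurable_fun_prod _ fun i _ => (measurable_stepFun k h E).comp
        ((measurable_id.sub_const _).div_const _)
    · rw [← abs_coeffFun hh, abs_abs]
      exact abs_coeffFun_le hh E S x r A z

theorem integral_dyadicIdx_eq_le {k a : ℕ} (ha : a ≠ 0) {x r : ℝ} (hr : r ∈ Icc (1 : ℝ) 2) :
    ∫ z in Icc (0 : ℝ) 6, (if dyadicIdx k ((z - x) / r) = a then (1 : ℝ) else 0) ≤
      2 * ((2 : ℝ) ^ k)⁻¹ := by
  have hk : (0 : ℝ) < 2 ^ k := by positivity
  have h1 : ∫ y, (Ico ((a : ℝ) / 2 ^ k) ((a + 1) / 2 ^ k)).indicator (fun _ => (1 : ℝ)) y =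
      ((2 : ℝ) ^ k)⁻¹ := by
    rw [integral_indicator measurableSet_Ico]
    simp only [integral_const, MeasurableSet.univ, measureReal_restrict_apply, univ_inter,
      smul_eq_mul, mul_one, Real.volume_real_Ico]
    rw [← sub_div, add_sub_cancel_left, max_eq_left (by positivity), one_div]
  rw [← h1]
  refine le_trans (le_of_eq ?_) (integral_comp_affine_le (x := x)
    (((integrableOn_const (C := (1 : ℝ)) (by simp)).integrable_indicator measurableSet_Ico))
      (fun y => indicator_nonneg (fun _ _ => zero_le_one) y) hr (Icc 0 6))
  congr 1
  funext z
  simp only [indicator, mem_Ico, dyadicIdx_eq_iff ha]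

theorem abs_corrCoeff_le {n : ℕ} {s C₀ : ℝ} {k : ℕ} {h : ℝ} {E : Finset ℕ}
    (hE : LevelRegular s C₀ k h E) (S : Finset (Fin n)) {x r : Fin n → ℝ}
    (hr : ∀ i, r i ∈ Icc (1 : ℝ) 2) {A : Finset ℕ} (hA : A ⊆ E) (hA0 : A.Nonempty) :
    |corrCoeff k h E S x r A| ≤ 2 * n * (((2 : ℝ) ^ k)⁻¹ * h ^ n) := by
  have hh : 0 ≤ h := by linarith [hE.one_le]
  obtain ⟨a, ha⟩ := hA0
  have ha0 : a ≠ 0 := by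
    have := (Finset.mem_Ico.1 (hE.subset (hA ha))).1
    have : 0 < 2 ^ k := by positivity
    omega
  have hmeas : ∀ i, Measurable fun z : ℝ =>
      if dyadicIdx k ((z - x i) / r i) = a then (1 : ℝ) else 0 := fun i =>
    Measurable.ite (((measurable_dyadicIdx k).comp ((measurable_id.sub_const _).div_const _))
      (measurableSet_singleton a)) measurable_const measurable_const
  have hInt : ∀ i, IntegrableOn (fun z : ℝ =>
      if dyadicIdx k ((z - x i) / r i) = a then (1 : ℝ) else 0) (Icc 0 6) := fun i =>
    integrableOn_of_abs_le (hmeas i) (C := 1) (fun z => by split_ifs <;> simp) 0 6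
  calc _ ≤ _ := abs_corrCoeff_le_integral hh E S x r A
    _ ≤ ∫ z in Icc (0 : ℝ) 6, h ^ n *
        ∑ i, if dyadicIdx k ((z - x i) / r i) = a then (1 : ℝ) else 0 := by
      refine integral_mono_of_nonneg (Filter.Eventually.of_forall fun z => ?_)
        ((integrable_finsetSum _ fun i _ => hInt i).const_mul _)
        (Filter.Eventually.of_forall fun z => ?_)
      · dsimp only [Pi.zero_apply]
        split_ifs
        · exact prod_stepFun_nonneg hh E x r z
        · exact le_rfl
      · have hs0 : ∀ i ∈ Finset.univ, (0 : ℝ) ≤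
            if dyadicIdx k ((z - x i) / r i) = a then (1 : ℝ) else 0 := fun i _ => by
          split_ifs <;> simp
        dsimp only
        split_ifs with hq
        · have h1 : a ∈ oddHits E S (fun i => dyadicIdx k ((z - x i) / r i)) := hq ▸ ha
          obtain ⟨i, hi⟩ := Finset.card_pos.1 (Finset.mem_filter.1 h1).2.pos
          have hi2 := (Finset.mem_filter.1 hi).2
          refine (prod_stepFun_le hh E x r z).trans (le_mul_of_one_le_right (by positivity) ?_)
          refine le_trans ?_ (Finset.single_le_sum hs0 (Finset.mem_univ i))
          rw [if_pos hi2]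
        · exact mul_nonneg (by positivity) (Finset.sum_nonneg hs0)
    _ = h ^ n * ∑ i, ∫ z in Icc (0 : ℝ) 6,
        if dyadicIdx k ((z - x i) / r i) = a then (1 : ℝ) else 0 := by
      rw [integral_const_mul, integral_finsetSum _ fun i _ => hInt i]
    _ ≤ h ^ n * ∑ _i : Fin n, 2 * ((2 : ℝ) ^ k)⁻¹ := by
      gcongr with i
      exact integral_dyadicIdx_eq_le ha0 (hr i)
    _ = _ := by simp; ring

theorem sum_sq_corrCoeff_le {n : ℕ} {s C₀ : ℝ} {k : ℕ} {h : ℝ} {E : Finset ℕ}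
    (hE : LevelRegular s C₀ k h E) (S : Finset (Fin n)) {x r : Fin n → ℝ}
    (hr : ∀ i, r i ∈ Icc (1 : ℝ) 2) :
    ∑ A ∈ E.powerset, (if A = ∅ then 0 else corrCoeff k h E S x r A) ^ 2 ≤
      2 * n * (((2 : ℝ) ^ k)⁻¹ * h ^ n) * prodInt k h E x r := by
  have hh : 0 ≤ h := by linarith [hE.one_le]
  calc _ ≤ ∑ A ∈ E.powerset, 2 * n * (((2 : ℝ) ^ k)⁻¹ * h ^ n) * |corrCoeff k h E S x r A| := by
        refine Finset.sum_le_sum fun A hA => ?_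
        split_ifs with h0
        · rw [sq, zero_mul]; positivity
        · rw [← sq_abs, sq]
          gcongr
          exact abs_corrCoeff_le hE S hr (Finset.mem_powerset.1 hA)
            (Finset.nonempty_iff_ne_empty.2 h0)
    _ ≤ _ := by
      rw [← Finset.mul_sum]
      gcongr
      exact sum_abs_corrCoeff_le hh E S x r

theorem abs_corrCoeff_empty_le {n : ℕ} {s C₀ : ℝ} {k : ℕ} {h : ℝ} {E : Finset ℕ} (hs0 : 0 ≤ s)
    (hs1 : s ≤ 1) (hE : LevelRegular s C₀ k h E) (hC₀ : 0 ≤ C₀) {S : Finset (Fin n)}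
    (hS : S.Nonempty) {x r : Fin n → ℝ} (hx : ∀ i, x i ∈ Icc (0 : ℝ) 1)
    (hr : ∀ i, r i ∈ Icc (1 : ℝ) 2) :
    |corrCoeff k h E S x r ∅| ≤ 64 * C₀ * (((2 : ℝ) ^ k)⁻¹ * h ^ n) * weight s k x := by
  have hh : 0 ≤ h := by linarith [hE.one_le]
  have hn : 0 < n := by
    obtain ⟨i, _⟩ := hS
    exact i.pos
  set δ : ℝ := ((2 : ℝ) ^ k)⁻¹ with hδ
  have hδ0 : 0 < δ := by positivity
  let N : Fin n × Fin n → ℝ → ℝ := fun p z =>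
    if dyadicIdx k ((z - x p.1) / r p.1) = dyadicIdx k ((z - x p.2) / r p.2)
        then stepFun k h E ((z - x p.1) / r p.1) else 0
  have hN0 : ∀ p z, 0 ≤ N p z := fun p z => by
    dsimp only [N]; split_ifs
    · exact stepFun_nonneg hh E _
    · exact le_rfl
  have hNint : ∀ p, IntegrableOn (N p) (Icc 0 6) := fun p => by
    have hm (i : Fin n) : Measurable fun z : ℝ => dyadicIdx k ((z - x i) / r i) :=
      (measurable_dyadicIdx k).comp ((measurable_id.sub_const _).div_const _)
    refine integrableOn_of_abs_le (C := h) ?_ (fun z => ?_) 0 6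
    · exact Measurable.ite (measurableSet_eq_fun (hm _) (hm _)) ((measurable_stepFun k h E).comp
        ((measurable_id.sub_const _).div_const _)) measurable_const
    · rw [abs_of_nonneg (hN0 p z)]
      dsimp only [N]; split_ifs
      · exact stepFun_le hh E _
      · exact hh
  calc _ ≤ _ := abs_corrCoeff_le_integral hh E S x r ∅
    _ ≤ ∫ z in Icc (0 : ℝ) 6, h ^ (n - 1) *
        ∑ p ∈ (Finset.univ : Finset (Fin n)).offDiag, N p z := by
      refine integral_mono_of_nonneg (Filter.Eventually.of_forall fun z => ?_)
        ((integrable_finsetSum _ fun p _ => hNint p).const_mul _)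
        (Filter.Eventually.of_forall fun z => ?_)
      · dsimp only [Pi.zero_apply]
        split_ifs
        · exact prod_stepFun_nonneg hh E x r z
        · exact le_rfl
      · have hR : 0 ≤ h ^ (n - 1) * ∑ p ∈ (Finset.univ : Finset (Fin n)).offDiag, N p z :=
          mul_nonneg (by positivity) (Finset.sum_nonneg fun p _ => hN0 p z)
        dsimp only
        split_ifs with hq
        · by_cases hv : ∀ i, dyadicIdx k ((z - x i) / r i) ∈ E
          · obtain ⟨i, j, hij, he⟩ := exists_ne_of_oddHits_eq_empty hv hS hq
            have h1 : N (i, j) z ≤ ∑ p ∈ (Finset.univ : Finset (Fin n)).offDiag, N p z :=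
              Finset.single_le_sum (f := fun p => N p z) (fun p _ => hN0 p z) (by simpa using hij)
            refine le_trans ?_ (mul_le_mul_of_nonneg_left h1 (by positivity))
            rw [show N (i, j) z = h by dsimp only [N]; rw [if_pos he, stepFun, if_pos (hv i)],
              ← pow_succ, Nat.sub_add_cancel hn]
            exact prod_stepFun_le hh E x r z
          · push Not at hv
            obtain ⟨i, hi⟩ := hv
            rw [Finset.prod_eq_zero (Finset.mem_univ i) (if_neg hi)]
            exact hR
        · exact hR
    _ = h ^ (n - 1) * ∑ p ∈ (Finset.univ : Finset (Fin n)).offDiag,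
        ∫ z in Icc (0 : ℝ) 6, N p z := by
      rw [integral_const_mul, integral_finsetSum _ fun p _ => hNint p]
    _ ≤ h ^ (n - 1) * ∑ p ∈ (Finset.univ : Finset (Fin n)).offDiag,
        64 * C₀ * ((h * δ) * (|x p.1 - x p.2| + δ) ^ (-s)) := by
      gcongr with p
      refine (integral_near_le hs0 hs1 hE hC₀ (hx _) (hx _) (hr _) (hr _)).trans ?_
      rw [Real.div_rpow hδ0.le (by positivity), Real.rpow_neg (by positivity), div_eq_mul_inv]
      gcongr
      exact hE.scale_le
    _ = 64 * C₀ * (δ * h ^ n) * ∑ p ∈ (Finset.univ : Finset (Fin n)).offDiag,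
        (|x p.1 - x p.2| + δ) ^ (-s) := by
      rw [← Finset.mul_sum, ← Finset.mul_sum]
      have : h ^ n = h ^ (n - 1) * h := by rw [← pow_succ, Nat.sub_add_cancel hn]
      rw [this]
      ring
    _ ≤ _ := by
      unfold weight
      gcongr
      linarith

/-- The moments of a correlation integral about its mean. -/
theorem signAvg_corr_sub_pow_le {n : ℕ} {s C₀ : ℝ} {k : ℕ} {h : ℝ} {E : Finset ℕ}
    (hE : LevelRegular s C₀ k h E) (S : Finset (Fin n)) {x r : Fin n → ℝ}
    (hr : ∀ i, r i ∈ Icc (1 : ℝ) 2) (j : ℕ) :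
    signAvg E (fun B => (corr k h E B S x r - corrCoeff k h E S x r ∅) ^ 2 ^ (j + 1)) ≤
      ((2 ^ (j + 1) - 1) ^ n * (2 * n * (((2 : ℝ) ^ k)⁻¹ * h ^ n) * prodInt k h E x r)) ^ 2 ^ j := by
  have hh : 0 ≤ h := by linarith [hE.one_le]
  have hK : (0 : ℝ) ≤ 2 ^ (j + 1) - 1 := by
    have : (1 : ℝ) ≤ 2 ^ (j + 1) := one_le_pow₀ (by norm_num)
    linarith
  have h1 : ∀ B, corr k h E B S x r - corrCoeff k h E S x r ∅ =
      walsh E (fun A => if A = ∅ then 0 else corrCoeff k h E S x r A) B := fun B => by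
    rw [corr_eq_walsh hh]
    unfold walsh
    rw [sub_eq_iff_eq_add, ← Finset.sum_erase_add _ _ (Finset.empty_mem_powerset E),
      ← Finset.sum_erase_add (a := ∅) (f := fun A => (if A = ∅ then 0 else _) * _) _
        (Finset.empty_mem_powerset E)]
    simp only [if_true, add_zero, Finset.empty_inter, Finset.card_empty, pow_zero,
      mul_one]
    congr 1
    refine Finset.sum_congr rfl fun A hA => ?_
    rw [if_neg (Finset.ne_of_mem_erase hA)]
  simp_rw [h1]
  refine (signAvg_walsh_pow_le j E n _ fun A hA hcard => ?_).trans ?_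
  · split_ifs
    · rfl
    · exact corrCoeff_eq_zero k h E S x r hcard
  · refine pow_le_pow_left₀ (mul_nonneg (by positivity)
      (Finset.sum_nonneg fun _ _ => sq_nonneg _)) ?_ _
    gcongr
    exact sum_sq_corrCoeff_le hE S hr

theorem abs_prod_sub_prod_le {ι : Type*} (T : Finset ι) {a b : ι → ℝ} {h : ℝ} (hh : 1 ≤ h)
    (ha : ∀ i, |a i| ≤ h) (hb : ∀ i, |b i| ≤ h) :
    |∏ i ∈ T, a i - ∏ i ∈ T, b i| ≤ h ^ T.card * ∑ i ∈ T, |a i - b i| := by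
  classical
  induction T using Finset.induction_on with
  | empty => simp
  | insert v T hv ih =>
    rw [Finset.prod_insert hv, Finset.prod_insert hv, Finset.sum_insert hv,
      Finset.card_insert_of_notMem hv]
    have e : a v * ∏ i ∈ T, a i - b v * ∏ i ∈ T, b i =
        (a v - b v) * ∏ i ∈ T, a i + b v * (∏ i ∈ T, a i - ∏ i ∈ T, b i) := by ring
    have h1 : |∏ i ∈ T, a i| ≤ h ^ T.card := by
      rw [Finset.abs_prod, ← Finset.prod_const]
      exact Finset.prod_le_prod (fun i _ => abs_nonneg _) fun i _ => ha i
    rw [e]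
    calc _ ≤ |a v - b v| * |∏ i ∈ T, a i| + |b v| * |∏ i ∈ T, a i - ∏ i ∈ T, b i| := by
          rw [← abs_mul, ← abs_mul]; exact abs_add_le _ _
      _ ≤ |a v - b v| * h ^ (T.card + 1) + h * (h ^ T.card * ∑ i ∈ T, |a i - b i|) := by
          gcongr
          · exact h1.trans (pow_le_pow_right₀ hh (Nat.le_succ _))
          · exact hb v
      _ = _ := by ring

theorem dyadicIdx_succ_div_two (k : ℕ) (y : ℝ) : dyadicIdx (k + 1) y / 2 = dyadicIdx k y := by
  unfold dyadicIdx
  rw [← Nat.floor_div_ofNat, pow_succ]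
  congr 1
  rw [mul_assoc, mul_comm 2 y, ← mul_assoc, mul_div_assoc, div_self (by norm_num), mul_one]

theorem integral_abs_indicator_sub_le (l u l' u' a b : ℝ) :
    ∫ z in Icc a b, |(Ico l u).indicator (fun _ => (1 : ℝ)) z -
      (Ico l' u').indicator (fun _ => (1 : ℝ)) z| ≤ |l - l'| + |u - u'| := by
  have hi (p q : ℝ) : Integrable ((uIcc p q).indicator (fun _ => (1 : ℝ))) :=
    (integrableOn_const (C := (1 : ℝ)) (by
      rw [uIcc, Real.volume_Icc]; exact ENNReal.ofReal_ne_top)).integrable_indicator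
      measurableSet_uIcc
  have hv (p q : ℝ) : ∫ z in Icc a b, (uIcc p q).indicator (fun _ => (1 : ℝ)) z ≤ |p - q| := by
    refine (setIntegral_le_integral (hi p q) (Filter.Eventually.of_forall fun z =>
      indicator_nonneg (fun _ _ => zero_le_one) z)).trans_eq ?_
    rw [integral_indicator measurableSet_uIcc]
    simp only [integral_const, MeasurableSet.univ, measureReal_restrict_apply, univ_inter,
      smul_eq_mul, mul_one, uIcc, Real.volume_real_Icc]
    rw [max_sub_min_eq_abs', max_eq_left (abs_nonneg _)]
  calc _ ≤ ∫ z in Icc a b, ((uIcc l l').indicator (fun _ => (1 : ℝ)) z +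
        (uIcc u u').indicator (fun _ => (1 : ℝ)) z) := by
        refine integral_mono_of_nonneg (Filter.Eventually.of_forall fun z => abs_nonneg _)
          ((hi _ _).integrableOn.add (hi _ _).integrableOn) (Filter.Eventually.of_forall fun z => ?_)
        simp only [indicator, mem_Ico, mem_uIcc]
        split_ifs <;> norm_num <;> grind
    _ ≤ _ := by
      rw [integral_add (hi _ _).integrableOn (hi _ _).integrableOn]
      exact add_le_add (hv _ _) (hv _ _)

/-- Step functions of the dyadic index depend continuously in `L¹` on the affine parameters. -/
theorem integral_abs_step_sub_le {K : ℕ} {h : ℝ} {F : ℕ → ℝ}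
    (hF : ∀ a, |F a| ≤ h) (hF0 : ∀ a, a ∉ Finset.Ico (2 ^ K) (2 ^ (K + 1)) → F a = 0)
    {x x' r r' η : ℝ} (hr : r ∈ Icc (1 : ℝ) 2) (hr' : r' ∈ Icc (1 : ℝ) 2)
    (hx : |x - x'| ≤ η) (hrr : |r - r'| ≤ η) (p q : ℝ) :
    ∫ z in Icc p q, |F (dyadicIdx K ((z - x) / r)) - F (dyadicIdx K ((z - x') / r'))| ≤
      2 ^ K * (h * (6 * η)) := by
  have hη : 0 ≤ η := (abs_nonneg _).trans hx
  have hh : 0 ≤ h := (abs_nonneg _).trans (hF 0)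
  have hKp : (0 : ℝ) < 2 ^ K := by positivity
  let J : ℝ → ℝ → ℕ → ℝ → ℝ := fun x r a =>
    (Ico (x + r * (a / 2 ^ K)) (x + r * ((a + 1) / 2 ^ K))).indicator (fun _ => (1 : ℝ))
  have hrep : ∀ x r z : ℝ, r ∈ Icc (1 : ℝ) 2 → F (dyadicIdx K ((z - x) / r)) =
      ∑ a ∈ Finset.Ico (2 ^ K) (2 ^ (K + 1)), F a * J x r a z := by
    intro x r z hr
    have hr0 : 0 < r := by linarith [hr.1]
    have h1 : ∀ a ∈ Finset.Ico (2 ^ K) (2 ^ (K + 1)), F a * J x r a z =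
        if dyadicIdx K ((z - x) / r) = a then F a else 0 := by
      intro a ha
      have ha0 : a ≠ 0 := by
        have := (Finset.mem_Ico.1 ha).1
        have : 0 < 2 ^ K := by positivity
        omega
      have : z ∈ Ico (x + r * (a / 2 ^ K)) (x + r * ((a + 1) / 2 ^ K)) ↔
          dyadicIdx K ((z - x) / r) = a := by
        rw [dyadicIdx_eq_iff ha0, mem_Ico, le_div_iff₀ hr0, div_lt_iff₀ hr0]
        constructor <;> rintro ⟨h1, h2⟩ <;> constructor <;> linarith
      simp only [J, indicator, this]
      split_ifs <;> simp
    rw [Finset.sum_congr rfl h1, Finset.sum_ite_eq]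
    split_ifs with hm
    · rfl
    · exact hF0 _ hm
  have hJm : ∀ x r a, Measurable (J x r a) := fun x r a =>
    measurable_const.indicator measurableSet_Ico
  have hJi : ∀ a, IntegrableOn (fun z => |F a| * |J x r a z - J x' r' a z|) (Icc p q) := fun a => by
    have hm : Measurable fun z => |J x r a z - J x' r' a z| := ((hJm x r a).sub (hJm x' r' a)).abs
    refine (integrableOn_of_abs_le (C := 1) hm (fun z => ?_) p q).const_mul _
    simp only [J, indicator]
    split_ifs <;> norm_num
  calc _ ≤ ∫ z in Icc p q, ∑ a ∈ Finset.Ico (2 ^ K) (2 ^ (K + 1)),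
        |F a| * |J x r a z - J x' r' a z| := by
        refine integral_mono_of_nonneg (Filter.Eventually.of_forall fun z => abs_nonneg _)
          (integrable_finsetSum _ fun a _ => hJi a) (Filter.Eventually.of_forall fun z => ?_)
        dsimp only
        rw [hrep x r z hr, hrep x' r' z hr', ← Finset.sum_sub_distrib]
        refine (Finset.abs_sum_le_sum_abs _ _).trans_eq (Finset.sum_congr rfl fun a _ => ?_)
        rw [← abs_mul, mul_sub]
    _ = ∑ a ∈ Finset.Ico (2 ^ K) (2 ^ (K + 1)), |F a| *
        ∫ z in Icc p q, |J x r a z - J x' r' a z| := by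
        rw [integral_finsetSum _ fun a _ => hJi a]
        exact Finset.sum_congr rfl fun a _ => integral_const_mul _ _
    _ ≤ ∑ a ∈ Finset.Ico (2 ^ K) (2 ^ (K + 1)), h * (6 * η) := by
        gcongr with a ha
        · exact hF a
        · refine (integral_abs_indicator_sub_le _ _ _ _ _ _).trans ?_
          have ha' := Finset.mem_Ico.1 ha
          have hend : ∀ c : ℝ, 0 ≤ c → c ≤ 2 → |(x + r * c) - (x' + r' * c)| ≤ 3 * η := by
            intro c hc0 hc2
            have : (x + r * c) - (x' + r' * c) = (x - x') + (r - r') * c := by ring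
            rw [this]
            refine (abs_add_le _ _).trans ?_
            rw [abs_mul, abs_of_nonneg hc0]
            nlinarith [abs_nonneg (r - r')]
          have h2 : ((a : ℝ) + 1) ≤ 2 * 2 ^ K := by
            rw [← pow_succ']; exact_mod_cast ha'.2
          have e1 := hend (a / 2 ^ K) (by positivity) (by rw [div_le_iff₀ hKp]; linarith)
          have e2 := hend ((a + 1) / 2 ^ K) (by positivity) (by rw [div_le_iff₀ hKp]; linarith)
          linarith
    _ = _ := by
        rw [Finset.sum_const, Nat.card_Ico, nsmul_eq_mul, pow_succ, mul_two, Nat.add_sub_cancel]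
        push_cast
        ring

theorem corr_sub_le {n k : ℕ} {h : ℝ} {E : Finset ℕ} (hh : 1 ≤ h)
    (hE : E ⊆ Finset.Ico (2 ^ k) (2 ^ (k + 1))) (hk : h ≤ 2 ^ (k + 1)) (B : Finset ℕ)
    (S : Finset (Fin n)) {x x' r r' : Fin n → ℝ} {η : ℝ} (hη : η = ((2 : ℝ) ^ (3 * k + 24 * n))⁻¹)
    (hr : ∀ i, r i ∈ Icc (1 : ℝ) 2) (hr' : ∀ i, r' i ∈ Icc (1 : ℝ) 2)
    (hx : ∀ i, |x i - x' i| ≤ η) (hrr : ∀ i, |r i - r' i| ≤ η) :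
    |corr k h E B S x r - corr k h E B S x' r'| ≤ ((2 : ℝ) ^ k)⁻¹ * h ^ n := by
  have hh0 : 0 ≤ h := by linarith
  have hInt : ∀ x r, IntegrableOn (corrFun k h E B S x r) (Icc 0 6) := fun x r =>
    integrableOn_of_abs_le (measurable_corrFun k h E B S x r) (C := h ^ n) (fun z => by
      rw [abs_corrFun hh0]; exact prod_stepFun_le hh0 E x r z) 0 6
  let F : Fin n → ℕ → ℝ := fun i a =>
    if i ∈ S then (if a / 2 ∈ E then h else 0) * (-1) ^ a * (if a / 2 ∈ B then -1 else 1)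
    else if a / 2 ∈ E then h else 0
  have hfac : ∀ i y, (if i ∈ S then signedStep k h E B y else stepFun k h E y) =
      F i (dyadicIdx (k + 1) y) := by
    intro i y
    simp only [F, signedStep, stepFun, haarSign, dyadicIdx_succ_div_two]
  have hFh : ∀ i a, |F i a| ≤ h := by
    intro i a
    simp only [F]
    split_ifs <;> simp [abs_mul, abs_of_nonneg hh0, hh0]
  have hF0 : ∀ i a, a ∉ Finset.Ico (2 ^ (k + 1)) (2 ^ (k + 1 + 1)) → F i a = 0 := by
    intro i a ha
    have : a / 2 ∉ E := fun hm => ha <| by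
      have := Finset.mem_Ico.1 (hE hm)
      rw [Finset.mem_Ico, pow_succ, pow_succ 2 (k + 1)]
      omega
    simp [F, this]
  have hcm : ∀ x r : ℝ, ∀ i, Measurable fun z : ℝ => F i (dyadicIdx (k + 1) ((z - x) / r)) :=
    fun x r i => (measurable_of_countable (F i)).comp ((measurable_dyadicIdx (k + 1)).comp
      ((measurable_id.sub_const _).div_const _))
  have hint2 : ∀ i, IntegrableOn (fun z => |F i (dyadicIdx (k + 1) ((z - x i) / r i)) -
      F i (dyadicIdx (k + 1) ((z - x' i) / r' i))|) (Icc 0 6) := fun i =>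
    integrableOn_of_abs_le ((hcm _ _ i).sub (hcm _ _ i)).abs (C := h + h) (fun z => by
      rw [abs_abs]; exact (abs_sub _ _).trans (add_le_add (hFh _ _) (hFh _ _))) 0 6
  unfold corr
  rw [← integral_sub (hInt x r) (hInt x' r')]
  calc _ ≤ ∫ z in Icc (0 : ℝ) 6, |corrFun k h E B S x r z - corrFun k h E B S x' r' z| :=
        abs_integral_le_integral_abs
    _ ≤ ∫ z in Icc (0 : ℝ) 6, h ^ n * ∑ i, |F i (dyadicIdx (k + 1) ((z - x i) / r i)) -
      F i (dyadicIdx (k + 1) ((z - x' i) / r' i))| := by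
        refine integral_mono_of_nonneg (Filter.Eventually.of_forall fun z => abs_nonneg _)
          ((integrable_finsetSum _ fun i _ => hint2 i).const_mul _)
          (Filter.Eventually.of_forall fun z => ?_)
        dsimp only [corrFun]
        simp only [hfac]
        have := abs_prod_sub_prod_le (Finset.univ : Finset (Fin n)) hh
          (a := fun i => F i (dyadicIdx (k + 1) ((z - x i) / r i)))
          (b := fun i => F i (dyadicIdx (k + 1) ((z - x' i) / r' i))) (fun i => hFh _ _)
          (fun i => hFh _ _)
        simpa using this
    _ = h ^ n * ∑ i, ∫ z in Icc (0 : ℝ) 6, |F i (dyadicIdx (k + 1) ((z - x i) / r i)) -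
      F i (dyadicIdx (k + 1) ((z - x' i) / r' i))| := by
        rw [integral_const_mul, integral_finsetSum _ fun i _ => hint2 i]
    _ ≤ h ^ n * ∑ _i : Fin n, 2 ^ (k + 1) * (2 ^ (k + 1) * (6 * η)) := by
        gcongr with i
        refine (integral_abs_step_sub_le (hFh i) (hF0 i) (hr i) (hr' i) (hx i) (hrr i) 0 6).trans ?_
        have : 0 ≤ η := by rw [hη]; positivity
        gcongr
    _ = (24 * n * ((2 : ℝ) ^ (24 * n))⁻¹) * (((2 : ℝ) ^ k)⁻¹ * h ^ n) := by
        simp only [Finset.sum_const, Finset.card_univ, Fintype.card_fin, nsmul_eq_mul]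
        have h3 : (2 : ℝ) ^ (3 * k) = (2 ^ k) ^ 3 := by rw [mul_comm, pow_mul]
        rw [hη, pow_add 2 (3 * k), h3, pow_succ (2 : ℝ) k]
        have hZ : (2 : ℝ) ^ (24 * n) ≠ 0 := by positivity
        generalize (2 : ℝ) ^ (24 * n) = Z at hZ ⊢
        field_simp
        ring
    _ ≤ 1 * (((2 : ℝ) ^ k)⁻¹ * h ^ n) := by
        gcongr
        rw [mul_inv_le_iff₀ (by positivity), one_mul]
        exact_mod_cast (Nat.lt_two_pow_self (n := 24 * n)).le
    _ = _ := one_mul _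

theorem corr_empty {n k : ℕ} (h : ℝ) (E B : Finset ℕ) (x r : Fin n → ℝ) :
    corr k h E B ∅ x r = prodInt k h E x r := by
  simp [corr, corrFun, prodInt]

theorem one_le_weight {n : ℕ} (s : ℝ) (k : ℕ) (x : Fin n → ℝ) : 1 ≤ weight s k x := by
  unfold weight
  have : 0 ≤ ∑ p ∈ (Finset.univ : Finset (Fin n)).offDiag,
      (|x p.1 - x p.2| + ((2 : ℝ) ^ k)⁻¹) ^ (-s) :=
    Finset.sum_nonneg fun p _ => by positivity
  linarith

theorem weight_mono {n : ℕ} {s : ℝ} (hs : 0 ≤ s) (k : ℕ) (x : Fin n → ℝ) :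
    weight s k x ≤ weight s (k + 1) x := by
  unfold weight
  gcongr 1 + ∑ p ∈ _, ?_ with p
  refine Real.rpow_le_rpow_of_nonpos (by positivity) ?_ (by linarith)
  gcongr
  · norm_num
  · exact Nat.le_succ k

theorem weight_le_two_mul {n : ℕ} {s : ℝ} (hs0 : 0 ≤ s) (hs1 : s ≤ 1) {k : ℕ} {x x' : Fin n → ℝ}
    {η : ℝ} (hη : 4 * η ≤ ((2 : ℝ) ^ k)⁻¹) (hx : ∀ i, |x i - x' i| ≤ η) :
    weight s k x' ≤ 2 * weight s k x := by
  set δ : ℝ := ((2 : ℝ) ^ k)⁻¹ with hδ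
  have hδ0 : 0 < δ := by positivity
  unfold weight
  rw [mul_add, Finset.mul_sum]
  gcongr ?_ + ∑ p ∈ _, ?_ with p
  · norm_num
  · have h1 : (|x p.1 - x p.2| + δ) / 2 ≤ |x' p.1 - x' p.2| + δ := by
      have : |x p.1 - x p.2| ≤ |x p.1 - x' p.1| + |x' p.1 - x' p.2| + |x p.2 - x' p.2| := by
        rw [abs_sub_comm (x p.2)]
        have := abs_add_le (x p.1 - x' p.1 + (x' p.1 - x' p.2)) (x' p.2 - x p.2)
        have h2 := abs_add_le (x p.1 - x' p.1) (x' p.1 - x' p.2)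
        have e : x p.1 - x' p.1 + (x' p.1 - x' p.2) + (x' p.2 - x p.2) = x p.1 - x p.2 := by ring
        rw [e] at this
        linarith
      have := hx p.1
      have := hx p.2
      have := abs_nonneg (x' p.1 - x' p.2)
      linarith
    refine (Real.rpow_le_rpow_of_nonpos (by positivity) h1 (by linarith)).trans ?_
    rw [Real.div_rpow (by positivity) (by norm_num), div_eq_mul_inv, mul_comm]
    gcongr
    rw [← Real.rpow_neg (by norm_num), neg_neg]
    calc (2 : ℝ) ^ s ≤ 2 ^ (1 : ℝ) := Real.rpow_le_rpow_of_exponent_le (by norm_num) hs1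
      _ = 2 := Real.rpow_one _

/-- The correlation estimate enjoyed by a good choice of signs. -/
def CorrBound (n : ℕ) (s C ε : ℝ) (k : ℕ) (h : ℝ) (E B : Finset ℕ) : Prop :=
  ∀ S : Finset (Fin n), S.Nonempty → ∀ x r : Fin n → ℝ, (∀ i, x i ∈ Icc (0 : ℝ) 1) →
    (∀ i, r i ∈ Icc (1 : ℝ) 2) → |corr k h E B S x r| ≤
      C * 2 ^ (ε * k) * (((2 : ℝ) ^ k)⁻¹ * h ^ n) * weight s k x +
      √(C * 2 ^ (ε * k) * (((2 : ℝ) ^ k)⁻¹ * h ^ n) *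
        (prodInt k h E x r + ((2 : ℝ) ^ k)⁻¹ * h ^ n + 1))

theorem CorrBound.mono {n : ℕ} {s C C' ε : ℝ} {k : ℕ} {h : ℝ} {E B : Finset ℕ} (hh : 0 ≤ h)
    (hB : CorrBound n s C ε k h E B) (hC : C ≤ C') : CorrBound n s C' ε k h E B := by
  intro S hS x r hx hr
  have h0 := prodInt_nonneg (k := k) hh E x r
  have h1 := one_le_weight s k x
  refine (hB S hS x r hx hr).trans ?_
  gcongr

theorem exists_near_grid (N : ℕ) (hN : 0 < N) {y : ℝ} (hy : y ∈ Icc (0 : ℝ) 1) :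
    ∃ a : Fin (N + 1), |y - (a : ℕ) / N| ≤ (N : ℝ)⁻¹ := by
  have hN' : (0 : ℝ) < N := by exact_mod_cast hN
  have h1 : ⌊y * N⌋₊ ≤ N := by
    refine Nat.floor_le_of_le ?_
    nlinarith [hy.2]
  refine ⟨⟨⌊y * N⌋₊, by omega⟩, ?_⟩
  have h2 := Nat.floor_le (show 0 ≤ y * N from mul_nonneg hy.1 hN'.le)
  have h3 := Nat.lt_floor_add_one (y * N)
  have e : y - (⌊y * N⌋₊ : ℝ) / N = (y * N - ⌊y * N⌋₊) * (N : ℝ)⁻¹ := by field_simp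
  dsimp only
  rw [e, abs_mul, abs_of_nonneg (by linarith), abs_of_pos (by positivity)]
  exact mul_le_of_le_one_left (by positivity) (by linarith)

/-- The parameter in `[0, 1]` with grid index `a`. -/
noncomputable def gridPt (L : ℕ) (a : Fin (2 ^ L + 1)) : ℝ := (a : ℕ) / (2 ^ L : ℕ)

theorem gridPt_mem (L : ℕ) (a : Fin (2 ^ L + 1)) : gridPt L a ∈ Icc (0 : ℝ) 1 := by
  unfold gridPt
  have h : (0 : ℝ) < (2 ^ L : ℕ) := by positivity
  refine ⟨by positivity, ?_⟩
  rw [div_le_one h]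
  exact_mod_cast Nat.lt_succ_iff.1 a.2

/-- The normalised deviation whose average is controlled by hypercontractivity. -/
noncomputable def deviation {n : ℕ} (k : ℕ) (h : ℝ) (E : Finset ℕ) (X : ℝ) (j L : ℕ)
    (i : (Fin n → Fin (2 ^ L + 1)) × (Fin n → Fin (2 ^ L + 1)) × Finset (Fin n))
    (B : Finset ℕ) : ℝ :=
  (corr k h E B i.2.2 (fun l => gridPt L (i.1 l)) (fun l => 1 + gridPt L (i.2.1 l)) -
    corrCoeff k h E i.2.2 (fun l => gridPt L (i.1 l)) (fun l => 1 + gridPt L (i.2.1 l)) ∅) ^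
      2 ^ (j + 1) /
    (X * (((2 : ℝ) ^ k)⁻¹ * h ^ n) *
      (prodInt k h E (fun l => gridPt L (i.1 l)) (fun l => 1 + gridPt L (i.2.1 l)) + 1)) ^ 2 ^ j

theorem deviation_nonneg {n : ℕ} {k : ℕ} {h : ℝ} (hh : 0 ≤ h) (E : Finset ℕ) {X : ℝ}
    (hX : 0 ≤ X) (j L : ℕ)
    (i : (Fin n → Fin (2 ^ L + 1)) × (Fin n → Fin (2 ^ L + 1)) × Finset (Fin n))
    (B : Finset ℕ) : 0 ≤ deviation k h E X j L i B := by
  unfold deviation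
  have h1 : ∀ x r : Fin n → ℝ, 0 ≤ prodInt k h E x r := fun x r => prodInt_nonneg hh E x r
  have h2 := h1 (fun l => gridPt L (i.1 l)) (fun l => 1 + gridPt L (i.2.1 l))
  rw [pow_succ 2 j, pow_mul']
  positivity

theorem signAvg_deviation_le {n : ℕ} {s C₀ : ℝ} {k : ℕ} {h : ℝ} {E : Finset ℕ}
    (hE : LevelRegular s C₀ k h E) {X : ℝ} (hX : 0 < X) (j L : ℕ)
    (i : (Fin n → Fin (2 ^ L + 1)) × (Fin n → Fin (2 ^ L + 1)) × Finset (Fin n)) :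
    signAvg E (deviation k h E X j L i) ≤ ((2 ^ (j + 1) - 1) ^ n * (2 * n) / X) ^ 2 ^ j := by
  have hh : 0 < h := by linarith [hE.one_le]
  have hr : ∀ l, 1 + gridPt L (i.2.1 l) ∈ Icc (1 : ℝ) 2 := fun l => by
    have := gridPt_mem L (i.2.1 l)
    exact ⟨by linarith [this.1], by linarith [this.2]⟩
  have hP := prodInt_nonneg (k := k) hh.le E (fun l => gridPt L (i.1 l))
    (fun l => 1 + gridPt L (i.2.1 l))
  have h1 := signAvg_corr_sub_pow_le hE i.2.2 (x := fun l => gridPt L (i.1 l)) hr j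
  set P := prodInt k h E (fun l => gridPt L (i.1 l)) (fun l => 1 + gridPt L (i.2.1 l)) with hPdef
  set H := ((2 : ℝ) ^ k)⁻¹ * h ^ n with hH
  have hH0 : 0 < H := by positivity
  have hK : (0 : ℝ) ≤ 2 ^ (j + 1) - 1 := by
    have : (1 : ℝ) ≤ 2 ^ (j + 1) := one_le_pow₀ (by norm_num)
    linarith
  have h2 : signAvg E (deviation k h E X j L i) = signAvg E (fun B =>
      (corr k h E B i.2.2 (fun l => gridPt L (i.1 l)) (fun l => 1 + gridPt L (i.2.1 l)) -
      corrCoeff k h E i.2.2 (fun l => gridPt L (i.1 l)) (fun l => 1 + gridPt L (i.2.1 l)) ∅) ^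
      2 ^ (j + 1)) / (X * H * (P + 1)) ^ 2 ^ j := by
    unfold signAvg deviation
    rw [← Finset.sum_div, div_right_comm]
  rw [h2, div_le_iff₀ (by positivity), ← mul_pow]
  refine h1.trans (pow_le_pow_left₀ (by positivity) ?_ _)
  have : (2 ^ (j + 1) - 1) ^ n * (2 * ↑n) / X * (X * H * (P + 1)) =
      (2 ^ (j + 1) - 1) ^ n * (2 * ↑n * H * (P + 1)) := by field_simp
  rw [this]
  gcongr
  linarith

theorem corrBound_of_deviation_lt {n : ℕ} {s C₀ : ℝ} {k : ℕ} {h : ℝ} {E B : Finset ℕ}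
    (hs0 : 0 ≤ s) (hs1 : s ≤ 1) (hn : 0 < n) (hC₀ : 0 ≤ C₀)
    (hE : LevelRegular s C₀ k h E) (hk : h ≤ 2 ^ (k + 1)) {C ε : ℝ} (hC : 128 * C₀ + 1 ≤ C)
    (hε : 0 ≤ ε) (j : ℕ)
    (hB : ∀ i : (Fin n → Fin (2 ^ (3 * k + 24 * n) + 1)) × (Fin n → Fin (2 ^ (3 * k + 24 * n) + 1)) ×
      Finset (Fin n), deviation k h E (C * 2 ^ (ε * k)) j (3 * k + 24 * n) i B < 1) :
    CorrBound n s C ε k h E B := by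
  intro S hS x r hx hr
  set L := 3 * k + 24 * n with hL
  have hh : 0 < h := by linarith [hE.one_le]
  have hN : 0 < 2 ^ L := by positivity
  choose a ha using fun l => exists_near_grid (2 ^ L) hN (hx l)
  choose b hb using fun l => exists_near_grid (2 ^ L) hN (y := r l - 1)
    ⟨by linarith [(hr l).1], by linarith [(hr l).2]⟩
  have hB' := hB (a, b, S)
  unfold deviation at hB'
  dsimp only at hB'
  set x' : Fin n → ℝ := fun l => gridPt L (a l) with hx'
  set r' : Fin n → ℝ := fun l => 1 + gridPt L (b l) with hr'
  have hr2 : ∀ l, r' l ∈ Icc (1 : ℝ) 2 := fun l => by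
    have := gridPt_mem L (b l)
    exact ⟨by linarith [this.1], by linarith [this.2]⟩
  have hx2 : ∀ l, x' l ∈ Icc (0 : ℝ) 1 := fun l => gridPt_mem L (a l)
  have hxx : ∀ l, |x l - x' l| ≤ ((2 : ℝ) ^ L)⁻¹ := fun l => by
    have := ha l; push_cast at this; simpa [x', gridPt] using this
  have hrr : ∀ l, |r l - r' l| ≤ ((2 : ℝ) ^ L)⁻¹ := fun l => by
    have := hb l; push_cast at this
    have e : r l - r' l = r l - 1 - gridPt L (b l) := by simp only [r']; ring
    rw [e]; simpa [gridPt] using this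
  have hlip := fun T => corr_sub_le hE.one_le hE.subset hk B T rfl hr hr2 hxx hrr
  have hP0 := prodInt_nonneg (k := k) hh.le E x' r'
  have hPx := hlip ∅
  rw [corr_empty, corr_empty] at hPx
  have hYx := hlip S
  set H := ((2 : ℝ) ^ k)⁻¹ * h ^ n with hH
  have hH0 : 0 < H := by positivity
  have hC0 : 0 < C := by linarith
  set X := C * 2 ^ (ε * k) with hX
  have hX0 : 0 < X := by positivity
  have h1 : (corr k h E B S x' r' - corrCoeff k h E S x' r' ∅) ^ 2 <
      X * H * (prodInt k h E x' r' + 1) := by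
    rw [div_lt_one (by positivity), pow_succ' 2 j, pow_mul] at hB'
    exact lt_of_pow_lt_pow_left₀ _ (by positivity) hB'
  have h2 := Real.abs_le_sqrt h1.le
  have h3 := abs_corrCoeff_empty_le hs0 hs1 hE hC₀ hS hx2 hr2
  have h4 : weight s k x' ≤ 2 * weight s k x := by
    refine weight_le_two_mul hs0 hs1 (η := ((2 : ℝ) ^ L)⁻¹) ?_ hxx
    rw [hL, show 3 * k + 24 * n = 2 + k + (2 * k + 24 * n - 2) by omega, pow_add, pow_add, mul_inv,
      mul_inv]
    have : ((2 : ℝ) ^ (2 * k + 24 * n - 2))⁻¹ ≤ 1 := inv_le_one_of_one_le₀ (one_le_pow₀ (by norm_num))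
    have h5 : (0 : ℝ) < (2 ^ k)⁻¹ := by positivity
    nlinarith
  have h5 := one_le_weight s k x
  have h6 : √(X * H * (prodInt k h E x' r' + 1)) ≤ √(X * H * (prodInt k h E x r + H + 1)) := by
    gcongr
    linarith [(abs_le.1 hPx).1]
  have h7 : |corr k h E B S x r| ≤ |corr k h E B S x r - corr k h E B S x' r'| +
      (|corr k h E B S x' r' - corrCoeff k h E S x' r' ∅| + |corrCoeff k h E S x' r' ∅|) := by
    have e1 := abs_sub_abs_le_abs_sub (corr k h E B S x r) (corr k h E B S x' r')
    have e2 := abs_sub_abs_le_abs_sub (corr k h E B S x' r') (corrCoeff k h E S x' r' ∅)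
    linarith
  have h8 : 64 * C₀ * H * weight s k x' ≤ 64 * C₀ * H * (2 * weight s k x) := by gcongr
  have h9 : (128 * C₀ + 1) * (H * weight s k x) ≤ X * (H * weight s k x) := by
    gcongr
    exact hC.trans (le_mul_of_one_le_right hC0.le (Real.one_le_rpow (by norm_num) (by positivity)))
  have h10 : H ≤ H * weight s k x := le_mul_of_one_le_right hH0.le h5
  linarith

/-- For each `n`, a random choice of signs satisfies the correlation bound with probability larger
than `1 / 2`. -/
theorem exists_corrBound_family (n : ℕ) (hn : 0 < n) {s C₀ : ℝ} (hs0 : 0 ≤ s) (hs1 : s ≤ 1)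
    (hC₀ : 0 ≤ C₀) {ε : ℝ} (hε : 0 < ε) :
    ∃ C : ℝ, 0 ≤ C ∧ ∀ (k : ℕ) (h : ℝ) (E : Finset ℕ), LevelRegular s C₀ k h E → h ≤ 2 ^ (k + 1) →
      ∃ (ι : Type) (I : Finset ι) (F : ι → Finset ℕ → ℝ), (∀ i B, 0 ≤ F i B) ∧
        ∑ i ∈ I, signAvg E (F i) < 1 / 2 ∧
        ∀ B, (∀ i ∈ I, F i B < 1) → CorrBound n s C ε k h E B := by
  obtain ⟨j, hj⟩ := pow_unbounded_of_one_lt (6 * n / ε) (one_lt_two : (1 : ℝ) < 2)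
  have hK : (1 : ℝ) ≤ 2 ^ (j + 1) - 1 := by
    have : (1 : ℝ) ≤ 2 ^ j := one_le_pow₀ (by norm_num)
    rw [pow_succ]; linarith
  set Q : ℝ := (2 ^ (j + 1) - 1) ^ n * (2 * n) with hQ
  have hQ0 : 0 < Q := by positivity
  set D : ℝ := 2 ^ (2 * n * (24 * n + 1) + n + 2) with hD
  have hD1 : 1 ≤ D := one_le_pow₀ (by norm_num)
  set C : ℝ := Q * D + (128 * C₀ + 1) with hCdef
  have hC0 : 0 < C := by positivity
  refine ⟨C, hC0.le, fun k h E hE hk => ⟨_, Finset.univ,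
    deviation k h E (C * 2 ^ (ε * k)) j (3 * k + 24 * n),
    deviation_nonneg (by linarith [hE.one_le]) E (by positivity) j _, ?_, fun B hB =>
    corrBound_of_deviation_lt hs0 hs1 hn hC₀ hE hk (by
      have : 0 ≤ Q * D := by positivity
      linarith) hε.le j fun i => hB i (Finset.mem_univ i)⟩⟩
  set L := 3 * k + 24 * n with hL
  have h1 : Q / (C * 2 ^ (ε * k)) ≤ D⁻¹ * (2 ^ (ε * k))⁻¹ := by
    rw [← mul_inv, ← one_div, div_le_div_iff₀ (by positivity) (by positivity), one_mul,
      ← mul_assoc]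
    gcongr
    linarith
  have h2 : (D⁻¹ : ℝ) ^ 2 ^ j ≤ D⁻¹ :=
    pow_le_of_le_one (by positivity) (inv_le_one_of_one_le₀ hD1) (by positivity)
  have h3 : (((2 : ℝ) ^ (ε * k))⁻¹) ^ 2 ^ j ≤ ((2 : ℝ) ^ (6 * n * k))⁻¹ := by
    rw [inv_pow]
    gcongr
    rw [← Real.rpow_natCast (2 ^ (ε * k)), ← Real.rpow_mul (by norm_num), ← Real.rpow_natCast]
    refine Real.rpow_le_rpow_of_exponent_le (by norm_num) ?_
    push_cast
    rw [div_lt_iff₀ hε] at hj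
    have : (0 : ℝ) ≤ k := by positivity
    nlinarith
  calc _ ≤ ∑ _i : (Fin n → Fin (2 ^ L + 1)) × (Fin n → Fin (2 ^ L + 1)) × Finset (Fin n),
        D⁻¹ * ((2 : ℝ) ^ (6 * n * k))⁻¹ := by
        refine Finset.sum_le_sum fun i _ => (signAvg_deviation_le hE (by positivity) j L i).trans ?_
        refine (pow_le_pow_left₀ (by positivity) h1 _).trans ?_
        rw [mul_pow]
        gcongr
    _ = ((2 : ℝ) ^ L + 1) ^ n * (((2 : ℝ) ^ L + 1) ^ n * 2 ^ n) *
        (D⁻¹ * ((2 : ℝ) ^ (6 * n * k))⁻¹) := by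
        simp [Finset.card_univ]
    _ ≤ ((2 : ℝ) ^ (L + 1)) ^ n * (((2 : ℝ) ^ (L + 1)) ^ n * 2 ^ n) *
        (D⁻¹ * ((2 : ℝ) ^ (6 * n * k))⁻¹) := by
        have : (2 : ℝ) ^ L + 1 ≤ 2 ^ (L + 1) := by
          have : (1 : ℝ) ≤ 2 ^ L := one_le_pow₀ (by norm_num)
          rw [pow_succ]; linarith
        gcongr
    _ = 1 / 4 := by
        rw [← mul_inv, hD, ← div_eq_mul_inv, div_eq_div_iff (by positivity) (by norm_num)]
        rw [show (4 : ℝ) = 2 ^ 2 by norm_num]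
        simp only [← pow_mul, ← pow_add, one_mul]
        congr 1
        rw [hL]; ring
    _ < 1 / 2 := by norm_num

/-- There is a choice of signs satisfying the correlation bounds of two given orders. -/
theorem exists_corrBound (n₁ n₂ : ℕ) (hn₁ : 0 < n₁) (hn₂ : 0 < n₂) {s C₀ : ℝ} (hs0 : 0 ≤ s)
    (hs1 : s ≤ 1) (hC₀ : 0 ≤ C₀) {ε : ℝ} (hε : 0 < ε) :
    ∃ C : ℝ, 0 ≤ C ∧ ∀ (k : ℕ) (h : ℝ) (E : Finset ℕ), LevelRegular s C₀ k h E → h ≤ 2 ^ (k + 1) →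
      ∃ B ⊆ E, CorrBound n₁ s C ε k h E B ∧ CorrBound n₂ s C ε k h E B := by
  obtain ⟨C₁, hC₁, h₁⟩ := exists_corrBound_family n₁ hn₁ hs0 hs1 hC₀ hε
  obtain ⟨C₂, hC₂, h₂⟩ := exists_corrBound_family n₂ hn₂ hs0 hs1 hC₀ hε
  refine ⟨max C₁ C₂, hC₁.trans (le_max_left _ _), fun k h E hE hk => ?_⟩
  obtain ⟨ι₁, I₁, F₁, hF₁, hs₁, hg₁⟩ := h₁ k h E hE hk
  obtain ⟨ι₂, I₂, F₂, hF₂, hs₂, hg₂⟩ := h₂ k h E hE hk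
  obtain ⟨B, hB, hlt⟩ := exists_forall_lt_one_of_sum_signAvg (I₁.disjSum I₂) E (Sum.elim F₁ F₂)
    (by rintro (i | i) B <;> simp [hF₁, hF₂]) (by
      rw [Finset.sum_disjSum]
      simp only [Sum.elim_inl, Sum.elim_inr]
      linarith)
  have hh : 0 ≤ h := by linarith [hE.one_le]
  refine ⟨B, hB, (hg₁ B fun i hi => ?_).mono hh (le_max_left _ _),
    (hg₂ B fun i hi => ?_).mono hh (le_max_right _ _)⟩
  · exact hlt (Sum.inl i) (by simpa using hi)
  · exact hlt (Sum.inr i) (by simpa using hi)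

theorem CorrBound.of_le {n : ℕ} {s C C' ε ε' : ℝ} {k : ℕ} {h : ℝ} {E B : Finset ℕ} (hh : 0 ≤ h)
    (hB : CorrBound n s C ε k h E B) (hC : C * 2 ^ (ε * k) ≤ C' * 2 ^ (ε' * k)) :
    CorrBound n s C' ε' k h E B := by
  intro S hS x r hx hr
  have h0 := prodInt_nonneg (k := k) hh E x r
  have h1 := one_le_weight s k x
  refine (hB S hS x r hx hr).trans ?_
  gcongr

/-- Exponents tending to zero slowly enough absorb any sequence of constants. -/
theorem exists_slow_exponents {c : ℕ → ℝ} (hc : ∀ m, 0 ≤ c m) :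
    ∃ (M : ℕ → ℕ) (C : ℝ → ℝ), (∀ ε, 0 ≤ C ε) ∧ ∀ ε > 0, ∀ k : ℕ,
      c (M k) * 2 ^ (1 / ((M k : ℝ) + 1) * k) ≤ C ε * 2 ^ (ε * k) := by
  classical
  set G : ℕ → ℕ → Prop := fun k m => c m ≤ 2 ^ (1 / ((m : ℝ) + 1) * k) with hG
  set M : ℕ → ℕ := fun k => Nat.findGreatest (G k) k with hM
  have key : ∀ ε : ℝ, 0 < ε → ∃ C : ℝ, 0 ≤ C ∧ ∀ k : ℕ,
      c (M k) * 2 ^ (1 / ((M k : ℝ) + 1) * k) ≤ C * 2 ^ (ε * k) := fun ε hε => by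
    obtain ⟨m₀, hm₀⟩ := exists_nat_gt (2 / ε)
    rw [div_lt_iff₀ hε] at hm₀
    obtain ⟨k₀, hk₀⟩ : ∃ k₀ : ℕ, ∀ k ≥ k₀, m₀ ≤ k ∧ G k m₀ := by
      obtain ⟨j, hj⟩ := pow_unbounded_of_one_lt (c m₀) (one_lt_two : (1 : ℝ) < 2)
      refine ⟨(m₀ + 1) * (j + 1), fun k hk => ⟨by nlinarith, hj.le.trans ?_⟩⟩
      rw [← Real.rpow_natCast]
      refine Real.rpow_le_rpow_of_exponent_le one_le_two ?_
      rw [one_div_mul_eq_div, le_div_iff₀ (by positivity)]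
      have : (((m₀ + 1) * (j + 1) : ℕ) : ℝ) ≤ k := by exact_mod_cast hk
      push_cast at this
      nlinarith
    set X : ℕ → ℝ := fun k => c (M k) * 2 ^ (1 / ((M k : ℝ) + 1) * k) with hX
    have hX0 : ∀ k, 0 ≤ X k := fun k => mul_nonneg (hc _) (by positivity)
    have hs : 0 ≤ ∑ j ∈ Finset.range k₀, X j := Finset.sum_nonneg fun j _ => hX0 j
    refine ⟨1 + ∑ j ∈ Finset.range k₀, X j, by linarith, fun k => ?_⟩
    have h1 : (1 : ℝ) ≤ 2 ^ (ε * k) := Real.one_le_rpow one_le_two (by positivity)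
    rcases lt_or_ge k k₀ with hk | hk
    · have : X k ≤ ∑ j ∈ Finset.range k₀, X j :=
        Finset.single_le_sum (fun j _ => hX0 j) (Finset.mem_range.2 hk)
      change X k ≤ _
      nlinarith
    · obtain ⟨hmk, hGk⟩ := hk₀ k hk
      have h2 : m₀ ≤ M k := Nat.le_findGreatest hmk hGk
      have h3 : G k (M k) := Nat.findGreatest_spec hmk hGk
      have h2' : (m₀ : ℝ) ≤ M k := by exact_mod_cast h2
      have h4 : c (M k) * 2 ^ (1 / ((M k : ℝ) + 1) * k) ≤ 2 ^ (ε * k) := by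
        calc _ ≤ (2 : ℝ) ^ (1 / ((M k : ℝ) + 1) * k) * 2 ^ (1 / ((M k : ℝ) + 1) * k) := by gcongr
          _ = 2 ^ (2 / ((M k : ℝ) + 1) * k) := by
              rw [← Real.rpow_add two_pos]; congr 1; ring
          _ ≤ _ := by
              refine Real.rpow_le_rpow_of_exponent_le one_le_two ?_
              gcongr
              rw [div_le_iff₀ (by positivity)]
              nlinarith
      nlinarith
  choose! C hC0 hC using key
  refine ⟨M, fun ε => |C ε|, fun ε => abs_nonneg _, fun ε hε k => (hC ε hε k).trans ?_⟩
  gcongr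
  exact le_abs_self _

theorem exists_corrBound_uniform (n₁ n₂ : ℕ) (hn₁ : 0 < n₁) (hn₂ : 0 < n₂) {s C₀ : ℝ} (hs0 : 0 ≤ s)
    (hs1 : s ≤ 1) (hC₀ : 0 ≤ C₀) :
    ∃ C : ℝ → ℝ, (∀ ε, 0 ≤ C ε) ∧
      ∀ (k : ℕ) (h : ℝ) (E : Finset ℕ), LevelRegular s C₀ k h E → h ≤ 2 ^ (k + 1) →
      ∃ B, ∀ ε > 0, CorrBound n₁ s (C ε) ε k h E B ∧ CorrBound n₂ s (C ε) ε k h E B := by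
  choose c hc0 hc using fun m : ℕ =>
    exists_corrBound n₁ n₂ hn₁ hn₂ hs0 hs1 hC₀ (ε := 1 / ((m : ℝ) + 1)) (by positivity)
  obtain ⟨M, C, hC0, hC⟩ := exists_slow_exponents hc0
  refine ⟨C, hC0, fun k h E hE hk => ?_⟩
  obtain ⟨B, -, h₁, h₂⟩ := hc (M k) k h E hE hk
  have hh : 0 ≤ h := by linarith [hE.one_le]
  exact ⟨B, fun ε hε => ⟨h₁.of_le hh (hC ε hε k), h₂.of_le hh (hC ε hε k)⟩⟩

/-- The number of levels before `k` at which both children are kept. -/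
noncomputable def branchCount (s : ℝ) (k : ℕ) : ℕ := ⌊s * k⌋₊

/-- The density of the level-`k` approximation. -/
noncomputable def levelDensity (s : ℝ) (k : ℕ) : ℝ := 2 ^ (k - branchCount s k)

open Classical in
/-- The intervals of level `k + 1` selected from those of level `k`. -/
noncomputable def nextLevel (s : ℝ) (k : ℕ) (E B : Finset ℕ) : Finset ℕ :=
  (Finset.Ico (2 ^ (k + 1)) (2 ^ (k + 1 + 1))).filter fun a =>
    a / 2 ∈ E ∧ (branchCount s (k + 1) = branchCount s k + 1 ∨ (Odd a ↔ a / 2 ∈ B))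

/-- A sequence of selections generated by the sign patterns `B`. -/
structure IsSelection (s : ℝ) (E B : ℕ → Finset ℕ) : Prop where
  zero : E 0 = {1}
  succ : ∀ k, E (k + 1) = nextLevel s k (E k) (B k)

/-- The density of the level-`k` approximating measure. -/
noncomputable def levelFun (s : ℝ) (E : ℕ → Finset ℕ) (k : ℕ) : ℝ → ℝ :=
  stepFun k (levelDensity s k) (E k)

/-- The difference of consecutive densities. -/
noncomputable def diffFun (s : ℝ) (E : ℕ → Finset ℕ) (k : ℕ) (y : ℝ) : ℝ :=
  levelFun s E (k + 1) y - levelFun s E k y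

/-- The dyadic interval of level `j` and index `a`. -/
def dyadicIco (j a : ℕ) : Set ℝ := Ico ((a : ℝ) / 2 ^ j) ((a + 1) / 2 ^ j)

theorem mem_dyadicIco {j a : ℕ} (ha : a ≠ 0) {y : ℝ} : y ∈ dyadicIco j a ↔ dyadicIdx j y = a :=
  (dyadicIdx_eq_iff ha).symm

theorem branchCount_le {s : ℝ} (hs0 : 0 ≤ s) (k : ℕ) : (branchCount s k : ℝ) ≤ s * k :=
  Nat.floor_le (by positivity)

theorem lt_branchCount (s : ℝ) (k : ℕ) : s * k - 1 < branchCount s k := by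
  have := Nat.lt_floor_add_one (s * k)
  unfold branchCount
  linarith

theorem branchCount_le_self {s : ℝ} (hs0 : 0 ≤ s) (hs1 : s ≤ 1) (k : ℕ) : branchCount s k ≤ k := by
  have h := branchCount_le hs0 k
  have hk : (0 : ℝ) ≤ k := by positivity
  have : (branchCount s k : ℝ) ≤ k := by nlinarith
  exact_mod_cast this

theorem branchCount_succ {s : ℝ} (hs0 : 0 ≤ s) (hs1 : s ≤ 1) (k : ℕ) :
    branchCount s (k + 1) = branchCount s k ∨ branchCount s (k + 1) = branchCount s k + 1 := by
  have h1 : branchCount s k ≤ branchCount s (k + 1) :=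
    Nat.floor_mono (by gcongr; exact Nat.le_succ k)
  have h2 : branchCount s (k + 1) ≤ branchCount s k + 1 := by
    have := branchCount_le hs0 (k + 1)
    have h3 := lt_branchCount s k
    have : (branchCount s (k + 1) : ℝ) < branchCount s k + 1 + 1 := by push_cast at this; linarith
    have : branchCount s (k + 1) < branchCount s k + 1 + 1 := by exact_mod_cast this
    omega
  omega

theorem one_le_levelDensity (s : ℝ) (k : ℕ) : 1 ≤ levelDensity s k :=
  one_le_pow₀ (by norm_num)

theorem levelDensity_mul_inv {s : ℝ} (hs0 : 0 ≤ s) (hs1 : s ≤ 1) (k : ℕ) :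
    levelDensity s k * ((2 : ℝ) ^ k)⁻¹ = ((2 : ℝ) ^ branchCount s k)⁻¹ := by
  have h := branchCount_le_self hs0 hs1 k
  have : (2 : ℝ) ^ k = 2 ^ (k - branchCount s k) * 2 ^ branchCount s k := by
    rw [← pow_add, Nat.sub_add_cancel h]
  rw [this, levelDensity, mul_inv, ← mul_assoc, mul_inv_cancel₀ (by positivity), one_mul]

theorem two_pow_inv_rpow (k : ℕ) (s : ℝ) : ((2 : ℝ) ^ k)⁻¹ ^ s = 2 ^ (-(s * k)) := by
  rw [← Real.rpow_natCast, ← Real.rpow_neg (by norm_num), ← Real.rpow_mul (by norm_num)]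
  congr 1
  ring

theorem levelDensity_le {s : ℝ} (hs0 : 0 ≤ s) (hs1 : s ≤ 1) (k : ℕ) :
    levelDensity s k ≤ 2 * 2 ^ ((1 - s) * k) := by
  have h := branchCount_le_self hs0 hs1 k
  unfold levelDensity
  rw [← Real.rpow_natCast, Nat.cast_sub h]
  nth_rw 2 [← Real.rpow_one 2]
  rw [← Real.rpow_add (by norm_num)]
  refine Real.rpow_le_rpow_of_exponent_le (by norm_num) ?_
  linarith [lt_branchCount s k]

theorem levelDensity_le_two_pow (s : ℝ) (k : ℕ) : levelDensity s k ≤ 2 ^ (k + 1) :=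
  pow_le_pow_right₀ (by norm_num) (by omega)

theorem two_pow_branchCount_inv_le {s : ℝ} (j : ℕ) :
    ((2 : ℝ) ^ branchCount s j)⁻¹ ≤ 2 * ((2 : ℝ) ^ j)⁻¹ ^ s := by
  rw [two_pow_inv_rpow, ← Real.rpow_natCast, ← Real.rpow_neg (by norm_num)]
  nth_rw 2 [← Real.rpow_one 2]
  rw [← Real.rpow_add (by norm_num)]
  refine Real.rpow_le_rpow_of_exponent_le (by norm_num) ?_
  linarith [lt_branchCount s j]

theorem le_two_pow_branchCount_inv {s : ℝ} (hs0 : 0 ≤ s) (j : ℕ) :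
    ((2 : ℝ) ^ j)⁻¹ ^ s ≤ ((2 : ℝ) ^ branchCount s j)⁻¹ := by
  rw [two_pow_inv_rpow, ← Real.rpow_natCast, ← Real.rpow_neg (by norm_num)]
  refine Real.rpow_le_rpow_of_exponent_le (by norm_num) ?_
  linarith [branchCount_le hs0 j]

namespace IsSelection

variable {s : ℝ} {E B : ℕ → Finset ℕ}

theorem subset (h : IsSelection s E B) (k : ℕ) : E k ⊆ Finset.Ico (2 ^ k) (2 ^ (k + 1)) := by
  rcases k with _ | k
  · rw [h.zero]; decide
  · rw [h.succ]
    exact Finset.filter_subset _ _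

theorem mem_succ_iff (h : IsSelection s E B) (k : ℕ) (y : ℝ) :
    dyadicIdx (k + 1) y ∈ E (k + 1) ↔ dyadicIdx k y ∈ E k ∧
      (branchCount s (k + 1) = branchCount s k + 1 ∨
        (Odd (dyadicIdx (k + 1) y) ↔ dyadicIdx k y ∈ B k)) := by
  rw [h.succ, nextLevel, Finset.mem_filter, dyadicIdx_succ_div_two]
  refine ⟨fun h => h.2, fun h1 => ⟨?_, h1⟩⟩
  have h2 := Finset.mem_Ico.1 (h.subset k h1.1)
  have h3 := dyadicIdx_succ_div_two k y
  rw [Finset.mem_Ico, pow_succ, pow_succ 2 (k + 1)]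
  omega

theorem mem_of_mem (h : IsSelection s E B) {j k : ℕ} (hjk : j ≤ k) {y : ℝ}
    (hy : dyadicIdx k y ∈ E k) : dyadicIdx j y ∈ E j := by
  induction k, hjk using Nat.le_induction with
  | base => exact hy
  | succ k _ ih => exact ih ((h.mem_succ_iff k y).1 hy).1

theorem diffFun_eq (h : IsSelection s E B) (hs0 : 0 ≤ s) (hs1 : s ≤ 1) (k : ℕ) :
    diffFun s E k = 0 ∨ diffFun s E k = signedStep k (levelDensity s k) (E k) (B k) := by
  have hle := branchCount_le_self hs0 hs1 k
  rcases branchCount_succ hs0 hs1 k with hb | hb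
  · right
    have hd : levelDensity s (k + 1) = 2 * levelDensity s k := by
      unfold levelDensity
      rw [hb, ← pow_succ']
      congr 1
      omega
    funext y
    have hm := h.mem_succ_iff k y
    unfold diffFun levelFun signedStep stepFun haarSign
    rw [hd]
    simp only [hm, hb]
    by_cases h1 : dyadicIdx k y ∈ E k
    · rcases Nat.even_or_odd (dyadicIdx (k + 1) y) with he | ho
      · have h2 := Nat.not_odd_iff_even.2 he
        by_cases h3 : dyadicIdx k y ∈ B k
        · simp [h1, h2, h3, he.neg_one_pow]
        · simp [h1, h2, h3, he.neg_one_pow]; ring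
      · by_cases h3 : dyadicIdx k y ∈ B k
        · simp [h1, ho, h3, ho.neg_one_pow]; ring
        · simp [h1, ho, h3, ho.neg_one_pow]
    · simp [h1]
  · left
    have hd : levelDensity s (k + 1) = levelDensity s k := by
      unfold levelDensity
      rw [hb]
      congr 1
      omega
    funext y
    have hm := h.mem_succ_iff k y
    unfold diffFun levelFun stepFun
    rw [hd]
    simp [hm, hb]

end IsSelection

theorem dyadicIco_eq_union (j a : ℕ) :
    dyadicIco j a = dyadicIco (j + 1) (2 * a) ∪ dyadicIco (j + 1) (2 * a + 1) := by
  unfold dyadicIco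
  have h2 : (0 : ℝ) < 2 ^ j := by positivity
  push_cast
  rw [Ico_union_Ico_eq_Ico]
  · congr 1
    · rw [pow_succ]; field_simp
    · rw [pow_succ]; field_simp; ring
  · gcongr; linarith
  · gcongr; linarith

theorem disjoint_dyadicIco (j a : ℕ) :
    Disjoint (dyadicIco (j + 1) (2 * a)) (dyadicIco (j + 1) (2 * a + 1)) := by
  unfold dyadicIco
  push_cast
  rw [Ico_disjoint_Ico]
  simp

theorem volume_real_dyadicIco (j a : ℕ) : volume.real (dyadicIco j a) = ((2 : ℝ) ^ j)⁻¹ := by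
  rw [dyadicIco, Real.volume_real_Ico, ← sub_div, add_sub_cancel_left,
    max_eq_left (by positivity), one_div]

theorem measurableSet_dyadicIco (j a : ℕ) : MeasurableSet (dyadicIco j a) := measurableSet_Ico

theorem setIntegral_dyadicIco_const {j a : ℕ} (ha : a ≠ 0) {g : ℝ → ℝ} {c : ℝ}
    (hg : ∀ y, dyadicIdx j y = a → g y = c) : ∫ y in dyadicIco j a, g y = ((2 : ℝ) ^ j)⁻¹ * c := by
  rw [setIntegral_congr_fun (g := fun _ => c) (measurableSet_dyadicIco j a)
    fun y hy => hg y ((mem_dyadicIco ha).1 hy)]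
  simp [volume_real_dyadicIco]

theorem setIntegral_signedStep_eq_zero {j k : ℕ} (hjk : j ≤ k) {h : ℝ} (hh : 0 ≤ h)
    {E : Finset ℕ} (hE : E ⊆ Finset.Ico (2 ^ k) (2 ^ (k + 1))) (B : Finset ℕ) {a : ℕ}
    (ha : a ≠ 0) : ∫ y in dyadicIco j a, signedStep k h E B y = 0 := by
  have hInt : Integrable (signedStep k h E B) :=
    (integrable_stepFun hh hE).mono (measurable_signedStep k h E B).aestronglyMeasurable
      (Filter.Eventually.of_forall fun y => by
        rw [Real.norm_eq_abs, abs_signedStep hh, Real.norm_eq_abs,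
          abs_of_nonneg (stepFun_nonneg hh E y)])
  have split : ∀ i b, ∫ y in dyadicIco i b, signedStep k h E B y =
      (∫ y in dyadicIco (i + 1) (2 * b), signedStep k h E B y) +
        ∫ y in dyadicIco (i + 1) (2 * b + 1), signedStep k h E B y := fun i b => by
    rw [dyadicIco_eq_union, setIntegral_union (disjoint_dyadicIco i b)
      (measurableSet_dyadicIco _ _) hInt.integrableOn hInt.integrableOn]
  induction hjk using Nat.decreasingInduction generalizing a with
  | self =>
    have hval : ∀ c ∈ ({2 * a, 2 * a + 1} : Set ℕ), ∀ y, dyadicIdx (k + 1) y = c →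
        signedStep k h E B y = (if a ∈ E then h else 0) * (-1) ^ c *
          (if a ∈ B then -1 else 1) := by
      intro c hc y hy
      have : dyadicIdx k y = a := by
        rw [← dyadicIdx_succ_div_two, hy]
        rcases hc with rfl | rfl <;> omega
      simp [signedStep, stepFun, haarSign, this, hy]
    rw [split, setIntegral_dyadicIco_const (by omega) (hval (2 * a) (by simp)),
      setIntegral_dyadicIco_const (by omega) (hval (2 * a + 1) (by simp)),
      (even_two_mul a).neg_one_pow, (odd_two_mul_add_one a).neg_one_pow]
    ring
  | of_succ j _ ih => rw [split, ih (by omega), ih (by omega), add_zero]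

theorem measurable_levelFun (s : ℝ) (E : ℕ → Finset ℕ) (k : ℕ) : Measurable (levelFun s E k) :=
  measurable_stepFun _ _ _

theorem levelFun_nonneg (s : ℝ) (E : ℕ → Finset ℕ) (k : ℕ) (y : ℝ) : 0 ≤ levelFun s E k y :=
  stepFun_nonneg (by linarith [one_le_levelDensity s k]) _ _

namespace IsSelection

variable {s : ℝ} {E B : ℕ → Finset ℕ}

theorem integrable_levelFun (h : IsSelection s E B) (k : ℕ) : Integrable (levelFun s E k) :=
  integrable_stepFun (by linarith [one_le_levelDensity s k]) (h.subset k)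

theorem levelFun_eq_zero (h : IsSelection s E B) (k : ℕ) {y : ℝ} (hy : y ∉ Ico (1 : ℝ) 2) :
    levelFun s E k y = 0 :=
  if_neg fun hm => hy (mem_Ico_of_dyadicIdx_mem (h.subset k) hm)

theorem setIntegral_levelFun (h : IsSelection s E B) (hs0 : 0 ≤ s) (hs1 : s ≤ 1) {j k : ℕ}
    (hjk : j ≤ k) {a : ℕ} (ha : a ≠ 0) : ∫ y in dyadicIco j a, levelFun s E k y =
      if a ∈ E j then ((2 : ℝ) ^ branchCount s j)⁻¹ else 0 := by
  induction k, hjk using Nat.le_induction with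
  | base =>
    rw [setIntegral_dyadicIco_const ha (c := if a ∈ E j then levelDensity s j else 0)
      fun y hy => by rw [levelFun, stepFun, hy]]
    split_ifs
    · rw [mul_comm, levelDensity_mul_inv hs0 hs1]
    · simp
  | succ k hjk ih =>
    rw [← ih]
    have h0 : ∫ y in dyadicIco j a, diffFun s E k y = 0 := by
      rcases h.diffFun_eq hs0 hs1 k with he | he
      · simp [he]
      · rw [he]
        exact setIntegral_signedStep_eq_zero hjk (by linarith [one_le_levelDensity s k])
          (h.subset k) _ ha
    unfold diffFun at h0
    rwa [integral_sub (h.integrable_levelFun _).integrableOn (h.integrable_levelFun _).integrableOn,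
      sub_eq_zero] at h0

theorem integral_levelFun (h : IsSelection s E B) (hs0 : 0 ≤ s) (hs1 : s ≤ 1) (k : ℕ) :
    ∫ y, levelFun s E k y = 1 := by
  have h1 := h.setIntegral_levelFun hs0 hs1 (Nat.zero_le k) (a := 1) one_ne_zero
  rw [← setIntegral_eq_integral_of_forall_compl_eq_zero (s := dyadicIco 0 1), h1]
  · simp [h.zero, branchCount]
  · intro y hy
    refine h.levelFun_eq_zero k fun hy' => hy ?_
    simpa [dyadicIco, one_add_one_eq_two] using hy'

theorem setIntegral_levelFun_Icc_le (h : IsSelection s E B) (hs0 : 0 ≤ s) (hs1 : s ≤ 1) {k : ℕ}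
    {u v : ℝ} (huv : ((2 : ℝ) ^ k)⁻¹ ≤ v - u) :
    ∫ y in Icc u v, levelFun s E k y ≤ 8 * (v - u) ^ s := by
  have hk : (0 : ℝ) < ((2 : ℝ) ^ k)⁻¹ := by positivity
  rcases le_or_gt 1 (v - u) with h1 | h1
  · have h2 : ∫ y in Icc u v, levelFun s E k y ≤ 1 := by
      rw [← h.integral_levelFun hs0 hs1 k]
      exact setIntegral_le_integral (h.integrable_levelFun k)
        (Filter.Eventually.of_forall (levelFun_nonneg s E k))
    have h3 : 1 ≤ (v - u) ^ s := Real.one_le_rpow h1 hs0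
    linarith
  obtain ⟨j, hj1, hj2⟩ := exists_nat_pow_near_of_lt_one (x := v - u) (y := (1 / 2 : ℝ))
    (by linarith) h1.le (by norm_num) (by norm_num)
  rw [one_div, inv_pow] at hj1 hj2
  have hjk : j ≤ k := by
    by_contra! hcon
    have : ((2 : ℝ) ^ j)⁻¹ ≤ ((2 : ℝ) ^ (k + 1))⁻¹ := by
      gcongr
      · norm_num
      · exact hcon
    rw [pow_succ, mul_inv] at this
    linarith
  set w := max u 1 with hw
  have hj0 : (0 : ℝ) < 2 ^ j := by positivity
  set a := dyadicIdx j w with ha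
  have ha0 : a ≠ 0 := by
    have : 1 ≤ a := by
      rw [ha, dyadicIdx, Nat.one_le_floor_iff]
      have : (1 : ℝ) ≤ 2 ^ j := one_le_pow₀ (by norm_num)
      have := le_max_right u 1
      nlinarith
    omega
  have hi : ∀ b, Integrable ((dyadicIco j b).indicator (levelFun s E k)) := fun b =>
    (h.integrable_levelFun k).indicator (measurableSet_dyadicIco j b)
  have hle : ∀ b, b ≠ 0 → ∫ y, (dyadicIco j b).indicator (levelFun s E k) y ≤
      4 * (v - u) ^ s := fun b hb => by
    rw [integral_indicator (measurableSet_dyadicIco j b), h.setIntegral_levelFun hs0 hs1 hjk hb]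
    have h2 : ((2 : ℝ) ^ branchCount s j)⁻¹ ≤ 4 * (v - u) ^ s := by
      refine (two_pow_branchCount_inv_le j).trans ?_
      have : ((2 : ℝ) ^ j)⁻¹ ^ s ≤ (2 * (v - u)) ^ s := by
        refine Real.rpow_le_rpow (by positivity) ?_ hs0
        rw [pow_succ, mul_inv] at hj1
        linarith
      rw [Real.mul_rpow (by norm_num) (by linarith)] at this
      have h2s : (2 : ℝ) ^ s ≤ 2 := by
        calc (2 : ℝ) ^ s ≤ 2 ^ (1 : ℝ) := Real.rpow_le_rpow_of_exponent_le (by norm_num) hs1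
          _ = 2 := Real.rpow_one _
      have h3 : 0 ≤ (v - u) ^ s := Real.rpow_nonneg (by linarith) _
      nlinarith
    split_ifs
    · exact h2
    · exact (by positivity : (0 : ℝ) ≤ _).trans h2
  calc _ = ∫ y, (Icc u v).indicator (levelFun s E k) y := (integral_indicator measurableSet_Icc).symm
    _ ≤ ∫ y, ((dyadicIco j a).indicator (levelFun s E k) y +
        (dyadicIco j (a + 1)).indicator (levelFun s E k) y) := by
      refine integral_mono_of_nonneg (Filter.Eventually.of_forall fun y =>
        indicator_nonneg (fun y _ => levelFun_nonneg s E k y) y) ((hi _).add (hi _))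
        (Filter.Eventually.of_forall fun y => ?_)
      have hp : ∀ b, 0 ≤ (dyadicIco j b).indicator (levelFun s E k) y := fun b =>
        indicator_nonneg (fun y _ => levelFun_nonneg s E k y) y
      dsimp only
      by_cases hy : y ∈ Icc u v
      · rw [indicator_of_mem hy]
        by_cases hy1 : y ∈ Ico (1 : ℝ) 2
        · have h3 : a ≤ dyadicIdx j y := Nat.floor_mono (by
            gcongr; exact max_le hy.1 hy1.1)
          have h4 : dyadicIdx j y ≤ a + 1 := by
            rw [ha, dyadicIdx, dyadicIdx, ← Nat.floor_add_one (by positivity)]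
            refine Nat.floor_mono ?_
            have : y ≤ w + ((2 : ℝ) ^ j)⁻¹ := by
              have := le_max_left u 1
              linarith [hy.2]
            calc 2 ^ j * y ≤ 2 ^ j * (w + ((2 : ℝ) ^ j)⁻¹) := by gcongr
              _ = _ := by field_simp
          rcases (show dyadicIdx j y = a ∨ dyadicIdx j y = a + 1 by omega) with h5 | h5
          · have := hp (a + 1)
            rw [indicator_of_mem ((mem_dyadicIco ha0).2 h5)]
            linarith
          · have := hp a
            rw [indicator_of_mem (s := dyadicIco j (a + 1)) ((mem_dyadicIco (by omega)).2 h5)]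
            linarith
        · rw [h.levelFun_eq_zero k hy1]
          exact add_nonneg (hp _) (hp _)
      · rw [indicator_of_notMem hy]
        exact add_nonneg (hp _) (hp _)
    _ ≤ 4 * (v - u) ^ s + 4 * (v - u) ^ s := by
      rw [integral_add (hi _) (hi _)]
      exact add_le_add (hle a ha0) (hle (a + 1) (by omega))
    _ = _ := by ring

theorem levelRegular (h : IsSelection s E B) (hs0 : 0 ≤ s) (hs1 : s ≤ 1) (k : ℕ) :
    LevelRegular s 8 k (levelDensity s k) (E k) where
  subset := h.subset k
  one_le := one_le_levelDensity s k
  scale_le := by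
    rw [levelDensity_mul_inv hs0 hs1]
    exact le_two_pow_branchCount_inv hs0 k
  mass_le := fun _ _ huv => h.setIntegral_levelFun_Icc_le hs0 hs1 huv

end IsSelection

theorem exists_selection {s : ℝ} (hs0 : 0 ≤ s) (hs1 : s ≤ 1) {P : ℕ → ℝ → Finset ℕ → Finset ℕ → Prop}
    (hP : ∀ k h E, LevelRegular s 8 k h E → h ≤ 2 ^ (k + 1) → ∃ B, P k h E B) :
    ∃ E B : ℕ → Finset ℕ, IsSelection s E B ∧ ∀ k, P k (levelDensity s k) (E k) (B k) := by
  choose! pick hpick using hP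
  let E : ℕ → Finset ℕ := fun k => Nat.rec {1}
    (fun k Ek => nextLevel s k Ek (pick k (levelDensity s k) Ek)) k
  have h : IsSelection s E fun k => pick k (levelDensity s k) (E k) := ⟨rfl, fun _ => rfl⟩
  exact ⟨E, _, h, fun k => hpick _ _ _ (h.levelRegular hs0 hs1 k) (levelDensity_le_two_pow s k)⟩

theorem levelDensity_pow_le {s : ℝ} (hs0 : 0 ≤ s) (hs1 : s ≤ 1) (n k : ℕ) :
    ((2 : ℝ) ^ k)⁻¹ * levelDensity s k ^ n ≤ 2 ^ n * 2 ^ ((n * (1 - s) - 1) * k) := by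
  have h1 : levelDensity s k ^ n ≤ (2 * 2 ^ ((1 - s) * k)) ^ n :=
    pow_le_pow_left₀ (by linarith [one_le_levelDensity s k]) (levelDensity_le hs0 hs1 k) n
  calc _ ≤ ((2 : ℝ) ^ k)⁻¹ * (2 * 2 ^ ((1 - s) * k)) ^ n := by gcongr
    _ = 2 ^ n * (((2 : ℝ) ^ k)⁻¹ * (2 ^ ((1 - s) * k)) ^ n) := by rw [mul_pow]; ring
    _ = _ := by
      congr 1
      rw [← Real.rpow_natCast 2 k, ← Real.rpow_neg (by norm_num), ← Real.rpow_mul_natCast (by norm_num),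
        ← Real.rpow_add (by norm_num)]
      congr 1
      ring

theorem CorrBound.abs_corr_le {n : ℕ} {s C ε : ℝ} {k : ℕ} {h : ℝ} {E B : Finset ℕ}
    (hB : CorrBound n s C ε k h E B) (hC : 0 ≤ C) (hε : 0 ≤ ε) (hh : 0 ≤ h) {u A G : ℝ}
    (hG : 0 ≤ G) (hA : 0 ≤ A) (hH : ((2 : ℝ) ^ k)⁻¹ * h ^ n ≤ G * 2 ^ (u * k))
    {S : Finset (Fin n)} (hS : S.Nonempty) {x r : Fin n → ℝ} (hx : ∀ i, x i ∈ Icc (0 : ℝ) 1)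
    (hr : ∀ i, r i ∈ Icc (1 : ℝ) 2)
    (hP : prodInt k h E x r ≤ A * 2 ^ ((max 0 u + ε) * k) * weight s k x) :
    |corr k h E B S x r| ≤
      (C * G + √(C * G * (A + G + 1))) * 2 ^ (((u + max 0 u) / 2 + ε) * k) * weight s k x := by
  have hW := one_le_weight s k x
  have hγ := le_max_left 0 u
  have hγu := le_max_right 0 u
  set γ := max 0 u
  set W := weight s k x
  set H := ((2 : ℝ) ^ k)⁻¹ * h ^ n with hHdef
  have hH0 : 0 ≤ H := by positivity
  have hP0 := prodInt_nonneg (k := k) hh E x r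
  have e2 : (2 : ℝ) ^ (u * k) ≤ 2 ^ ((γ + ε) * k) := by
    refine Real.rpow_le_rpow_of_exponent_le (by norm_num) ?_
    gcongr; linarith
  have e3 : (1 : ℝ) ≤ 2 ^ ((γ + ε) * k) := Real.one_le_rpow (by norm_num) (by positivity)
  set Q := (2 : ℝ) ^ ((γ + ε) * k) with hQ
  have hQ0 : 0 < Q := by positivity
  have t1 : prodInt k h E x r + H + 1 ≤ (A + G + 1) * (Q * W) := by
    have : G * 2 ^ (u * k) ≤ G * (Q * W) := by
      gcongr
      exact e2.trans (le_mul_of_one_le_right hQ0.le hW)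
    have : 1 ≤ Q * W := one_le_mul_of_one_le_of_one_le e3 hW
    linarith
  have t2 : √(C * 2 ^ (ε * k) * H * (prodInt k h E x r + H + 1)) ≤
      √(C * G * (A + G + 1)) * 2 ^ (((u + γ) / 2 + ε) * k) * W := by
    have hsq : (2 : ℝ) ^ (ε * k) * 2 ^ (u * k) * Q = (2 ^ (((u + γ) / 2 + ε) * k)) ^ 2 := by
      rw [hQ, ← Real.rpow_add (by norm_num), ← Real.rpow_add (by norm_num), ← Real.rpow_mul_natCast (by norm_num)]
      congr 1
      push_cast
      ring
    calc _ ≤ √(C * 2 ^ (ε * k) * (G * 2 ^ (u * k)) * ((A + G + 1) * (Q * W))) := by gcongr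
      _ = √(C * G * (A + G + 1) * (2 ^ (((u + γ) / 2 + ε) * k)) ^ 2 * W) := by
        congr 1
        rw [← hsq]; ring
      _ ≤ √(C * G * (A + G + 1) * (2 ^ (((u + γ) / 2 + ε) * k)) ^ 2 * W ^ 2) := by
        gcongr
        nlinarith
      _ = _ := by
        rw [mul_assoc, ← mul_pow, Real.sqrt_mul (by positivity), Real.sqrt_sq (by positivity), ← mul_assoc]
  refine (hB S hS x r hx hr).trans ?_
  have t3 : C * 2 ^ (ε * k) * H * W ≤ C * G * 2 ^ (((u + γ) / 2 + ε) * k) * W := by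
    have e4 : (2 : ℝ) ^ (ε * k) * 2 ^ (u * k) ≤ 2 ^ (((u + γ) / 2 + ε) * k) := by
      rw [← Real.rpow_add (by norm_num)]
      refine Real.rpow_le_rpow_of_exponent_le (by norm_num) ?_
      rw [← add_mul]
      refine mul_le_mul_of_nonneg_right ?_ (by positivity)
      linarith
    calc _ ≤ C * 2 ^ (ε * k) * (G * 2 ^ (u * k)) * W := by gcongr
      _ = C * G * (2 ^ (ε * k) * 2 ^ (u * k)) * W := by ring
      _ ≤ _ := by gcongr
  linarith

theorem exists_recursion_constant {D M κ : ℝ} (hD : 0 ≤ D) (hM : 0 < M) (hκ : 0 < κ) :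
    ∃ A : ℝ, 6 ≤ A ∧ M * (D + √(D * (A + M + 1))) ≤ κ * A := by
  set R := M * D + κ / 2 * (M + 1) + M * D / (4 * (κ / (2 * M))) with hR
  have hR0 : 0 ≤ R := by positivity
  refine ⟨6 + 2 / κ * R, by linarith [show 0 ≤ 2 / κ * R by positivity], ?_⟩
  set A := 6 + 2 / κ * R with hA
  have hA0 : 0 ≤ A := by positivity
  set τ := κ / (2 * M) with hτ
  have hτ0 : 0 < τ := by positivity
  have h1 : √(D * (A + M + 1)) ≤ τ * (A + M + 1) + D / (4 * τ) := by
    refine Real.sqrt_le_iff.2 ⟨by positivity, ?_⟩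
    have : D * (A + M + 1) = 4 * (τ * (A + M + 1)) * (D / (4 * τ)) := by field_simp
    nlinarith [sq_nonneg (τ * (A + M + 1) - D / (4 * τ))]
  have h2 : M * (D + (τ * (A + M + 1) + D / (4 * τ))) = R + κ / 2 * A := by
    have : M * τ = κ / 2 := by rw [hτ]; field_simp
    rw [hR]
    calc _ = M * D + (M * τ) * (A + M + 1) + M * D / (4 * τ) := by ring
      _ = _ := by rw [this]; ring
  have h3 : κ / 2 * A = 3 * κ + R := by rw [hA]; field_simp; ring
  calc _ ≤ M * (D + (τ * (A + M + 1) + D / (4 * τ))) := by gcongr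
    _ = R + κ / 2 * A := h2
    _ ≤ _ := by nlinarith

theorem corrFun_eq {n k : ℕ} (h : ℝ) (E B : Finset ℕ) (S : Finset (Fin n)) (x r : Fin n → ℝ) (z : ℝ) :
    corrFun k h E B S x r z = (∏ i ∈ S, signedStep k h E B ((z - x i) / r i)) *
      ∏ i ∈ Finset.univ \ S, stepFun k h E ((z - x i) / r i) := by
  have := Finset.prod_piecewise Finset.univ S (fun i => signedStep k h E B ((z - x i) / r i))
    fun i => stepFun k h E ((z - x i) / r i)
  rw [Finset.univ_inter] at this
  rw [← this]
  rfl

theorem integrableOn_corrFun {n k : ℕ} {h : ℝ} (hh : 0 ≤ h) (E B : Finset ℕ) (S : Finset (Fin n))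
    (x r : Fin n → ℝ) : IntegrableOn (corrFun k h E B S x r) (Icc 0 6) := by
  refine integrableOn_of_abs_le (C := h ^ n) (measurable_corrFun k h E B S x r) (fun z => ?_) _ _
  rw [abs_corrFun hh]
  exact prod_stepFun_le hh E x r z

namespace IsSelection

variable {s : ℝ} {E B : ℕ → Finset ℕ}

theorem prodInt_succ_le {n : ℕ} (h : IsSelection s E B) (hs0 : 0 ≤ s) (hs1 : s ≤ 1) (k : ℕ)
    (x r : Fin n → ℝ) {K : ℝ} (hK0 : 0 ≤ K) (hK : ∀ S : Finset (Fin n), S.Nonempty →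
      |corr k (levelDensity s k) (E k) (B k) S x r| ≤ K) :
    prodInt (k + 1) (levelDensity s (k + 1)) (E (k + 1)) x r ≤
      prodInt k (levelDensity s k) (E k) x r + 2 ^ n * K := by
  have hh : 0 ≤ levelDensity s k := by linarith [one_le_levelDensity s k]
  rcases h.diffFun_eq hs0 hs1 k with he | he
  · have : levelFun s E (k + 1) = levelFun s E k := by
      funext y
      have := congrFun he y
      simpa [diffFun, sub_eq_zero] using this
    unfold levelFun at this
    unfold prodInt
    rw [this]
    have : 0 ≤ 2 ^ n * K := by positivity
    linarith
  · have hz : ∀ z, ∏ i, stepFun (k + 1) (levelDensity s (k + 1)) (E (k + 1)) ((z - x i) / r i) =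
        ∑ S : Finset (Fin n), corrFun k (levelDensity s k) (E k) (B k) S x r z := fun z => by
      have : ∀ y, stepFun (k + 1) (levelDensity s (k + 1)) (E (k + 1)) y =
          signedStep k (levelDensity s k) (E k) (B k) y + stepFun k (levelDensity s k) (E k) y :=
        fun y => by
          rw [← he]
          simp [diffFun, levelFun]
      simp_rw [this, Finset.prod_add, Finset.powerset_univ, corrFun_eq]
    have hsum : prodInt (k + 1) (levelDensity s (k + 1)) (E (k + 1)) x r =
        ∑ S : Finset (Fin n), corr k (levelDensity s k) (E k) (B k) S x r := by
      unfold prodInt corr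
      simp_rw [hz]
      exact integral_finsetSum _ fun S _ => integrableOn_corrFun hh _ _ S x r
    rw [hsum, ← Finset.add_sum_erase _ _ (Finset.mem_univ ∅), corr_empty]
    gcongr
    calc _ ≤ ∑ S ∈ (Finset.univ : Finset (Finset (Fin n))).erase ∅, K :=
          Finset.sum_le_sum fun S hS => (le_abs_self _).trans
            (hK S (Finset.nonempty_iff_ne_empty.2 (Finset.ne_of_mem_erase hS)))
      _ ≤ ∑ S : Finset (Fin n), K :=
          Finset.sum_le_sum_of_subset_of_nonneg (Finset.erase_subset _ _) fun _ _ _ => hK0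
      _ = 2 ^ n * K := by simp

theorem exists_prodInt_le {n : ℕ} (h : IsSelection s E B) (hs0 : 0 ≤ s) (hs1 : s ≤ 1) {C ε : ℝ}
    (hC : 0 ≤ C) (hε : 0 < ε) (hB : ∀ k, CorrBound n s C ε k (levelDensity s k) (E k) (B k)) :
    ∃ A : ℝ, 0 ≤ A ∧ ∀ (k : ℕ) (x r : Fin n → ℝ), (∀ i, x i ∈ Icc (0 : ℝ) 1) →
      (∀ i, r i ∈ Icc (1 : ℝ) 2) → prodInt k (levelDensity s k) (E k) x r ≤
        A * 2 ^ ((max 0 (n * (1 - s) - 1) + ε) * k) * weight s k x := by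
  obtain ⟨A, hA6, hA⟩ := exists_recursion_constant (D := C * 2 ^ n) (M := 2 ^ n) (κ := 2 ^ ε - 1)
    (by positivity) (by positivity)
    (by linarith [Real.one_lt_rpow (one_lt_two : (1 : ℝ) < 2) hε])
  refine ⟨A, by linarith, fun k x r hx hr => ?_⟩
  set u : ℝ := n * (1 - s) - 1
  have hγ := le_max_left 0 u
  have hγu := le_max_right 0 u
  induction k with
  | zero =>
    have h0 : levelDensity s 0 = 1 := by simp [levelDensity]
    have h1 : prodInt 0 (levelDensity s 0) (E 0) x r ≤ 6 := by
      have := norm_setIntegral_le_of_norm_le_const (μ := volume) (s := Icc (0 : ℝ) 6) (C := 1)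
        (f := fun z => ∏ i, stepFun 0 (levelDensity s 0) (E 0) ((z - x i) / r i)) (by simp)
        fun z _ => by
          rw [Real.norm_eq_abs, abs_of_nonneg (prod_stepFun_nonneg (by rw [h0]; norm_num) _ x r z)]
          have := prod_stepFun_le (k := 0) (h := levelDensity s 0) (by rw [h0]; norm_num) (E 0) x r z
          exact this.trans (by rw [h0, one_pow])
      rw [Real.volume_real_Icc] at this
      refine (le_abs_self _).trans (this.trans ?_)
      norm_num
    have := one_le_weight s 0 x
    simp only [Nat.cast_zero, mul_zero, Real.rpow_zero, mul_one]
    nlinarith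
  | succ k ih =>
    have hh : 0 ≤ levelDensity s k := by linarith [one_le_levelDensity s k]
    have hW := one_le_weight s k x
    set W := weight s k x with hWdef
    set K := (C * 2 ^ n + √(C * 2 ^ n * (A + 2 ^ n + 1))) * 2 ^ ((max 0 u + ε) * k) * W with hKdef
    have hA0 : 0 ≤ A := by linarith
    have hK0 : 0 ≤ K := by positivity
    have hK : ∀ S : Finset (Fin n), S.Nonempty →
        |corr k (levelDensity s k) (E k) (B k) S x r| ≤ K := fun S hS => by
      refine ((hB k).abs_corr_le hC hε.le hh (by positivity) hA0 (levelDensity_pow_le hs0 hs1 n k) hS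
        hx hr ih).trans ?_
      have : (2 : ℝ) ^ (((u + max 0 u) / 2 + ε) * k) ≤ 2 ^ ((max 0 u + ε) * k) := by
        refine Real.rpow_le_rpow_of_exponent_le (by norm_num) ?_
        gcongr
        linarith
      rw [hKdef]
      gcongr
    refine (h.prodInt_succ_le hs0 hs1 k x r hK0 hK).trans ?_
    have hexp : (2 : ℝ) ^ ((max 0 u + ε) * (k + 1 : ℕ)) =
        2 ^ ((max 0 u + ε) * k) * 2 ^ (max 0 u + ε) := by
      rw [← Real.rpow_add (by norm_num)]
      congr 1
      push_cast
      ring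
    have hge : (2 : ℝ) ^ ε ≤ 2 ^ (max 0 u + ε) :=
      Real.rpow_le_rpow_of_exponent_le (by norm_num) (by linarith)
    set q := (2 : ℝ) ^ ((max 0 u + ε) * k)
    have hq : 0 < q := by positivity
    calc _ ≤ A * q * W + 2 ^ n * K := by gcongr
      _ = (A + 2 ^ n * (C * 2 ^ n + √(C * 2 ^ n * (A + 2 ^ n + 1)))) * (q * W) := by
        rw [hKdef]; ring
      _ ≤ (A * 2 ^ (max 0 u + ε)) * (q * W) := by
        gcongr
        have := mul_le_mul_of_nonneg_left hge hA0
        linarith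
      _ = A * (q * 2 ^ (max 0 u + ε)) * W := by ring
      _ ≤ _ := by
        rw [hexp]
        gcongr
        exact weight_mono hs0 k x

theorem exists_abs_integral_diffFun_le {n : ℕ} (hn : 0 < n) (h : IsSelection s E B) (hs0 : 0 ≤ s)
    (hs1 : s ≤ 1) {C ε : ℝ} (hC : 0 ≤ C) (hε : 0 < ε)
    (hB : ∀ k, CorrBound n s C ε k (levelDensity s k) (E k) (B k)) :
    ∃ K : ℝ, 0 ≤ K ∧ ∀ (k : ℕ) (x r : Fin n → ℝ), (∀ i, x i ∈ Icc (0 : ℝ) 1) →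
      (∀ i, r i ∈ Icc (1 : ℝ) 2) →
      |∫ z in Icc (0 : ℝ) 6, ∏ i, diffFun s E k ((z - x i) / r i)| ≤
        K * 2 ^ (((n * (1 - s) - 1 + max 0 (n * (1 - s) - 1)) / 2 + ε) * k) * weight s k x := by
  obtain ⟨A, hA0, hA⟩ := h.exists_prodInt_le hs0 hs1 hC hε hB
  refine ⟨C * 2 ^ n + √(C * 2 ^ n * (A + 2 ^ n + 1)), by positivity, fun k x r hx hr => ?_⟩
  have : Nonempty (Fin n) := ⟨⟨0, hn⟩⟩
  have hW := one_le_weight s k x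
  rcases h.diffFun_eq hs0 hs1 k with he | he
  · have : ∀ z : ℝ, ∏ i, diffFun s E k ((z - x i) / r i) = 0 := fun z => by
      simp [he, Finset.prod_const, hn.ne']
    simp only [this, integral_zero, abs_zero]
    positivity
  · have := (hB k).abs_corr_le hC hε.le (by linarith [one_le_levelDensity s k]) (by positivity) hA0
      (levelDensity_pow_le hs0 hs1 n k) Finset.univ_nonempty hx hr (hA k x r hx hr)
    rw [he]
    simpa [corr, corrFun] using this

end IsSelection

/-- The level-`k` approximating measure. -/
noncomputable def levelMeasure (s : ℝ) (E : ℕ → Finset ℕ) (k : ℕ) : Measure ℝ :=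
  volume.withDensity fun y => ENNReal.ofReal (levelFun s E k y)

theorem isClosed_msupport (ν : Measure ℝ) : IsClosed (msupport ν) := by
  rw [← isOpen_compl_iff, Metric.isOpen_iff]
  intro x hx
  simp only [msupport, mem_compl_iff, mem_ofPred_eq, not_forall, not_lt, nonpos_iff_eq_zero] at hx
  obtain ⟨ε, hε, h0⟩ := hx
  refine ⟨ε / 2, by positivity, fun y hy hmem => ?_⟩
  refine (hmem (ε / 2) (by positivity)).ne' (measure_mono_null (fun z hz => ?_) h0)
  rw [Metric.mem_ball] at *
  linarith [dist_triangle z y x]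

namespace IsSelection

variable {s : ℝ} {E B : ℕ → Finset ℕ}

theorem levelMeasure_apply (h : IsSelection s E B) (k : ℕ) {S : Set ℝ} (hS : MeasurableSet S) :
    levelMeasure s E k S = ENNReal.ofReal (∫ y in S, levelFun s E k y) := by
  rw [levelMeasure, withDensity_apply _ hS, ofReal_integral_eq_lintegral_ofReal
    (h.integrable_levelFun k).integrableOn
    (Filter.Eventually.of_forall (levelFun_nonneg s E k))]

theorem isProbabilityMeasure_levelMeasure (h : IsSelection s E B) (hs0 : 0 ≤ s) (hs1 : s ≤ 1)
    (k : ℕ) : IsProbabilityMeasure (levelMeasure s E k) :=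
  ⟨by rw [h.levelMeasure_apply k MeasurableSet.univ, setIntegral_univ, h.integral_levelFun hs0 hs1,
    ENNReal.ofReal_one]⟩

theorem levelMeasure_compl_Icc (h : IsSelection s E B) (k : ℕ) :
    levelMeasure s E k (Icc 1 2)ᶜ = 0 := by
  rw [h.levelMeasure_apply k measurableSet_Icc.compl, setIntegral_eq_zero_of_forall_eq_zero,
    ENNReal.ofReal_zero]
  exact fun y hy => h.levelFun_eq_zero k fun hy' => hy (Ico_subset_Icc_self hy')

theorem exists_limit (h : IsSelection s E B) (hs0 : 0 ≤ s) (hs1 : s ≤ 1) :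
    ∃ (ν : Measure ℝ) (φ : ℕ → ℕ), IsProbabilityMeasure ν ∧ StrictMono φ ∧
      ∀ U, IsOpen U → ν U ≤ Filter.liminf (fun n => levelMeasure s E (φ n) U) Filter.atTop := by
  let μ : ℕ → ProbabilityMeasure ℝ := fun k =>
    ⟨levelMeasure s E k, h.isProbabilityMeasure_levelMeasure hs0 hs1 k⟩
  have htight : IsTightMeasureSet {((ρ : ProbabilityMeasure ℝ) : Measure ℝ) | ρ ∈ range μ} := by
    rw [isTightMeasureSet_iff_exists_isCompact_measure_compl_le]
    intro ε hε
    refine ⟨Icc 1 2, isCompact_Icc, ?_⟩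
    rintro _ ⟨_, ⟨k, rfl⟩, rfl⟩
    exact (h.levelMeasure_compl_Icc k).le.trans hε.le
  obtain ⟨ν, -, φ, hφ, hlim⟩ := (isCompact_closure_of_isTightMeasureSet htight).tendsto_subseq
    (x := μ) fun k => subset_closure ⟨k, rfl⟩
  exact ⟨ν, φ, inferInstance, hφ, fun U hU =>
    ProbabilityMeasure.le_liminf_measure_open_of_tendsto hlim hU⟩

variable {ν : Measure ℝ} {φ : ℕ → ℕ}

theorem msupport_subset (h : IsSelection s E B)
    (hν : ∀ U, IsOpen U → ν U ≤ Filter.liminf (fun n => levelMeasure s E (φ n) U) Filter.atTop) :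
    msupport ν ⊆ Icc 1 2 := by
  intro x hx
  by_contra hcon
  obtain ⟨ε, hε, hb⟩ := Metric.isOpen_iff.1
    (isClosed_Icc (a := (1 : ℝ)) (b := 2)).isOpen_compl x hcon
  refine (hx ε hε).ne' (le_antisymm ((hν _ Metric.isOpen_ball).trans ?_) zero_le)
  have : ∀ n, levelMeasure s E (φ n) (Metric.ball x ε) = 0 := fun n =>
    measure_mono_null hb (h.levelMeasure_compl_Icc (φ n))
  simp [this]

theorem measure_Icc_le (h : IsSelection s E B) (hs0 : 0 ≤ s) (hs1 : s ≤ 1) (hφ : StrictMono φ)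
    (hν : ∀ U, IsOpen U → ν U ≤ Filter.liminf (fun n => levelMeasure s E (φ n) U) Filter.atTop)
    (x : ℝ) {r : ℝ} (hr : 0 < r) : ν (Icc (x - r) (x + r)) ≤ ENNReal.ofReal (32 * r ^ s) := by
  calc ν (Icc (x - r) (x + r)) ≤ ν (Ioo (x - 2 * r) (x + 2 * r)) :=
        measure_mono (Icc_subset_Ioo (by linarith) (by linarith))
    _ ≤ _ := hν _ isOpen_Ioo
    _ ≤ _ := by
      refine Filter.liminf_le_of_frequently_le' (Filter.Eventually.frequently ?_)
      have : Filter.Tendsto (fun n => ((2 : ℝ) ^ φ n)⁻¹) Filter.atTop (nhds 0) := by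
        simp_rw [← inv_pow]
        exact (tendsto_pow_atTop_nhds_zero_of_lt_one (by norm_num) (by norm_num)).comp
          hφ.tendsto_atTop
      filter_upwards [this.eventually_le_const (show (0 : ℝ) < 4 * r by positivity)] with n hn
      refine (measure_mono Ioo_subset_Icc_self).trans ?_
      rw [h.levelMeasure_apply _ measurableSet_Icc]
      refine ENNReal.ofReal_le_ofReal ((h.setIntegral_levelFun_Icc_le hs0 hs1 (by linarith)).trans ?_)
      have : x + 2 * r - (x - 2 * r) = 4 * r := by ring
      rw [this, Real.mul_rpow (by norm_num) hr.le]
      have h4 : (4 : ℝ) ^ s ≤ 4 := by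
        calc (4 : ℝ) ^ s ≤ 4 ^ (1 : ℝ) := Real.rpow_le_rpow_of_exponent_le (by norm_num) hs1
          _ = 4 := Real.rpow_one _
      have : 0 ≤ r ^ s := by positivity
      nlinarith

theorem le_measure_closed (h : IsSelection s E B) (hs0 : 0 ≤ s) (hs1 : s ≤ 1)
    [IsProbabilityMeasure ν]
    (hν : ∀ U, IsOpen U → ν U ≤ Filter.liminf (fun n => levelMeasure s E (φ n) U) Filter.atTop)
    {F : Set ℝ} (hF : IsClosed F) {c : ENNReal}
    (hc : ∀ᶠ n in Filter.atTop, c ≤ levelMeasure s E (φ n) F) : c ≤ ν F := by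
  have := h.isProbabilityMeasure_levelMeasure hs0 hs1
  have h1 : ν Fᶜ ≤ 1 - c := by
    refine (hν _ hF.isOpen_compl).trans
      (Filter.liminf_le_of_frequently_le' (Filter.Eventually.frequently ?_))
    filter_upwards [hc] with n hn
    rw [prob_compl_eq_one_sub hF.measurableSet]
    exact tsub_le_tsub_left hn 1
  obtain ⟨n, hn⟩ := hc.exists
  have hc1 : c ≤ 1 := hn.trans prob_le_one
  rw [prob_compl_eq_one_sub hF.measurableSet] at h1
  have h2 := tsub_le_tsub_left h1 1
  rwa [ENNReal.sub_sub_cancel ENNReal.one_ne_top hc1,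
    ENNReal.sub_sub_cancel ENNReal.one_ne_top prob_le_one] at h2

theorem le_measure_Icc (h : IsSelection s E B) (hs0 : 0 ≤ s) (hs1 : s ≤ 1)
    [IsProbabilityMeasure ν] (hφ : StrictMono φ)
    (hν : ∀ U, IsOpen U → ν U ≤ Filter.liminf (fun n => levelMeasure s E (φ n) U) Filter.atTop)
    {x : ℝ} (hx : x ∈ msupport ν) {r : ℝ} (hr : 0 < r) (hr1 : r ≤ 1) :
    ENNReal.ofReal ((32 : ℝ)⁻¹ * r ^ s) ≤ ν (Icc (x - r) (x + r)) := by
  obtain ⟨i, hi1, hi2⟩ := exists_nat_pow_near_of_lt_one (x := r) (y := (1 / 2 : ℝ))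
    hr hr1 (by norm_num) (by norm_num)
  obtain ⟨j, hj1, hj2⟩ : ∃ j : ℕ, ((2 : ℝ) ^ j)⁻¹ < r / 2 ∧ r / 4 ≤ ((2 : ℝ) ^ j)⁻¹ := by
    refine ⟨i + 2, ?_⟩
    rw [← inv_pow, ← one_div, pow_add]
    rw [pow_succ] at hi1
    constructor <;> linarith
  obtain ⟨n, hn, hpos⟩ : ∃ n, j ≤ φ n ∧ levelMeasure s E (φ n) (Metric.ball x (r / 2)) ≠ 0 := by
    by_contra! hcon
    refine (hx (r / 2) (by positivity)).ne' (le_antisymm ((hν _ Metric.isOpen_ball).trans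
      (Filter.liminf_le_of_frequently_le' (Filter.Eventually.frequently ?_))) zero_le)
    filter_upwards [hφ.tendsto_atTop.eventually_ge_atTop j] with n hn using (hcon n hn).le
  obtain ⟨y, hy, hyE⟩ : ∃ y ∈ Metric.ball x (r / 2), dyadicIdx (φ n) y ∈ E (φ n) := by
    by_contra! hcon
    refine hpos ?_
    rw [h.levelMeasure_apply _ measurableSet_ball, setIntegral_eq_zero_of_forall_eq_zero,
      ENNReal.ofReal_zero]
    exact fun y hy => if_neg (hcon y hy)
  have ha := h.mem_of_mem hn hyE
  set a := dyadicIdx j y with hadef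
  have ha0 : a ≠ 0 := by
    have := (Finset.mem_Ico.1 (h.subset j ha)).1
    have : 0 < 2 ^ j := by positivity
    omega
  have hya := (mem_dyadicIco ha0).2 hadef.symm
  have hsub : dyadicIco j a ⊆ Icc (x - r) (x + r) := by
    intro z hz
    rw [Metric.mem_ball, Real.dist_eq, abs_lt] at hy
    rw [dyadicIco, mem_Ico, add_div, one_div] at hya hz
    constructor <;> linarith
  refine h.le_measure_closed hs0 hs1 hν isClosed_Icc ?_
  filter_upwards [hφ.tendsto_atTop.eventually_ge_atTop j] with m hm
  refine le_trans ?_ (measure_mono hsub)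
  rw [h.levelMeasure_apply _ (measurableSet_dyadicIco j a), h.setIntegral_levelFun hs0 hs1 hm ha0,
    if_pos ha]
  refine ENNReal.ofReal_le_ofReal (le_trans ?_ (le_two_pow_branchCount_inv hs0 j))
  calc (32 : ℝ)⁻¹ * r ^ s ≤ (4 : ℝ)⁻¹ * r ^ s := by gcongr; norm_num
    _ ≤ (4 : ℝ)⁻¹ ^ s * r ^ s := by
      gcongr
      nth_rw 1 [← Real.rpow_one (4 : ℝ)⁻¹]
      exact Real.rpow_le_rpow_of_exponent_ge (by norm_num) (by norm_num) hs1
    _ = (r / 4) ^ s := by rw [← Real.mul_rpow (by norm_num) hr.le]; congr 1; ring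
    _ ≤ _ := by gcongr

theorem isAhlforsRegular (h : IsSelection s E B) (hs0 : 0 ≤ s) (hs1 : s ≤ 1)
    [IsProbabilityMeasure ν] (hφ : StrictMono φ)
    (hν : ∀ U, IsOpen U → ν U ≤ Filter.liminf (fun n => levelMeasure s E (φ n) U) Filter.atTop) :
    IsAhlforsRegular ν s :=
  ⟨32, by norm_num, fun x hx _ hr hr1 =>
    ⟨h.le_measure_Icc hs0 hs1 hφ hν hx hr hr1, h.measure_Icc_le hs0 hs1 hφ hν x hr⟩⟩

end IsSelection

theorem lintegral_Ioo_rpow_neg {s m : ℝ} (hs1 : s < 1) (hm : 0 ≤ m) :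
    ∫⁻ u in Ioo 0 m, ENNReal.ofReal (u ^ (-s)) = ENNReal.ofReal (m ^ (1 - s) / (1 - s)) := by
  rw [← ofReal_integral_eq_lintegral_ofReal]
  · congr 1
    rw [← integral_Ioc_eq_integral_Ioo, ← intervalIntegral.integral_of_le hm,
      integral_rpow (Or.inl (by linarith)), Real.zero_rpow (by linarith), sub_zero]
    congr 1 <;> ring_nf
  · exact (intervalIntegrable_iff_integrableOn_Ioo_of_le hm).1
      (intervalIntegral.intervalIntegrable_rpow' (by linarith))
  · filter_upwards [ae_restrict_mem measurableSet_Ioo] with u hu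
    exact Real.rpow_nonneg hu.1.le _

theorem lintegral_abs_add_rpow_neg_le {s δ : ℝ} (hs0 : 0 ≤ s) (hs1 : s < 1) (hδ : 0 ≤ δ)
    {Ω : Set ℝ} (hfin : volume Ω ≠ ⊤) (c : ℝ) :
    ∫⁻ x in Ω, ENNReal.ofReal ((|x - c| + δ) ^ (-s)) ≤
      ENNReal.ofReal (1 + 2 / (1 - s)) * volume Ω ^ (1 - s) := by
  rcases eq_or_ne (volume Ω) 0 with h0 | h0
  · rw [Measure.restrict_eq_zero.2 h0, lintegral_zero_measure]
    exact zero_le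
  have hs : 0 < 1 - s := by linarith
  set m := (volume Ω).toReal with hm
  have hm0 : 0 < m := ENNReal.toReal_pos h0 hfin
  have hvol : volume Ω = ENNReal.ofReal m := (ENNReal.ofReal_toReal hfin).symm
  have hmeas : Measurable fun u : ℝ => ENNReal.ofReal (u ^ (-s)) := by fun_prop
  have h1 : MeasurePreserving (fun x : ℝ => x - c) := measurePreserving_sub_right volume c
  have h2 : MeasurePreserving (fun x : ℝ => c - x) := Measure.measurePreserving_sub_left volume c
  have i1 := h1.setLIntegral_comp_preimage (measurableSet_Ioo (a := 0) (b := m)) hmeas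
  have i2 := h2.setLIntegral_comp_preimage (measurableSet_Ioo (a := 0) (b := m)) hmeas
  rw [lintegral_Ioo_rpow_neg hs1 hm0.le] at i1 i2
  set T₁ := (fun x : ℝ => x - c) ⁻¹' Ioo 0 m
  set T₂ := (fun x : ℝ => c - x) ⁻¹' Ioo 0 m
  have hT₁ : MeasurableSet T₁ := h1.measurable measurableSet_Ioo
  have hT₂ : MeasurableSet T₂ := h2.measurable measurableSet_Ioo
  calc ∫⁻ x in Ω, ENNReal.ofReal ((|x - c| + δ) ^ (-s))
      ≤ ∫⁻ x in Ω, (ENNReal.ofReal (m ^ (-s)) +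
          (T₁.indicator (fun x => ENNReal.ofReal ((x - c) ^ (-s))) x +
            T₂.indicator (fun x => ENNReal.ofReal ((c - x) ^ (-s))) x)) := by
        refine lintegral_mono_ae ?_
        filter_upwards [ae_restrict_of_ae (Measure.ae_ne volume c)] with x hxc
        have hpos : 0 < |x - c| := abs_pos.2 (sub_ne_zero.2 hxc)
        have hle : (|x - c| + δ) ^ (-s) ≤ |x - c| ^ (-s) :=
          Real.rpow_le_rpow_of_nonpos hpos (by linarith) (by linarith)
        refine (ENNReal.ofReal_le_ofReal hle).trans ?_
        rcases le_or_gt m |x - c| with hge | hlt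
        · exact le_add_right (ENNReal.ofReal_le_ofReal
            (Real.rpow_le_rpow_of_nonpos hm0 hge (by linarith)))
        · refine le_add_left ?_
          rcases lt_or_gt_of_ne hxc with hx | hx
          · have : |x - c| = c - x := by rw [abs_of_neg (by linarith)]; ring
            rw [this] at hpos hlt ⊢
            refine le_add_left ?_
            rw [indicator_of_mem (show x ∈ T₂ from ⟨hpos, hlt⟩)]
          · have : |x - c| = x - c := abs_of_pos (by linarith)
            rw [this] at hpos hlt ⊢
            refine le_add_right ?_
            rw [indicator_of_mem (show x ∈ T₁ from ⟨hpos, hlt⟩)]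
    _ ≤ ENNReal.ofReal (m ^ (-s)) * volume Ω + (ENNReal.ofReal (m ^ (1 - s) / (1 - s)) +
          ENNReal.ofReal (m ^ (1 - s) / (1 - s))) := by
        rw [lintegral_add_left measurable_const, lintegral_const, Measure.restrict_apply_univ]
        gcongr
        refine (setLIntegral_le_lintegral _ _).trans ?_
        rw [lintegral_add_left (Measurable.indicator (by fun_prop) hT₁),
          lintegral_indicator hT₁, lintegral_indicator hT₂, i1, i2]
    _ = _ := by
        rw [hvol, ENNReal.ofReal_rpow_of_pos hm0, ← ENNReal.ofReal_mul (by positivity),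
          ← ENNReal.ofReal_mul (by positivity), ← ENNReal.ofReal_add (by positivity) (by positivity),
          ← ENNReal.ofReal_add (by positivity) (by positivity)]
        congr 1
        have : m ^ (1 - s) = m ^ (-s) * m := by
          rw [show 1 - s = -s + 1 by ring, Real.rpow_add hm0, Real.rpow_one]
        rw [← this]
        ring

theorem lintegral_pi_abs_rpow_le {n : ℕ} {s δ : ℝ} (hs0 : 0 ≤ s) (hs1 : s < 1) (hδ : 0 ≤ δ)
    {Ω : Set ℝ} (hfin : volume Ω ≠ ⊤) {i j : Fin (n + 1)} (hij : i ≠ j) :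
    ∫⁻ x, ENNReal.ofReal ((|x i - x j| + δ) ^ (-s))
        ∂(Measure.pi fun _ : Fin (n + 1) => volume.restrict Ω) ≤
      ENNReal.ofReal (1 + 2 / (1 - s)) * volume Ω ^ (1 - s) * volume Ω ^ n := by
  have : IsFiniteMeasure (volume.restrict Ω) := ⟨by
    rw [Measure.restrict_apply_univ]; exact hfin.lt_top⟩
  obtain ⟨l, rfl⟩ := Fin.exists_succAbove_eq hij.symm
  have hmp := (measurePreserving_piFinSuccAbove (fun _ : Fin (n + 1) => volume.restrict Ω) i)
  have hm : Measurable fun q : ℝ × (Fin n → ℝ) =>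
      ENNReal.ofReal ((|q.1 - q.2 l| + δ) ^ (-s)) := by fun_prop
  have := hmp.lintegral_comp hm
  simp only [MeasurableEquiv.piFinSuccAbove_apply, Fin.insertNthEquiv_symm_apply, Fin.removeNth] at this
  rw [this, lintegral_prod_symm _ hm.aemeasurable]
  calc _ ≤ ∫⁻ y, ENNReal.ofReal (1 + 2 / (1 - s)) * volume Ω ^ (1 - s)
        ∂(Measure.pi fun _ : Fin n => volume.restrict Ω) :=
        lintegral_mono fun y => lintegral_abs_add_rpow_neg_le hs0 hs1 hδ hfin (y l)
    _ = _ := by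
        rw [lintegral_const, Measure.pi_univ]
        simp

theorem lintegral_weight_le {n : ℕ} {s : ℝ} (hs0 : 0 ≤ s) (hs1 : s < 1) (k : ℕ)
    {Ω : Set ℝ} (hΩ1 : volume Ω ≤ 1) :
    ∫⁻ x, ENNReal.ofReal (weight s k x) ∂(Measure.pi fun _ : Fin (n + 1) => volume.restrict Ω) ≤
      ENNReal.ofReal (1 + (n + 1) ^ 2 * (1 + 2 / (1 - s))) * volume Ω ^ (n + (1 - s)) := by
  have hfin : volume Ω ≠ ⊤ := (hΩ1.trans_lt ENNReal.one_lt_top).ne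
  have hs : 0 < 1 - s := by linarith
  have hδ : (0 : ℝ) ≤ ((2 : ℝ) ^ k)⁻¹ := by positivity
  have hexp : volume Ω ^ (1 - s) * volume Ω ^ n = volume Ω ^ (n + (1 - s)) := by
    rw [← ENNReal.rpow_natCast, ← ENNReal.rpow_add_of_nonneg _ _ hs.le (by positivity), add_comm]
  unfold weight
  calc _ = ∫⁻ x, (1 + ∑ p ∈ (Finset.univ : Finset (Fin (n + 1))).offDiag,
        ENNReal.ofReal ((|x p.1 - x p.2| + ((2 : ℝ) ^ k)⁻¹) ^ (-s)))
        ∂(Measure.pi fun _ : Fin (n + 1) => volume.restrict Ω) := by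
        refine lintegral_congr fun x => ?_
        rw [ENNReal.ofReal_add zero_le_one (Finset.sum_nonneg fun p _ => by positivity),
          ENNReal.ofReal_one, ENNReal.ofReal_sum_of_nonneg fun p _ => by positivity]
    _ ≤ volume Ω ^ (n + 1) + ∑ p ∈ (Finset.univ : Finset (Fin (n + 1))).offDiag,
        ENNReal.ofReal (1 + 2 / (1 - s)) * volume Ω ^ (n + (1 - s)) := by
        rw [lintegral_add_left measurable_const, lintegral_const, Measure.pi_univ]
        gcongr
        · simp
        · rw [lintegral_finsetSum _ fun p _ => by fun_prop]
          gcongr with p hp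
          rw [← hexp, ← mul_assoc]
          exact lintegral_pi_abs_rpow_le hs0 hs1 hδ hfin (Finset.mem_offDiag.1 hp).2.2
    _ ≤ volume Ω ^ (n + (1 - s)) + (n + 1) ^ 2 *
        (ENNReal.ofReal (1 + 2 / (1 - s)) * volume Ω ^ (n + (1 - s))) := by
        gcongr
        · rw [← ENNReal.rpow_natCast]
          refine ENNReal.rpow_le_rpow_of_exponent_ge hΩ1 ?_
          push_cast
          linarith
        · rw [Finset.sum_const, nsmul_eq_mul]
          gcongr
          rw [Finset.offDiag_card, Finset.card_univ, Fintype.card_fin, ← sq]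
          exact_mod_cast Nat.sub_le _ _
    _ = _ := by
        have hc : ENNReal.ofReal (1 + (n + 1) ^ 2 * (1 + 2 / (1 - s))) =
            1 + (n + 1) ^ 2 * ENNReal.ofReal (1 + 2 / (1 - s)) := by
          rw [ENNReal.ofReal_add zero_le_one (by positivity), ENNReal.ofReal_mul (by positivity),
            ENNReal.ofReal_one, ENNReal.ofReal_pow (by positivity),
            ENNReal.ofReal_add (by positivity) zero_le_one, ENNReal.ofReal_natCast,
            ENNReal.ofReal_one]
        rw [hc]
        ring

theorem integral_pow_eq {n : ℕ} {σ g ρ : ℝ → ℝ} {M : ℝ} (hσ : Measurable σ) (hσM : ∀ y, |σ y| ≤ M)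
    (hg : Measurable g) (hg1 : ∀ x, |g x| ≤ 1) (hρ : Measurable ρ) {Ω : Set ℝ}
    (hfin : volume Ω ≠ ⊤) :
    ∫ z in Icc (0 : ℝ) 6, (∫ x in Ω, g x * σ ((z - x) / ρ x)) ^ n =
      ∫ x, (∏ i, g (x i)) * (∫ z in Icc (0 : ℝ) 6, ∏ i, σ ((z - x i) / ρ (x i)))
        ∂(Measure.pi fun _ : Fin n => volume.restrict Ω) := by
  have : IsFiniteMeasure (volume.restrict Ω) := ⟨by
    rw [Measure.restrict_apply_univ]; exact hfin.lt_top⟩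
  have hpow : ∀ z : ℝ, (∫ x in Ω, g x * σ ((z - x) / ρ x)) ^ n =
      ∫ x, ∏ i, (g (x i) * σ ((z - x i) / ρ (x i)))
        ∂(Measure.pi fun _ : Fin n => volume.restrict Ω) := fun z => by
    rw [integral_fintype_prod_eq_pow (fun x => g x * σ ((z - x) / ρ x)), Fintype.card_fin]
  simp_rw [hpow]
  rw [integral_integral_swap]
  · simp_rw [Finset.prod_mul_distrib, integral_const_mul]
  · refine Integrable.of_bound (C := M ^ n) ?_ (Filter.Eventually.of_forall fun q => ?_)
    · refine Measurable.aestronglyMeasurable ?_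
      unfold Function.uncurry
      refine Finset.measurable_fun_prod _ fun i _ => ?_
      have hx : Measurable fun q : ℝ × (Fin n → ℝ) => q.2 i := by fun_prop
      exact (hg.comp hx).mul (hσ.comp ((measurable_fst.sub hx).div (hρ.comp hx)))
    · rw [Function.uncurry, Real.norm_eq_abs, Finset.abs_prod]
      calc _ ≤ ∏ _i : Fin n, M := by
            refine Finset.prod_le_prod (fun _ _ => abs_nonneg _) fun i _ => ?_
            rw [abs_mul]
            exact (mul_le_of_le_one_left (abs_nonneg _) (hg1 _)).trans (hσM _)
        _ = _ := by simp

theorem lintegral_dual_pow_le {n : ℕ} (hn : Even (n + 1)) {s K : ℝ} {k : ℕ} (hs0 : 0 ≤ s) (hs1 : s < 1)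
    {σ g ρ : ℝ → ℝ} {M : ℝ} (hσ : Measurable σ) (hσM : ∀ y, |σ y| ≤ M)
    (hK0 : 0 ≤ K) (hK : ∀ x r : Fin (n + 1) → ℝ, (∀ i, x i ∈ Icc (0 : ℝ) 1) →
      (∀ i, r i ∈ Icc (1 : ℝ) 2) →
      |∫ z in Icc (0 : ℝ) 6, ∏ i, σ ((z - x i) / r i)| ≤ K * weight s k x)
    (hg : Measurable g) (hg1 : ∀ x, |g x| ≤ 1) (hρ : Measurable ρ) (hρ1 : ∀ x, ρ x ∈ Icc (1 : ℝ) 2)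
    {Ω : Set ℝ} (hΩ : MeasurableSet Ω) (hΩ01 : Ω ⊆ Icc 0 1) :
    ∫⁻ z in Icc (0 : ℝ) 6, ‖∫ x in Ω, g x * σ ((z - x) / ρ x)‖ₑ ^ (n + 1) ≤
      ENNReal.ofReal K * (ENNReal.ofReal (1 + (n + 1) ^ 2 * (1 + 2 / (1 - s))) *
        volume Ω ^ (n + (1 - s))) := by
  have hΩ1 : volume Ω ≤ 1 := (measure_mono hΩ01).trans (by simp)
  have hfin : volume Ω ≠ ⊤ := (hΩ1.trans_lt ENNReal.one_lt_top).ne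
  have : IsFiniteMeasure (volume.restrict Ω) := ⟨by
    rw [Measure.restrict_apply_univ]; exact hfin.lt_top⟩
  set T : ℝ → ℝ := fun z => ∫ x in Ω, g x * σ ((z - x) / ρ x) with hT
  have hTm : Measurable T := by
    refine (StronglyMeasurable.integral_prod_right' (f := fun q : ℝ × ℝ =>
      g q.2 * σ ((q.1 - q.2) / ρ q.2)) (Measurable.stronglyMeasurable ?_)).measurable
    exact (hg.comp measurable_snd).mul
      (hσ.comp ((measurable_fst.sub measurable_snd).div (hρ.comp measurable_snd)))
  have hTb : ∀ z, |T z ^ (n + 1)| ≤ M ^ (n + 1) := fun z => by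
    rw [abs_pow]
    refine pow_le_pow_left₀ (abs_nonneg _) ?_ _
    have hM0 : 0 ≤ M := (abs_nonneg _).trans (hσM 0)
    have h1 := norm_setIntegral_le_of_norm_le_const (μ := volume) (s := Ω) (C := M)
      (f := fun x => g x * σ ((z - x) / ρ x)) hfin.lt_top fun x _ => by
        rw [Real.norm_eq_abs, abs_mul]
        exact (mul_le_of_le_one_left (abs_nonneg _) (hg1 _)).trans (hσM _)
    have h2 : volume.real Ω ≤ 1 := ENNReal.toReal_le_of_le_ofReal zero_le_one (by simpa using hΩ1)
    rw [Real.norm_eq_abs] at h1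
    exact h1.trans (mul_le_of_le_one_right hM0 h2)
  calc ∫⁻ z in Icc (0 : ℝ) 6, ‖T z‖ₑ ^ (n + 1) = ∫⁻ z in Icc (0 : ℝ) 6, ENNReal.ofReal (T z ^ (n + 1)) := by
        refine lintegral_congr fun z => ?_
        rw [← hn.pow_abs, ENNReal.ofReal_pow (abs_nonneg _), ← Real.enorm_eq_ofReal_abs]
    _ = ENNReal.ofReal (∫ z in Icc (0 : ℝ) 6, T z ^ (n + 1)) := by
        rw [ofReal_integral_eq_lintegral_ofReal (integrableOn_of_abs_le (hTm.pow_const _) hTb 0 6)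
          (Filter.Eventually.of_forall fun z => hn.pow_nonneg _)]
    _ ≤ ‖∫ z in Icc (0 : ℝ) 6, T z ^ (n + 1)‖ₑ := by
        rw [Real.enorm_eq_ofReal_abs]
        exact ENNReal.ofReal_le_ofReal (le_abs_self _)
    _ ≤ ∫⁻ x, ENNReal.ofReal (K * weight s k x)
          ∂(Measure.pi fun _ : Fin (n + 1) => volume.restrict Ω) := by
        rw [integral_pow_eq hσ hσM hg hg1 hρ hfin]
        refine (enorm_integral_le_lintegral_enorm _).trans (lintegral_mono_ae ?_)
        have hmem : ∀ᵐ x ∂(Measure.pi fun _ : Fin (n + 1) => volume.restrict Ω),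
            ∀ i, x i ∈ Ω := by
          rw [← Measure.restrict_pi_pi]
          filter_upwards [ae_restrict_mem (MeasurableSet.univ_pi fun _ => hΩ)] with x hx i
            using hx i (mem_univ i)
        filter_upwards [hmem] with x hx
        rw [Real.enorm_eq_ofReal_abs, abs_mul]
        refine ENNReal.ofReal_le_ofReal ((mul_le_of_le_one_left (abs_nonneg _) ?_).trans
          (hK x (fun i => ρ (x i)) (fun i => hΩ01 (hx i)) fun i => hρ1 _))
        rw [Finset.abs_prod]
        exact Finset.prod_le_one (fun _ _ => abs_nonneg _) fun i _ => hg1 _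
    _ ≤ _ := by
        simp_rw [ENNReal.ofReal_mul hK0]
        rw [lintegral_const_mul' _ _ ENNReal.ofReal_ne_top]
        gcongr
        exact lintegral_weight_le hs0 hs1 k hΩ1

/-- The dual restricted estimate of exponent `b` and constant `Q` for the averages of `σ`. -/
def DualBound (s b : ℝ) (Q : ENNReal) (σ : ℝ → ℝ) : Prop :=
  ∀ (g ρ : ℝ → ℝ) (Ω : Set ℝ), Measurable g → (∀ x, |g x| ≤ 1) → Measurable ρ →
    (∀ x, ρ x ∈ Icc (1 : ℝ) 2) → MeasurableSet Ω → Ω ⊆ Icc 0 1 →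
    ∫⁻ z in Icc (0 : ℝ) 6, ‖∫ x in Ω, g x * σ ((z - x) / ρ x)‖ₑ ^ b ≤ Q * volume Ω ^ (b - s)

theorem DualBound.of_even {n : ℕ} (hn0 : 0 < n) (hn : Even n) {s K : ℝ} {k : ℕ} (hs0 : 0 ≤ s) (hs1 : s < 1)
    {σ : ℝ → ℝ} {M : ℝ} (hσ : Measurable σ) (hσM : ∀ y, |σ y| ≤ M)
    (hK0 : 0 ≤ K) (hK : ∀ x r : Fin n → ℝ, (∀ i, x i ∈ Icc (0 : ℝ) 1) →
      (∀ i, r i ∈ Icc (1 : ℝ) 2) →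
      |∫ z in Icc (0 : ℝ) 6, ∏ i, σ ((z - x i) / r i)| ≤ K * weight s k x) :
    DualBound s n (ENNReal.ofReal K * ENNReal.ofReal (1 + n ^ 2 * (1 + 2 / (1 - s)))) σ := by
  obtain ⟨n, rfl⟩ := Nat.exists_eq_add_of_le' hn0
  intro g ρ Ω hg hg1 hρ hρ1 hΩ hΩ01
  have := lintegral_dual_pow_le hn hs0 hs1 hσ hσM hK0 hK hg hg1 hρ hρ1 hΩ hΩ01
  simp only [ENNReal.rpow_natCast]
  refine this.trans_eq ?_
  push_cast
  rw [mul_assoc, show (n : ℝ) + (1 - s) = n + 1 - s by ring]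

theorem DualBound.interpolate {s b₁ b₂ : ℝ} {Q₁ Q₂ : ENNReal} {σ : ℝ → ℝ} (hσ : Measurable σ) {τ : ℝ}
    (hb₁ : s ≤ b₁) (hb₂ : s ≤ b₂) (hs : 0 ≤ s)
    (h₁ : DualBound s b₁ Q₁ σ) (h₂ : DualBound s b₂ Q₂ σ) (hτ0 : 0 ≤ τ) (hτ1 : τ ≤ 1) :
    DualBound s (b₁ * (1 - τ) + b₂ * τ) (Q₁ ^ (1 - τ) * Q₂ ^ τ) σ := by
  intro g ρ Ω hg hg1 hρ hρ1 hΩ hΩ01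
  set T : ℝ → ℝ := fun z => ∫ x in Ω, g x * σ ((z - x) / ρ x) with hT
  have hTm : Measurable T := by
    refine (StronglyMeasurable.integral_prod_right' (f := fun q : ℝ × ℝ =>
      g q.2 * σ ((q.1 - q.2) / ρ q.2)) (Measurable.stronglyMeasurable ?_)).measurable
    exact (hg.comp measurable_snd).mul
      (hσ.comp ((measurable_fst.sub measurable_snd).div (hρ.comp measurable_snd)))
  have h := ENNReal.lintegral_mul_norm_pow_le (μ := volume.restrict (Icc (0 : ℝ) 6))
    (f := fun z => ‖T z‖ₑ ^ b₁) (g := fun z => ‖T z‖ₑ ^ b₂) (by fun_prop) (by fun_prop)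
    (sub_nonneg.2 hτ1) hτ0 (sub_add_cancel 1 τ)
  have h1τ : 0 ≤ 1 - τ := sub_nonneg.2 hτ1
  have e1 : ∀ z, (‖T z‖ₑ ^ b₁) ^ (1 - τ) * (‖T z‖ₑ ^ b₂) ^ τ = ‖T z‖ₑ ^ (b₁ * (1 - τ) + b₂ * τ) := fun z => by
    rw [← ENNReal.rpow_mul, ← ENNReal.rpow_mul, ENNReal.rpow_add_of_nonneg _ _ (mul_nonneg (hs.trans hb₁) h1τ)
      (mul_nonneg (hs.trans hb₂) hτ0)]
  simp only [e1] at h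
  refine h.trans ?_
  calc _ ≤ (Q₁ * volume Ω ^ (b₁ - s)) ^ (1 - τ) * (Q₂ * volume Ω ^ (b₂ - s)) ^ τ := by
        gcongr
        · exact h₁ g ρ Ω hg hg1 hρ hρ1 hΩ hΩ01
        · exact h₂ g ρ Ω hg hg1 hρ hρ1 hΩ hΩ01
    _ = _ := by
        rw [ENNReal.mul_rpow_of_nonneg _ _ h1τ, ENNReal.mul_rpow_of_nonneg _ _ hτ0, ← ENNReal.rpow_mul,
          ← ENNReal.rpow_mul]
        have : b₁ * (1 - τ) + b₂ * τ - s = (b₁ - s) * (1 - τ) + (b₂ - s) * τ := by ring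
        rw [this, ENNReal.rpow_add_of_nonneg _ _ (mul_nonneg (sub_nonneg.2 hb₁) h1τ)
          (mul_nonneg (sub_nonneg.2 hb₂) hτ0)]
        ring

/-- The integral of `σ` over the set of `y` with `x + r * y ∈ O`. -/
noncomputable def sliceInt (σ : ℝ → ℝ) (O : Set ℝ) (r x : ℝ) : ℝ := ∫ y in {y | x + r * y ∈ O}, σ y

theorem measurable_sliceInt {σ ρ : ℝ → ℝ} (hσ : Measurable σ) (hρ : Measurable ρ) {O : Set ℝ}
    (hO : MeasurableSet O) : Measurable fun x => sliceInt σ O (ρ x) x := by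
  have : (fun x => sliceInt σ O (ρ x) x) =
      fun x => ∫ y, {q : ℝ × ℝ | q.1 + ρ q.1 * q.2 ∈ O}.indicator (fun q => σ q.2) (x, y) := by
    ext x
    have hm : MeasurableSet {y | x + ρ x * y ∈ O} :=
      (measurable_const.add (measurable_const_mul (ρ x))) hO
    rw [sliceInt, ← integral_indicator hm]
    rfl
  rw [this]
  refine (StronglyMeasurable.integral_prod_right' (Measurable.stronglyMeasurable ?_)).measurable
  refine (hσ.comp measurable_snd).indicator ?_
  exact (measurable_fst.add ((hρ.comp measurable_fst).mul measurable_snd)) hO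

theorem sliceInt_eq {σ : ℝ → ℝ} (hsupp : ∀ y, y ∉ Icc (1 : ℝ) 2 → σ y = 0)
    {O : Set ℝ} (hO : MeasurableSet O) {r x : ℝ} (hr : r ∈ Icc (1 : ℝ) 2) (hx : x ∈ Icc (0 : ℝ) 1) :
    sliceInt σ O r x = r⁻¹ * ∫ z in Icc (0 : ℝ) 6 ∩ O, σ ((z - x) / r) := by
  have hr0 : 0 < r := by linarith [hr.1]
  have hm : MeasurableSet {y | x + r * y ∈ O} :=
      (measurable_const.add (measurable_const_mul r)) hO
  rw [sliceInt, ← integral_indicator hm, ← integral_indicator (measurableSet_Icc.inter hO)]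
  have h1 : ∀ z, (Icc (0 : ℝ) 6 ∩ O).indicator (fun z => σ ((z - x) / r)) z =
      {y | x + r * y ∈ O}.indicator σ ((z - x) / r) := fun z => by
    have hz : x + r * ((z - x) / r) = z := by field_simp; ring
    by_cases hzO : z ∈ O
    · rw [indicator_of_mem (s := {y | x + r * y ∈ O}) (by rw [mem_ofPred_eq, hz]; exact hzO)]
      by_cases hz6 : z ∈ Icc (0 : ℝ) 6
      · rw [indicator_of_mem (s := Icc (0 : ℝ) 6 ∩ O) ⟨hz6, hzO⟩]
      · rw [indicator_of_notMem fun h => hz6 h.1, hsupp]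
        intro h
        rw [mem_Icc, le_div_iff₀ hr0, div_le_iff₀ hr0] at h
        exact hz6 ⟨by linarith [hx.1], by linarith [hx.2, hr.2]⟩
    · rw [indicator_of_notMem fun h => hzO h.2, indicator_of_notMem]
      rw [mem_ofPred_eq, hz]; exact hzO
  simp_rw [h1]
  rw [integral_sub_right_eq_self (fun z => {y | x + r * y ∈ O}.indicator σ (z / r)) x,
    Measure.integral_comp_div, abs_of_pos hr0, smul_eq_mul]
  field_simp

theorem DualBound.lintegral_sliceInt_le {s b M : ℝ} {Q : ENNReal} {σ : ℝ → ℝ} (hσ : Measurable σ)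
    (hσM : ∀ y, |σ y| ≤ M) (hsupp : ∀ y, y ∉ Icc (1 : ℝ) 2 → σ y = 0) (hb : 1 < b)
    (h : DualBound s b Q σ) {O : Set ℝ} (hO : MeasurableSet O) {ρ : ℝ → ℝ} (hρ : Measurable ρ)
    (hρ1 : ∀ x, ρ x ∈ Icc (1 : ℝ) 2) {Ω : Set ℝ} (hΩ : MeasurableSet Ω) (hΩ01 : Ω ⊆ Icc 0 1) :
    ∫⁻ x in Ω, ‖sliceInt σ O (ρ x) x‖ₑ ≤
      volume O ^ ((b - 1) / b) * (Q * volume Ω ^ (b - s)) ^ (1 / b) := by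
  have hΩ1 : volume Ω ≤ 1 := (measure_mono hΩ01).trans (by simp)
  have : IsFiniteMeasure (volume.restrict Ω) := ⟨by
    rw [Measure.restrict_apply_univ]; exact hΩ1.trans_lt ENNReal.one_lt_top⟩
  have : IsFiniteMeasure (volume.restrict (Icc (0 : ℝ) 6 ∩ O)) := ⟨by
    rw [Measure.restrict_apply_univ]
    exact (measure_mono inter_subset_left).trans_lt (by simp)⟩
  set A : ℝ → ℝ := fun x => sliceInt σ O (ρ x) x with hA
  have hAm : Measurable A := measurable_sliceInt hσ hρ hO
  set g : ℝ → ℝ := fun x => (if 0 ≤ A x then 1 else -1) * (ρ x)⁻¹ with hg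
  have hgm : Measurable g :=
    (Measurable.ite (measurableSet_le measurable_const hAm) measurable_const measurable_const).mul
      hρ.inv
  have hg1 : ∀ x, |g x| ≤ 1 := fun x => by
    have h1 : |if 0 ≤ A x then (1 : ℝ) else -1| = 1 := by split_ifs <;> simp
    have h0 : 0 < ρ x := by linarith [(hρ1 x).1]
    rw [hg, abs_mul, h1, one_mul, abs_inv, abs_of_pos h0]
    exact inv_le_one_of_one_le₀ (hρ1 x).1
  set T : ℝ → ℝ := fun z => ∫ x in Ω, g x * σ ((z - x) / ρ x) with hT
  have hjm : Measurable fun q : ℝ × ℝ => g q.2 * σ ((q.1 - q.2) / ρ q.2) :=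
    (hgm.comp measurable_snd).mul
      (hσ.comp ((measurable_fst.sub measurable_snd).div (hρ.comp measurable_snd)))
  have hTm : Measurable T :=
    (StronglyMeasurable.integral_prod_right' hjm.stronglyMeasurable).measurable
  have habs : ∀ x ∈ Ω, |A x| = ∫ z in Icc (0 : ℝ) 6 ∩ O, g x * σ ((z - x) / ρ x) := fun x hx => by
    rw [integral_const_mul, hg, mul_assoc, ← sliceInt_eq hsupp hO (hρ1 x) (hΩ01 hx)]
    change |A x| = _ * A x
    split_ifs with h0
    · rw [abs_of_nonneg h0, one_mul]
    · rw [abs_of_neg (not_le.1 h0)]; ring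
  have hAb : ∀ x ∈ Ω, ‖|A x|‖ ≤ M * 6 := fun x hx => by
    have h1 : ‖∫ z in Icc (0 : ℝ) 6 ∩ O, g x * σ ((z - x) / ρ x)‖ ≤
        M * volume.real (Icc (0 : ℝ) 6 ∩ O) :=
      norm_setIntegral_le_of_norm_le_const (measure_lt_top_of_subset inter_subset_left (by simp))
        fun z _ => by
          rw [Real.norm_eq_abs, abs_mul]
          exact (mul_le_of_le_one_left (abs_nonneg _) (hg1 _)).trans (hσM _)
    rw [habs x hx]
    refine h1.trans (mul_le_mul_of_nonneg_left ?_ ((abs_nonneg _).trans (hσM 0)))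
    refine (measureReal_mono inter_subset_left (by simp)).trans (by simp)
  calc ∫⁻ x in Ω, ‖A x‖ₑ = ENNReal.ofReal (∫ x in Ω, |A x|) := by
        rw [ofReal_integral_eq_lintegral_ofReal]
        · simp_rw [Real.enorm_eq_ofReal_abs]
        · exact Integrable.of_bound hAm.abs.aestronglyMeasurable (M * 6)
            ((ae_restrict_mem hΩ).mono hAb)
        · exact Filter.Eventually.of_forall fun x => abs_nonneg _
    _ = ENNReal.ofReal (∫ z in Icc (0 : ℝ) 6 ∩ O, T z) := by
        rw [setIntegral_congr_fun hΩ habs, integral_integral_swap]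
        refine Integrable.of_bound (C := M) (hjm.comp measurable_swap).aestronglyMeasurable
          (Filter.Eventually.of_forall fun q => ?_)
        rw [Function.uncurry, Real.norm_eq_abs, abs_mul]
        exact (mul_le_of_le_one_left (abs_nonneg _) (hg1 _)).trans (hσM _)
    _ ≤ ∫⁻ z in Icc (0 : ℝ) 6 ∩ O, ‖T z‖ₑ := by
        refine le_trans ?_ (enorm_integral_le_lintegral_enorm _)
        rw [Real.enorm_eq_ofReal_abs]
        exact ENNReal.ofReal_le_ofReal (le_abs_self _)
    _ ≤ (∫⁻ z in Icc (0 : ℝ) 6 ∩ O, 1 ^ (b / (b - 1))) ^ (1 / (b / (b - 1))) *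
          (∫⁻ z in Icc (0 : ℝ) 6 ∩ O, ‖T z‖ₑ ^ b) ^ (1 / b) := by
        have := ENNReal.lintegral_mul_le_Lp_mul_Lq (volume.restrict (Icc (0 : ℝ) 6 ∩ O))
          (Real.HolderConjugate.conjExponent hb).symm (f := fun _ => 1) (g := fun z => ‖T z‖ₑ)
          (by fun_prop) (by fun_prop)
        simpa [Real.conjExponent] using this
    _ ≤ _ := by
        have hb1 : 0 < b - 1 := by linarith
        have hb0 : 0 < b := by linarith
        rw [ENNReal.one_rpow, one_div_div, lintegral_one, Measure.restrict_apply_univ]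
        gcongr
        · exact inter_subset_right
        · exact (lintegral_mono_set inter_subset_left).trans (h g ρ Ω hgm hg1 hρ hρ1 hΩ hΩ01)

theorem DualBound.weak_type {s b M : ℝ} (hs0 : 0 < s) {Q : ENNReal} {σ : ℝ → ℝ} (hσ : Measurable σ)
    (hσM : ∀ y, |σ y| ≤ M) (hsupp : ∀ y, y ∉ Icc (1 : ℝ) 2 → σ y = 0) (hb : 1 < b)
    (h : DualBound s b Q σ) {O : Set ℝ} (hO : MeasurableSet O) {u : ℕ → ℝ}
    (hu : ∀ i, u i ∈ Icc (1 : ℝ) 2) {lam : ENNReal} (hlam0 : lam ≠ 0) (hlam : lam ≠ ⊤) :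
    volume {x ∈ Icc (0 : ℝ) 1 | lam < ⨆ i, ‖sliceInt σ O (u i) x‖ₑ} ≤
      Q ^ (1 / s) * volume O ^ ((b - 1) / s) * lam ^ (-(b / s)) := by
  classical
  set V : Set ℝ := {x ∈ Icc (0 : ℝ) 1 | lam < ⨆ i, ‖sliceInt σ O (u i) x‖ₑ} with hV
  have hm : ∀ i, Measurable fun x => ‖sliceInt σ O (u i) x‖ₑ := fun i =>
    (measurable_sliceInt hσ (measurable_const (a := u i)) hO).enorm
  have hVm : MeasurableSet V :=
    measurableSet_Icc.inter (measurableSet_lt measurable_const (Measurable.iSup hm))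
  have hV01 : V ⊆ Icc 0 1 := fun x hx => hx.1
  have hVfin : volume V ≠ ⊤ := ((measure_mono hV01).trans_lt (by simp)).ne
  have hex : ∀ x, ∃ i, lam < ‖sliceInt σ O (u i) x‖ₑ ∨ ∀ j, ¬ lam < ‖sliceInt σ O (u j) x‖ₑ := fun x => by
    by_cases hx : ∃ i, lam < ‖sliceInt σ O (u i) x‖ₑ
    · exact hx.imp fun i hi => Or.inl hi
    · push Not at hx
      exact ⟨0, Or.inr fun j => not_lt.2 (hx j)⟩
  set N : ℝ → ℕ := fun x => Nat.find (hex x) with hN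
  have hpm : MeasurableSet {x | ∀ j, ¬ lam < ‖sliceInt σ O (u j) x‖ₑ} := by
    have : {x | ∀ j, ¬ lam < ‖sliceInt σ O (u j) x‖ₑ} =
        ⋂ j, {x | lam < ‖sliceInt σ O (u j) x‖ₑ}ᶜ := by ext; simp
    rw [this]
    exact MeasurableSet.iInter fun j => (measurableSet_lt measurable_const (hm j)).compl
  have hNm : Measurable N := measurable_find hex fun i =>
    (measurableSet_lt measurable_const (hm i)).union hpm
  have hρm : Measurable fun x => u (N x) := (measurable_of_countable u).comp hNm
  have hlow : ∀ x ∈ V, lam ≤ ‖sliceInt σ O (u (N x)) x‖ₑ := fun x hx => by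
    obtain ⟨i, hi⟩ := lt_iSup_iff.1 hx.2
    rcases Nat.find_spec (hex x) with h1 | h1
    · exact h1.le
    · exact absurd hi (h1 i)
  have h1 : lam * volume V ≤ volume O ^ ((b - 1) / b) * (Q * volume V ^ (b - s)) ^ (1 / b) :=
    calc lam * volume V = ∫⁻ _ in V, lam := by rw [setLIntegral_const]
      _ ≤ ∫⁻ x in V, ‖sliceInt σ O (u (N x)) x‖ₑ := setLIntegral_mono' hVm hlow
      _ ≤ _ := h.lintegral_sliceInt_le hσ hσM hsupp hb hO hρm (fun x => hu _) hVm hV01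
  have hb0 : 0 < b := by linarith
  rcases eq_or_ne (volume V) 0 with h0 | h0
  · rw [h0]; exact zero_le
  have h2 : (lam * volume V) ^ b ≤ volume O ^ (b - 1) * (Q * volume V ^ (b - s)) := by
    refine (ENNReal.rpow_le_rpow h1 hb0.le).trans_eq ?_
    rw [ENNReal.mul_rpow_of_nonneg _ _ hb0.le, ← ENNReal.rpow_mul, ← ENNReal.rpow_mul,
      div_mul_cancel₀ _ hb0.ne', div_mul_cancel₀ _ hb0.ne', ENNReal.rpow_one]
  have h3 : volume V ^ s ≤ Q * volume O ^ (b - 1) * lam ^ (-b) := by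
    have hc0 : lam ^ b * volume V ^ (b - s) ≠ 0 :=
      mul_ne_zero (ENNReal.rpow_pos (pos_iff_ne_zero.2 hlam0) hlam).ne' (ENNReal.rpow_pos (pos_iff_ne_zero.2 h0) hVfin).ne'
    have hc1 : lam ^ b * volume V ^ (b - s) ≠ ⊤ :=
      ENNReal.mul_ne_top (ENNReal.rpow_ne_top_of_nonneg hb0.le hlam)
        (ENNReal.rpow_ne_top_of_ne_zero h0 hVfin)
    rw [← ENNReal.mul_le_mul_iff_right hc0 hc1]
    calc _ = (lam * volume V) ^ b := by
          rw [ENNReal.mul_rpow_of_nonneg _ _ hb0.le, mul_assoc, ← ENNReal.rpow_add _ _ h0 hVfin,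
            sub_add_cancel]
      _ ≤ _ := h2
      _ = (lam ^ b * lam ^ (-b)) * (volume O ^ (b - 1) * (Q * volume V ^ (b - s))) := by
          rw [← ENNReal.rpow_add _ _ hlam0 hlam, add_neg_cancel, ENNReal.rpow_zero, one_mul]
      _ = _ := by ring
  calc volume V = (volume V ^ s) ^ (1 / s) := by
        rw [← ENNReal.rpow_mul, mul_one_div_cancel hs0.ne', ENNReal.rpow_one]
    _ ≤ (Q * volume O ^ (b - 1) * lam ^ (-b)) ^ (1 / s) := by gcongr
    _ = _ := by
        have : 0 ≤ 1 / s := by positivity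
        rw [ENNReal.mul_rpow_of_nonneg _ _ this, ENNReal.mul_rpow_of_nonneg _ _ this,
          ← ENNReal.rpow_mul, ← ENNReal.rpow_mul]
        congr 3 <;> ring

theorem lintegral_rpow_le_of_weak_type {α : Type*} [MeasurableSpace α] {μ : Measure α}
    {F : α → ENNReal} (hF : Measurable F) {m : ℝ} (hm : 0 ≤ m) (hFm : ∀ x, F x ≤ ENNReal.ofReal m)
    {D : ENNReal} {a q : ℝ} (ha : 0 < a) (haq : a < q)
    (hw : ∀ lam : ENNReal, lam ≠ 0 → lam ≠ ⊤ → μ {x | lam < F x} ≤ D * lam ^ (-a)) :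
    ∫⁻ x, F x ^ q ∂μ ≤ D * ENNReal.ofReal (q * (m ^ (q - a) / (q - a))) := by
  have hq : 0 < q := ha.trans haq
  have hFtop : ∀ x, F x ≠ ⊤ := fun x => ((hFm x).trans_lt ENNReal.ofReal_lt_top).ne
  have h1 := lintegral_rpow_eq_lintegral_meas_lt_mul μ (f := fun x => (F x).toReal)
    (Filter.Eventually.of_forall fun x => ENNReal.toReal_nonneg) hF.ennreal_toReal.aemeasurable hq
  have h2 : ∀ x, ENNReal.ofReal ((F x).toReal ^ q) = F x ^ q := fun x => by
    rw [← ENNReal.ofReal_rpow_of_nonneg ENNReal.toReal_nonneg hq.le, ENNReal.ofReal_toReal (hFtop x)]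
  simp only [h2] at h1
  rw [h1]
  have h3 : ∫⁻ t in Ioi (0 : ℝ), μ {x | t < (F x).toReal} * ENNReal.ofReal (t ^ (q - 1)) ≤
      ∫⁻ t in Ioo (0 : ℝ) m, D * ENNReal.ofReal (t ^ (-(1 + a - q))) := by
    rw [← lintegral_indicator measurableSet_Ioi, ← lintegral_indicator measurableSet_Ioo]
    refine lintegral_mono fun t => ?_
    by_cases ht0 : 0 < t
    · rw [indicator_of_mem (mem_Ioi.2 ht0)]
      by_cases htm : t < m
      · rw [indicator_of_mem (mem_Ioo.2 ⟨ht0, htm⟩)]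
        have hset : {x | t < (F x).toReal} = {x | ENNReal.ofReal t < F x} := by
          ext x
          simp [ENNReal.ofReal_lt_iff_lt_toReal ht0.le (hFtop x)]
        calc _ ≤ D * ENNReal.ofReal t ^ (-a) * ENNReal.ofReal (t ^ (q - 1)) := by
              rw [hset]
              gcongr
              exact hw _ (by simpa using ht0) ENNReal.ofReal_ne_top
          _ = _ := by
              rw [ENNReal.ofReal_rpow_of_pos ht0, mul_assoc, ← ENNReal.ofReal_mul (by positivity),
                ← Real.rpow_add ht0]
              congr 3
              ring
      · have : {x | t < (F x).toReal} = ∅ := by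
          refine eq_empty_of_forall_notMem fun x hx => htm ?_
          exact lt_of_lt_of_le hx (ENNReal.toReal_le_of_le_ofReal hm (hFm x))
        rw [this]; simp
    · rw [indicator_of_notMem (by simpa using ht0)]; exact zero_le
  calc _ ≤ ENNReal.ofReal q * ∫⁻ t in Ioo (0 : ℝ) m, D * ENNReal.ofReal (t ^ (-(1 + a - q))) := by
        gcongr
    _ = _ := by
        rw [lintegral_const_mul _ (by fun_prop), lintegral_Ioo_rpow_neg (by linarith) hm,
          ENNReal.ofReal_mul hq.le, show 1 - (1 + a - q) = q - a by ring]
        ring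

theorem DualBound.strong_type {s b M : ℝ} (hs0 : 0 < s) {Q : ENNReal} {σ : ℝ → ℝ} (hσ : Measurable σ)
    (hσM : ∀ y, |σ y| ≤ M) (hsupp : ∀ y, y ∉ Icc (1 : ℝ) 2 → σ y = 0) (hb : 1 < b)
    (h : DualBound s b Q σ) {m : ℝ} (hm : 0 ≤ m) (hσm : ∫⁻ y, ‖σ y‖ₑ ≤ ENNReal.ofReal m)
    {O : Set ℝ} (hO : MeasurableSet O) {u : ℕ → ℝ}
    (hu : ∀ i, u i ∈ Icc (1 : ℝ) 2) {q : ℝ} (hq : b / s < q) :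
    ∫⁻ x in Icc (0 : ℝ) 1, (⨆ i, ‖sliceInt σ O (u i) x‖ₑ) ^ q ≤
      ENNReal.ofReal (q * (m ^ (q - b / s) / (q - b / s))) *
        volume O ^ ((b - 1) / s) * Q ^ (1 / s) := by
  have hmeas : Measurable fun x => ⨆ i, ‖sliceInt σ O (u i) x‖ₑ :=
    Measurable.iSup fun i => (measurable_sliceInt hσ (measurable_const (a := u i)) hO).enorm
  refine (lintegral_rpow_le_of_weak_type (D := Q ^ (1 / s) * volume O ^ ((b - 1) / s)) hmeas hm
    (fun x => iSup_le fun i => ?_) (by positivity) hq fun lam h0 htop => ?_).trans_eq (by ring)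
  · exact ((enorm_integral_le_lintegral_enorm _).trans (setLIntegral_le_lintegral _ _)).trans hσm
  · rw [Measure.restrict_apply (measurableSet_lt measurable_const hmeas)]
    refine le_trans (measure_mono ?_) (h.weak_type hs0 hσ hσM hsupp hb hO hu h0 htop)
    exact fun x hx => ⟨hx.2, hx.1⟩

theorem lintegral_tsum_rpow_le {q c : ℝ} (hq : 0 < q) (hc : 0 < c) :
    ∃ C : ENNReal, C ≠ ⊤ ∧ ∀ {α : Type} [MeasurableSpace α] (μ : Measure α) (a : ℕ → α → ENNReal)
      (D : ENNReal), (∀ k, Measurable (a k)) →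
      (∀ k : ℕ, ∫⁻ x, a k x ^ q ∂μ ≤ D * ENNReal.ofReal (2 ^ (-(c * k)))) →
      ∫⁻ x, (∑' k, a k x) ^ q ∂μ ≤ C * D := by
  set w : ℕ → ENNReal := fun k => 2 ^ (-(c / (2 * q) * k)) with hw
  have geom : ∀ κ : ℝ, 0 < κ → ∑' k : ℕ, (2 : ENNReal) ^ (-(κ * k)) ≠ ⊤ := fun κ hκ => by
    have : ∀ k : ℕ, (2 : ENNReal) ^ (-(κ * k)) = (2 ^ (-κ)) ^ k := fun k => by
      rw [← ENNReal.rpow_natCast, ← ENNReal.rpow_mul]; ring_nf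
    simp_rw [this]
    rw [ENNReal.tsum_geometric]
    refine ENNReal.inv_ne_top.2 (tsub_pos_of_lt ?_).ne'
    exact ENNReal.rpow_lt_one_of_one_lt_of_neg (by norm_num) (by linarith)
  have hw0 : ∀ k, w k ≠ 0 := fun k => by simp [hw]
  have hwt : ∀ k, w k ≠ ⊤ := fun k => by simp [hw]
  refine ⟨(∑' k, w k) ^ q * ∑' k : ℕ, 2 ^ (-(c / 2 * k)), ENNReal.mul_ne_top
    (ENNReal.rpow_ne_top_of_nonneg hq.le (geom _ (by positivity))) (geom _ (by positivity)), ?_⟩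
  intro α _ μ a D ha hD
  have hpt : ∀ x, (∑' k, a k x) ^ q ≤ (∑' k, w k) ^ q * ∑' k, (w k)⁻¹ ^ q * a k x ^ q := fun x => by
    set S := ∑' k, (w k)⁻¹ ^ q * a k x ^ q with hS
    have h1 : ∀ k, a k x ≤ w k * S ^ (1 / q) := fun k => by
      have h2 : ((w k)⁻¹ * a k x) ^ q ≤ S := by
        rw [ENNReal.mul_rpow_of_nonneg _ _ hq.le]
        exact ENNReal.le_tsum k
      have h3 : (w k)⁻¹ * a k x ≤ S ^ (1 / q) := by
        rw [one_div, ENNReal.le_rpow_inv_iff hq]; exact h2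
      calc a k x = w k * ((w k)⁻¹ * a k x) := by
            rw [← mul_assoc, ENNReal.mul_inv_cancel (hw0 k) (hwt k), one_mul]
        _ ≤ _ := by gcongr
    calc _ ≤ (∑' k, w k * S ^ (1 / q)) ^ q := by
          gcongr with k
          exact h1 k
      _ = _ := by
          rw [ENNReal.tsum_mul_right, ENNReal.mul_rpow_of_nonneg _ _ hq.le, ← ENNReal.rpow_mul,
            one_div_mul_cancel hq.ne', ENNReal.rpow_one]
  calc _ ≤ ∫⁻ x, (∑' k, w k) ^ q * ∑' k, (w k)⁻¹ ^ q * a k x ^ q ∂μ := lintegral_mono hpt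
    _ = (∑' k, w k) ^ q * ∑' k, (w k)⁻¹ ^ q * ∫⁻ x, a k x ^ q ∂μ := by
        rw [lintegral_const_mul _ (Measurable.tsum fun k => ((ha k).pow_const q).const_mul _),
          lintegral_tsum fun k => (((ha k).pow_const q).const_mul _).aemeasurable]
        congr 2
        ext k
        rw [lintegral_const_mul _ ((ha k).pow_const q)]
    _ ≤ (∑' k, w k) ^ q * ∑' k : ℕ, 2 ^ (-(c / 2 * k)) * D := by
        refine mul_le_mul' le_rfl (ENNReal.tsum_le_tsum fun k => ?_)
        calc _ ≤ (w k)⁻¹ ^ q * (D * ENNReal.ofReal (2 ^ (-(c * k)))) := by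
              gcongr; exact hD k
          _ = ((w k)⁻¹ ^ q * 2 ^ (-(c * k))) * D := by
              rw [← ENNReal.ofReal_rpow_of_pos two_pos, ENNReal.ofReal_ofNat]; ring
          _ = _ := by
              rw [hw, ← ENNReal.rpow_neg, ← ENNReal.rpow_mul,
                ← ENNReal.rpow_add _ _ (by norm_num) (by norm_num)]
              congr 2
              field_simp
              ring
    _ = _ := by rw [ENNReal.tsum_mul_right]; ring

namespace IsSelection

variable {s : ℝ} {E B : ℕ → Finset ℕ} {ν : Measure ℝ} {φ : ℕ → ℕ}

theorem measure_le_tsum (h : IsSelection s E B)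
    (hν : ∀ U, IsOpen U → ν U ≤ Filter.liminf (fun n => levelMeasure s E (φ n) U) Filter.atTop)
    {U : Set ℝ} (hU : IsOpen U) :
    ν U ≤ ‖∫ y in U, levelFun s E 0 y‖ₑ + ∑' k, ‖∫ y in U, diffFun s E k y‖ₑ := by
  have hk : ∀ k, levelMeasure s E k U ≤
      ‖∫ y in U, levelFun s E 0 y‖ₑ + ∑ j ∈ Finset.range k, ‖∫ y in U, diffFun s E j y‖ₑ := fun k => by
    have h1 : ‖∫ y in U, levelFun s E k y‖ₑ ≤
      ‖∫ y in U, levelFun s E 0 y‖ₑ + ∑ j ∈ Finset.range k, ‖∫ y in U, diffFun s E j y‖ₑ := by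
      induction k with
      | zero => simp
      | succ k ih =>
        have h2 : ∫ y in U, levelFun s E (k + 1) y =
            (∫ y in U, levelFun s E k y) + ∫ y in U, diffFun s E k y := by
          rw [← integral_add (h.integrable_levelFun k).integrableOn]
          · simp [diffFun]
          · exact ((h.integrable_levelFun (k + 1)).sub (h.integrable_levelFun k)).integrableOn
        rw [h2, Finset.sum_range_succ, ← add_assoc]
        exact (enorm_add_le _ _).trans (add_le_add ih le_rfl)
    rw [h.levelMeasure_apply k hU.measurableSet]
    refine le_trans ?_ h1
    rw [Real.enorm_eq_ofReal_abs]
    exact ENNReal.ofReal_le_ofReal (le_abs_self _)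
  refine (hν U hU).trans (Filter.liminf_le_of_le ?_ fun a ha => ?_)
  · isBoundedDefault
  · obtain ⟨n, hn⟩ := ha.exists
    exact hn.trans ((hk _).trans (add_le_add le_rfl (ENNReal.sum_le_tsum _)))

theorem lintegral_levelFun (h : IsSelection s E B) (hs0 : 0 ≤ s) (hs1 : s ≤ 1) (k : ℕ) :
    ∫⁻ y, ‖levelFun s E k y‖ₑ = 1 := by
  simp_rw [Real.enorm_of_nonneg (levelFun_nonneg s E k _)]
  rw [← ofReal_integral_eq_lintegral_ofReal (h.integrable_levelFun k)
    (Filter.Eventually.of_forall (levelFun_nonneg s E k)), h.integral_levelFun hs0 hs1 k,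
    ENNReal.ofReal_one]

theorem lintegral_diffFun_le (h : IsSelection s E B) (hs0 : 0 ≤ s) (hs1 : s ≤ 1) (k : ℕ) :
    ∫⁻ y, ‖diffFun s E k y‖ₑ ≤ ENNReal.ofReal 2 := by
  calc _ ≤ ∫⁻ y, (‖levelFun s E (k + 1) y‖ₑ + ‖levelFun s E k y‖ₑ) :=
        lintegral_mono fun y => enorm_sub_le
    _ = 1 + 1 := by
        rw [lintegral_add_left (measurable_levelFun s E (k + 1)).enorm, h.lintegral_levelFun hs0 hs1,
          h.lintegral_levelFun hs0 hs1]
    _ = _ := by norm_num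

theorem abs_levelFun_le (k : ℕ) (y : ℝ) : |levelFun s E k y| ≤ levelDensity s k := by
  rw [abs_of_nonneg (levelFun_nonneg s E k y)]
  exact stepFun_le (zero_le_one.trans (one_le_levelDensity s k)) _ _

theorem abs_diffFun_le (k : ℕ) (y : ℝ) :
    |diffFun s E k y| ≤ levelDensity s (k + 1) + levelDensity s k :=
  (abs_sub _ _).trans (add_le_add (abs_levelFun_le _ _) (abs_levelFun_le _ _))

theorem measurable_diffFun (k : ℕ) : Measurable (diffFun s E k) :=
  (measurable_levelFun s E (k + 1)).sub (measurable_levelFun s E k)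

theorem lintegral_sliceInt_zero_le (h : IsSelection s E B) (hs0 : 0 ≤ s) (hs1 : s ≤ 1)
    {O : Set ℝ} {u : ℕ → ℝ} (hu : ∀ i, u i ∈ Icc (1 : ℝ) 2)
    {a q : ℝ} (ha : 0 ≤ a) (haq : a ≤ q) :
    ∫⁻ x in Icc (0 : ℝ) 1, (⨆ i, ‖sliceInt (levelFun s E 0) O (u i) x‖ₑ) ^ q ≤
      ENNReal.ofReal (levelDensity s 0) ^ a * volume O ^ a := by
  have h1 : ∀ x, ⨆ i, ‖sliceInt (levelFun s E 0) O (u i) x‖ₑ ≤ 1 := fun x => iSup_le fun i =>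
    ((enorm_integral_le_lintegral_enorm _).trans (setLIntegral_le_lintegral _ _)).trans_eq
      (h.lintegral_levelFun hs0 hs1 0)
  have h2 : ∀ x, ⨆ i, ‖sliceInt (levelFun s E 0) O (u i) x‖ₑ ≤
      ENNReal.ofReal (levelDensity s 0) * volume O := fun x => iSup_le fun i => by
    have hui : 0 < u i := by linarith [(hu i).1]
    calc _ ≤ ∫⁻ y in {y | x + u i * y ∈ O}, ‖levelFun s E 0 y‖ₑ := enorm_integral_le_lintegral_enorm _
      _ ≤ ∫⁻ y in {y | x + u i * y ∈ O}, ENNReal.ofReal (levelDensity s 0) := by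
          refine lintegral_mono fun y => ?_
          rw [Real.enorm_eq_ofReal_abs]
          exact ENNReal.ofReal_le_ofReal (abs_levelFun_le 0 y)
      _ = ENNReal.ofReal (levelDensity s 0) * volume {y | x + u i * y ∈ O} := setLIntegral_const _ _
      _ ≤ _ := by
          refine mul_le_mul' le_rfl ?_
          have : {y | x + u i * y ∈ O} = (fun y => u i * y) ⁻¹' ((fun z => x + z) ⁻¹' O) := rfl
          rw [this, Real.volume_preimage_mul_left hui.ne', measure_preimage_add]
          refine mul_le_of_le_one_left zero_le ?_
          rw [abs_of_pos (inv_pos.2 hui)]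
          exact ENNReal.ofReal_le_one.2 (inv_le_one_of_one_le₀ (hu i).1)
  calc _ ≤ ∫⁻ x in Icc (0 : ℝ) 1, (ENNReal.ofReal (levelDensity s 0) * volume O) ^ a := by
        refine lintegral_mono fun x => ?_
        exact (ENNReal.rpow_le_rpow_of_exponent_ge (h1 x) haq).trans
          (ENNReal.rpow_le_rpow (h2 x) ha)
    _ = _ := by
        rw [setLIntegral_const, ENNReal.mul_rpow_of_nonneg _ _ ha]
        simp

theorem exists_restricted_bound (h : IsSelection s E B) (hs0 : 0 < s) (hs1 : s ≤ 1)
    (hν : ∀ U, IsOpen U → ν U ≤ Filter.liminf (fun n => levelMeasure s E (φ n) U) Filter.atTop)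
    {b c : ℝ} (hb : 1 < b) (hc : 0 < c) {Q : ENNReal} (hQ : Q ≠ ⊤)
    (hD : ∀ k : ℕ, DualBound s b (Q * ENNReal.ofReal (2 ^ (-(c * k)))) (diffFun s E k))
    {q : ℝ} (hq : b / s < q) {u : ℕ → ℝ} (hu : ∀ i, u i ∈ Icc (1 : ℝ) 2) :
    ∃ C : ENNReal, C ≠ ⊤ ∧ ∀ O, IsOpen O →
      ∫⁻ x in Icc (0 : ℝ) 1, (⨆ i, ν {y | x + u i * y ∈ O}) ^ q ≤ C * volume O ^ ((b - 1) / s) := by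
  have hbs : 0 < b / s := by positivity
  have hb1 : 0 ≤ (b - 1) / s := div_nonneg (by linarith) hs0.le
  have hbs' : (b - 1) / s ≤ q := le_trans (by gcongr; linarith) hq.le
  obtain ⟨C, hC, hsum⟩ := lintegral_tsum_rpow_le (hbs.trans hq) (div_pos hc hs0)
  set K : ENNReal := ENNReal.ofReal (q * (2 ^ (q - b / s) / (q - b / s))) with hK
  set L : ENNReal := ENNReal.ofReal (levelDensity s 0) ^ ((b - 1) / s) with hL
  have hLt : L ≠ ⊤ := ENNReal.rpow_ne_top_of_nonneg hb1 ENNReal.ofReal_ne_top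
  set R : ENNReal := L + K * Q ^ (1 / s) * ENNReal.ofReal (2 ^ (c / s)) with hR
  have hRt : R ≠ ⊤ := ENNReal.add_ne_top.2 ⟨hLt, ENNReal.mul_ne_top (ENNReal.mul_ne_top
    ENNReal.ofReal_ne_top (ENNReal.rpow_ne_top_of_nonneg (by positivity) hQ)) ENNReal.ofReal_ne_top⟩
  refine ⟨C * R, ENNReal.mul_ne_top hC hRt, fun O hO => ?_⟩
  set f : ℕ → ℝ → ℝ := fun k => Nat.casesOn k (levelFun s E 0) (diffFun s E) with hf
  have hfm : ∀ k, Measurable (f k) := fun k => by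
    cases k
    exacts [measurable_levelFun s E 0, measurable_diffFun _]
  set a : ℕ → ℝ → ENNReal := fun k x => ⨆ i, ‖sliceInt (f k) O (u i) x‖ₑ with ha
  have ham : ∀ k, Measurable (a k) := fun k => Measurable.iSup fun i =>
    (measurable_sliceInt (hfm k) (measurable_const (a := u i)) hO.measurableSet).enorm
  have hle : ∀ x, ⨆ i, ν {y | x + u i * y ∈ O} ≤ ∑' k, a k x := fun x => iSup_le fun i => by
    have hopen : IsOpen {y | x + u i * y ∈ O} := hO.preimage (by fun_prop)
    refine (h.measure_le_tsum hν hopen).trans ?_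
    have : ∀ k, ‖∫ y in {y | x + u i * y ∈ O}, f k y‖ₑ ≤ a k x := fun k =>
      le_iSup (fun i => ‖sliceInt (f k) O (u i) x‖ₑ) i
    refine le_trans (le_of_eq ?_) (ENNReal.tsum_le_tsum this)
    exact (tsum_eq_zero_add' (f := fun k => ‖∫ y in {y | x + u i * y ∈ O}, f k y‖ₑ)
      ENNReal.summable).symm
  calc _ ≤ ∫⁻ x in Icc (0 : ℝ) 1, (∑' k, a k x) ^ q :=
        lintegral_mono fun x => ENNReal.rpow_le_rpow (hle x) (hbs.trans hq).le
    _ ≤ C * (R * volume O ^ ((b - 1) / s)) := by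
        refine hsum _ a _ ham fun k => ?_
        cases k with
        | zero =>
          refine (h.lintegral_sliceInt_zero_le hs0.le hs1 hu hb1 hbs').trans ?_
          simp only [Nat.cast_zero, mul_zero, neg_zero, Real.rpow_zero, ENNReal.ofReal_one, mul_one]
          gcongr
          exact le_self_add
        | succ k =>
          refine ((hD k).strong_type hs0 (measurable_diffFun k) (abs_diffFun_le k) (fun y hy => ?_) hb
            zero_le_two (h.lintegral_diffFun_le hs0.le hs1 k) hO.measurableSet hu hq).trans ?_
          · have hy' : y ∉ Ico (1 : ℝ) 2 := fun hh => hy (Ico_subset_Icc_self hh)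
            rw [diffFun, h.levelFun_eq_zero _ hy', h.levelFun_eq_zero _ hy', sub_zero]
          · have e1 : ENNReal.ofReal (2 ^ (-(c * (k : ℝ)))) ^ (1 / s) =
                ENNReal.ofReal (2 ^ (c / s)) * ENNReal.ofReal (2 ^ (-(c / s * ((k + 1 : ℕ) : ℝ)))) := by
              rw [← ENNReal.ofReal_mul (by positivity), ← Real.rpow_add two_pos,
                ENNReal.ofReal_rpow_of_pos (by positivity), ← Real.rpow_mul zero_le_two]
              congr 2
              push_cast
              field_simp
              ring
            rw [ENNReal.mul_rpow_of_nonneg _ _ (by positivity), e1]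
            calc _ = K * Q ^ (1 / s) * ENNReal.ofReal (2 ^ (c / s)) * volume O ^ ((b - 1) / s) *
                  ENNReal.ofReal (2 ^ (-(c / s * ((k + 1 : ℕ) : ℝ)))) := by ring
              _ ≤ _ := by
                  gcongr
                  exact le_add_self
    _ = _ := by ring

end IsSelection

/-- Open sets are almost as large along a dense sequence of dilations. -/
theorem measure_dilate_le_iSup {ν : Measure ℝ} [IsFiniteMeasure ν] {O : Set ℝ} (hO : IsOpen O)
    {u : ℕ → Icc (1 : ℝ) 2} (hu : DenseRange u) (x : ℝ) (r : Icc (1 : ℝ) 2) :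
    ν {y | x + r * y ∈ O} ≤ ⨆ i, ν {y | x + u i * y ∈ O} := by
  have hopen : IsOpen {y | x + (r : ℝ) * y ∈ O} := hO.preimage (by fun_prop)
  refine le_of_forall_lt fun a ha => ?_
  obtain ⟨K, hKsub, hK, haK⟩ := hopen.exists_lt_isCompact ha
  have hev : ∀ᶠ r' : Icc (1 : ℝ) 2 in nhds r, ∀ y ∈ K, x + (r' : ℝ) * y ∈ O := by
    refine hK.eventually_forall_of_forall_eventually fun y hy => ?_
    have hc : Continuous fun z : Icc (1 : ℝ) 2 × ℝ => x + (z.1 : ℝ) * z.2 := by fun_prop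
    exact hc.continuousAt.eventually (hO.mem_nhds (hKsub hy))
  obtain ⟨_, hi, i, rfl⟩ := mem_closure_iff_nhds.1 (hu r) _ hev
  exact haK.trans_le ((measure_mono hi).trans (le_iSup (fun i => ν {y | x + u i * y ∈ O}) i))

theorem IsSelection.exists_dualBound {s : ℝ} {E B : ℕ → Finset ℕ} (h : IsSelection s E B)
    (hs0 : 0 ≤ s) (hs1 : s < 1) {d : ℕ} (hd0 : 0 < d) (hd : Even d) {C : ℝ → ℝ} (hC : ∀ ε, 0 ≤ C ε)
    (hB : ∀ k, ∀ ε : ℝ, 0 < ε → CorrBound d s (C ε) ε k (levelDensity s k) (E k) (B k) ∧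
      CorrBound (d + 2) s (C ε) ε k (levelDensity s k) (E k) (B k))
    (hd1 : d * (1 - s) < 1) (hd2 : 1 ≤ (d + 2) * (1 - s)) {τ : ℝ} (hτ0 : 0 ≤ τ) (hτ1 : τ ≤ 1)
    (hτ : τ * ((d + 2) * (1 - s) - 1) < (1 - τ) * ((1 - d * (1 - s)) / 2)) :
    ∃ Q : ENNReal, Q ≠ ⊤ ∧ ∃ c : ℝ, 0 < c ∧ ∀ k : ℕ,
      DualBound s (d + 2 * τ) (Q * ENNReal.ofReal (2 ^ (-(c * k)))) (diffFun s E k) := by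
  set θ : ℝ := (1 - d * (1 - s)) / 2 with hθ
  set ξ : ℝ := (d + 2) * (1 - s) - 1 with hξ
  set ε : ℝ := ((1 - τ) * θ - τ * ξ) / 2 with hε
  have hε0 : 0 < ε := by linarith
  obtain ⟨K₁, hK₁, h₁⟩ := h.exists_abs_integral_diffFun_le hd0 hs0 hs1.le (hC ε) hε0
    fun k => (hB k ε hε0).1
  obtain ⟨K₂, hK₂, h₂⟩ := h.exists_abs_integral_diffFun_le (n := d + 2) (by omega) hs0 hs1.le (hC ε) hε0
    fun k => (hB k ε hε0).2
  have e₁ : ((d : ℝ) * (1 - s) - 1 + max 0 ((d : ℝ) * (1 - s) - 1)) / 2 + ε = -θ + ε := by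
    rw [max_eq_left (by linarith), hθ]; ring
  have e₂ : (((d + 2 : ℕ) : ℝ) * (1 - s) - 1 + max 0 (((d + 2 : ℕ) : ℝ) * (1 - s) - 1)) / 2 + ε =
      ξ + ε := by
    push_cast
    rw [max_eq_right (by linarith)]; ring
  rw [e₁] at h₁
  rw [e₂] at h₂
  have hτ' : 0 ≤ 1 - τ := by linarith
  set c₁ : ENNReal := ENNReal.ofReal (1 + (d : ℝ) ^ 2 * (1 + 2 / (1 - s)))
  set c₂ : ENNReal := ENNReal.ofReal (1 + ((d + 2 : ℕ) : ℝ) ^ 2 * (1 + 2 / (1 - s)))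
  refine ⟨(ENNReal.ofReal K₁ * c₁) ^ (1 - τ) * (ENNReal.ofReal K₂ * c₂) ^ τ, ENNReal.mul_ne_top
    (ENNReal.rpow_ne_top_of_nonneg hτ' (ENNReal.mul_ne_top ENNReal.ofReal_ne_top ENNReal.ofReal_ne_top))
    (ENNReal.rpow_ne_top_of_nonneg hτ0 (ENNReal.mul_ne_top ENNReal.ofReal_ne_top ENNReal.ofReal_ne_top)),
    ε, hε0, fun k => ?_⟩
  have hds : s ≤ (d : ℝ) := hs1.le.trans (by exact_mod_cast hd0)
  have D₁ := DualBound.of_even (k := k) hd0 hd hs0 hs1 (IsSelection.measurable_diffFun k)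
    (IsSelection.abs_diffFun_le k) (by positivity) (h₁ k)
  have D₂ := DualBound.of_even (k := k) (n := d + 2) (by omega) (hd.add even_two) hs0 hs1
    (IsSelection.measurable_diffFun k) (IsSelection.abs_diffFun_le k) (by positivity) (h₂ k)
  have D := D₁.interpolate (IsSelection.measurable_diffFun k) hds (by push_cast; linarith) hs0 D₂ hτ0 hτ1
  convert D using 1
  · push_cast; ring
  · have hpow : ∀ e η : ℝ, ENNReal.ofReal (2 ^ (e * (k : ℝ))) ^ η = ENNReal.ofReal (2 ^ (e * k * η)) :=
      fun e η => by rw [ENNReal.ofReal_rpow_of_pos (by positivity), ← Real.rpow_mul zero_le_two]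
    have hexp : ENNReal.ofReal (2 ^ (-(ε * (k : ℝ)))) =
        ENNReal.ofReal (2 ^ ((-θ + ε) * (k : ℝ))) ^ (1 - τ) *
          ENNReal.ofReal (2 ^ ((ξ + ε) * (k : ℝ))) ^ τ := by
      rw [hpow, hpow, ← ENNReal.ofReal_mul (by positivity), ← Real.rpow_add two_pos]
      congr 2
      rw [hε]; ring
    rw [hexp, ENNReal.ofReal_mul hK₁, ENNReal.ofReal_mul hK₂]
    simp only [ENNReal.mul_rpow_of_nonneg _ _ hτ', ENNReal.mul_rpow_of_nonneg _ _ hτ0]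
    ring

/-- The restricted maximal operator acting on functions with values in `[0, ∞]`. -/
noncomputable def lmax (ν : Measure ℝ) (f : ℝ → ENNReal) (x : ℝ) : ENNReal :=
  ⨆ r : Icc (1 : ℝ) 2, ∫⁻ y, f (x + (r : ℝ) * y) ∂ν

theorem le_one_add_tsum_two_pow (t : ENNReal) :
    t ≤ 1 + ∑' j : ℕ, if 2 ^ j < t then (2 : ENNReal) ^ j else 0 := by
  have key : ∀ n : ℕ, min t (2 ^ n) ≤
      1 + ∑ j ∈ Finset.range n, if 2 ^ j < t then (2 : ENNReal) ^ j else 0 := fun n => by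
    induction n with
    | zero => simp
    | succ n ih =>
      rw [Finset.sum_range_succ, ← add_assoc]
      split_ifs with h
      · rw [min_eq_right h.le] at ih
        calc _ ≤ (2 : ENNReal) ^ (n + 1) := min_le_right _ _
          _ = 2 ^ n + 2 ^ n := by rw [pow_succ]; ring
          _ ≤ _ := by gcongr
      · rw [min_eq_left (not_lt.1 h)] at ih
        rw [add_zero]
        exact (min_le_left _ _).trans ih
  have key' : ∀ n : ℕ, min t (2 ^ n) ≤ 1 + ∑' j : ℕ, if 2 ^ j < t then (2 : ENNReal) ^ j else 0 :=
    fun n => (key n).trans (add_le_add le_rfl (ENNReal.sum_le_tsum _))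
  have hpow : ∀ N : NNReal, ∃ n : ℕ, (N : ENNReal) ≤ 2 ^ n := fun N => by
    obtain ⟨n, hn⟩ := pow_unbounded_of_one_lt N (one_lt_two : (1 : NNReal) < 2)
    exact ⟨n, by exact_mod_cast hn.le⟩
  rcases eq_or_ne t ⊤ with rfl | ht
  · refine (ENNReal.eq_top_of_forall_nnreal_le fun N => ?_).ge
    obtain ⟨n, hn⟩ := hpow N
    exact hn.trans ((key' n).trans' (by simp))
  · lift t to NNReal using ht
    obtain ⟨n, hn⟩ := hpow t
    exact (min_eq_left hn).ge.trans (key' n)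

section

variable {ν : Measure ℝ} {u : ℕ → Icc (1 : ℝ) 2}

theorem measurable_iSup_dilate [IsFiniteMeasure ν] {O : Set ℝ} (hO : MeasurableSet O) :
    Measurable fun x => ⨆ i, ν {y | x + u i * y ∈ O} := by
  refine Measurable.iSup fun i => ?_
  have hm : Measurable fun z : ℝ × ℝ => z.1 + (u i : ℝ) * z.2 := by fun_prop
  exact measurable_measure_prodMk_left (hm hO)

theorem lmax_le_of_superlevel_subset [IsProbabilityMeasure ν] (hu : DenseRange u) {f : ℝ → ENNReal}
    {O : ℕ → Set ℝ} (hO : ∀ j, IsOpen (O j)) (hfO : ∀ j, {z | 2 ^ j < f z} ⊆ O j) (x : ℝ) :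
    lmax ν f x ≤ 1 + ∑' j : ℕ, 2 ^ j * ⨆ i, ν {y | x + u i * y ∈ O j} := by
  refine iSup_le fun r => ?_
  have hm : ∀ j, MeasurableSet {y | x + (r : ℝ) * y ∈ O j} := fun j =>
    ((hO j).preimage (by fun_prop : Continuous fun y => x + (r : ℝ) * y)).measurableSet
  calc _ ≤ ∫⁻ y, (1 + ∑' j : ℕ, {y | x + (r : ℝ) * y ∈ O j}.indicator (fun _ => (2 : ENNReal) ^ j) y) ∂ν := by
        refine lintegral_mono fun y => (le_one_add_tsum_two_pow _).trans ?_
        refine add_le_add le_rfl (ENNReal.tsum_le_tsum fun j => ?_)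
        split_ifs with h
        · rw [indicator_of_mem (s := {y | x + (r : ℝ) * y ∈ O j}) (hfO j h)]
        · exact zero_le
    _ = 1 + ∑' j : ℕ, 2 ^ j * ν {y | x + (r : ℝ) * y ∈ O j} := by
        rw [lintegral_add_left measurable_const,
          lintegral_tsum fun j => (measurable_const.indicator (hm j)).aemeasurable]
        simp [hm]
    _ ≤ _ := by
        gcongr with j
        exact measure_dilate_le_iSup (hO j) hu x r

theorem exists_lmax_bound_of_restricted [IsProbabilityMeasure ν] (hu : DenseRange u) {p q q' a : ℝ}
    {Q : ENNReal} (hQ : Q ≠ ⊤)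
    (hR : ∀ O, IsOpen O →
      ∫⁻ x in Icc (0 : ℝ) 1, (⨆ i, ν {y | x + u i * y ∈ O}) ^ q' ≤ Q * volume O ^ a)
    (hp : 0 < p) (ha : 0 ≤ a) (hqq' : q ≤ q') (hq' : 1 ≤ q') (hqa : q' < p * a) :
    ∃ C : ENNReal, C ≠ ⊤ ∧ ∀ f : ℝ → ENNReal, Measurable f → ∫⁻ z, f z ^ p ≤ 1 →
      ∃ g : ℝ → ENNReal, Measurable g ∧ (∀ x, lmax ν f x ≤ g x) ∧
        ∫⁻ x in Icc (0 : ℝ) 1, g x ^ q ≤ C := by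
  have hq'0 : 0 < q' := by linarith
  obtain ⟨C, hC, hsum⟩ := lintegral_tsum_rpow_le hq'0 (sub_pos.2 hqa)
  refine ⟨2 ^ (q' - 1) * (1 + C * (Q * 2 ^ a)), ENNReal.mul_ne_top (by simp)
    (ENNReal.add_ne_top.2 ⟨ENNReal.one_ne_top, ENNReal.mul_ne_top hC (ENNReal.mul_ne_top hQ (by simp))⟩),
    fun f hf hf1 => ?_⟩
  have hvol : ∀ j : ℕ, volume {z | 2 ^ j < f z} ≤ 2 ^ (-(p * j)) := fun j => by
    have h1 := mul_meas_ge_le_lintegral (μ := volume) (hf.pow_const p) ((2 ^ j) ^ p)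
    have h2 : {z | 2 ^ j < f z} ⊆ {z | ((2 : ENNReal) ^ j) ^ p ≤ f z ^ p} := fun z hz =>
      ENNReal.rpow_le_rpow (le_of_lt hz) hp.le
    have h3 : ((2 : ENNReal) ^ j) ^ p = 2 ^ (p * j) := by
      rw [← ENNReal.rpow_natCast, ← ENNReal.rpow_mul]; ring_nf
    rw [ENNReal.rpow_neg, ← one_div, ENNReal.le_div_iff_mul_le (by simp) (by simp), mul_comm, ← h3]
    exact (mul_le_mul' le_rfl (measure_mono h2)).trans (h1.trans hf1)
  have hO : ∀ j : ℕ, ∃ O ⊇ {z | 2 ^ j < f z}, IsOpen O ∧ volume O < 2 * 2 ^ (-(p * j)) := fun j => by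
    refine Set.exists_isOpen_lt_of_lt _ _ ((hvol j).trans_lt ?_)
    have h0 : (2 : ENNReal) ^ (-(p * j)) ≠ 0 := by simp
    have ht : (2 : ENNReal) ^ (-(p * j)) ≠ ⊤ := by simp
    rw [two_mul]
    exact ENNReal.lt_add_right ht h0
  choose O hfO hOo hOv using hO
  set S : ℝ → ENNReal := fun x => ∑' j : ℕ, 2 ^ j * ⨆ i, ν {y | x + u i * y ∈ O j} with hS
  have hm : ∀ j : ℕ, Measurable fun x => (2 : ENNReal) ^ j * ⨆ i, ν {y | x + u i * y ∈ O j} := fun j =>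
    (measurable_iSup_dilate (hOo j).measurableSet).const_mul _
  have hSm : Measurable S := Measurable.tsum hm
  refine ⟨fun x => 1 + S x, measurable_const.add hSm,
    lmax_le_of_superlevel_subset hu hOo hfO, ?_⟩
  have hSb : ∫⁻ x in Icc (0 : ℝ) 1, S x ^ q' ≤ C * (Q * 2 ^ a) := by
    refine hsum _ _ _ hm fun j => ?_
    calc _ = (2 ^ j) ^ q' * ∫⁻ x in Icc (0 : ℝ) 1, (⨆ i, ν {y | x + u i * y ∈ O j}) ^ q' := by
          rw [← lintegral_const_mul _ ((measurable_iSup_dilate (hOo j).measurableSet).pow_const _)]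
          simp_rw [ENNReal.mul_rpow_of_nonneg _ _ hq'0.le]
      _ ≤ (2 ^ j) ^ q' * (Q * (2 * 2 ^ (-(p * j))) ^ a) := by
          gcongr
          exact (hR _ (hOo j)).trans (by gcongr; exact (hOv j).le)
      _ = Q * 2 ^ a * ((2 ^ j) ^ q' * (2 ^ (-(p * j))) ^ a) := by
          rw [ENNReal.mul_rpow_of_nonneg _ _ ha]; ring
      _ = _ := by
          congr 1
          rw [← ENNReal.ofReal_rpow_of_pos two_pos, ENNReal.ofReal_ofNat, ← ENNReal.rpow_natCast,
            ← ENNReal.rpow_mul, ← ENNReal.rpow_mul, ← ENNReal.rpow_add _ _ (by norm_num) (by norm_num)]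
          congr 1
          ring
  calc ∫⁻ x in Icc (0 : ℝ) 1, (1 + S x) ^ q ≤ ∫⁻ x in Icc (0 : ℝ) 1, 2 ^ (q' - 1) * (1 + S x ^ q') := by
        refine lintegral_mono fun x => ?_
        refine (ENNReal.rpow_le_rpow_of_exponent_le le_self_add hqq').trans ?_
        have := ENNReal.rpow_add_le_mul_rpow_add_rpow 1 (S x) hq'
        rwa [ENNReal.one_rpow] at this
    _ = 2 ^ (q' - 1) * (1 + ∫⁻ x in Icc (0 : ℝ) 1, S x ^ q') := by
        rw [lintegral_const_mul _ (by fun_prop), lintegral_add_left measurable_const]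
        simp
    _ ≤ _ := by gcongr

end

section

variable {ν : Measure ℝ} {p q : ℝ} {C : ENNReal}

theorem lmax_const_mul {f : ℝ → ENNReal} (hf : Measurable f) (c : ENNReal) (x : ℝ) :
    lmax ν (fun z => c * f z) x = c * lmax ν f x := by
  unfold lmax
  rw [ENNReal.mul_iSup]
  congr with r
  exact lintegral_const_mul _ (by fun_prop)

theorem exists_lmax_bound_scaled (hp : 0 < p) (hq : 0 < q) (hC : C ≠ ⊤)
    (H : ∀ f : ℝ → ENNReal, Measurable f → ∫⁻ z, f z ^ p ≤ 1 →
      ∃ g : ℝ → ENNReal, Measurable g ∧ (∀ x, lmax ν f x ≤ g x) ∧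
        ∫⁻ x in Icc (0 : ℝ) 1, g x ^ q ≤ C)
    {f : ℝ → ENNReal} (hf : Measurable f) (hfp : ∫⁻ z, f z ^ p ≠ ⊤) :
    ∃ g : ℝ → ENNReal, Measurable g ∧ (∀ x, lmax ν f x ≤ g x) ∧
      ∫⁻ x in Icc (0 : ℝ) 1, g x ^ q ≤ C * (∫⁻ z, f z ^ p) ^ (q / p) := by
  have scale : ∀ c : ENNReal, c ≠ 0 → c ≠ ⊤ → ∫⁻ z, f z ^ p ≤ c ^ p →
      ∃ g : ℝ → ENNReal, Measurable g ∧ (∀ x, lmax ν f x ≤ g x) ∧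
        ∫⁻ x in Icc (0 : ℝ) 1, g x ^ q ≤ C * c ^ q := fun c hc0 hct hc => by
    obtain ⟨g, hg, hfg, hgq⟩ := H (fun z => c⁻¹ * f z) (hf.const_mul _) (by
      simp_rw [ENNReal.mul_rpow_of_nonneg _ _ hp.le]
      rw [lintegral_const_mul _ (hf.pow_const _), ENNReal.inv_rpow, mul_comm, ← div_eq_mul_inv]
      exact ENNReal.div_le_of_le_mul (by rwa [one_mul]))
    refine ⟨fun x => c * g x, hg.const_mul _, fun x => ?_, ?_⟩
    · have := hfg x
      rw [lmax_const_mul hf] at this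
      calc lmax ν f x = c * (c⁻¹ * lmax ν f x) := by
            rw [← mul_assoc, ENNReal.mul_inv_cancel hc0 hct, one_mul]
        _ ≤ _ := mul_le_mul' le_rfl this
    · simp_rw [ENNReal.mul_rpow_of_nonneg _ _ hq.le]
      rw [lintegral_const_mul _ (hg.pow_const _), mul_comm]
      gcongr
  by_cases h0 : ∫⁻ z, f z ^ p = 0
  · choose g hg hfg hgq using fun n : ℕ => scale ((n + 1 : ℕ) : ENNReal)⁻¹ (by simp)
      (ENNReal.inv_ne_top.2 (by positivity)) (by simp [h0])
    refine ⟨fun x => ⨅ n, g n x, Measurable.iInf hg, fun x => le_iInf fun n => hfg n x, ?_⟩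
    have hlim : Filter.Tendsto (fun n : ℕ => C * (((n + 1 : ℕ) : ENNReal)⁻¹) ^ q) Filter.atTop
        (nhds (C * 0 ^ q)) := by
      refine ENNReal.Tendsto.const_mul ?_ (Or.inr hC)
      exact (ENNReal.continuous_rpow_const.tendsto 0).comp
        ((Filter.tendsto_add_atTop_iff_nat 1).2 ENNReal.tendsto_inv_nat_nhds_zero)
    rw [h0, ENNReal.zero_rpow_of_pos (div_pos hq hp)]
    rw [ENNReal.zero_rpow_of_pos hq] at hlim
    refine ge_of_tendsto' hlim fun n => le_trans (lintegral_mono fun x => ?_) (hgq n)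
    exact ENNReal.rpow_le_rpow (iInf_le _ n) hq.le
  · obtain ⟨g, hg, hfg, hgq⟩ := scale ((∫⁻ z, f z ^ p) ^ p⁻¹)
      (by simp [ENNReal.rpow_eq_zero_iff, h0, hfp])
      (ENNReal.rpow_ne_top_of_nonneg (by positivity) hfp)
      (by rw [← ENNReal.rpow_mul, inv_mul_cancel₀ hp.ne', ENNReal.rpow_one])
    refine ⟨g, hg, hfg, hgq.trans_eq ?_⟩
    rw [← ENNReal.rpow_mul, inv_mul_eq_div]

theorem exists_lmax_bound_local (hν : ν (Icc 1 2)ᶜ = 0) (hp : 0 < p)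
    (H : ∀ f : ℝ → ENNReal, Measurable f → ∫⁻ z, f z ^ p ≠ ⊤ →
      ∃ g : ℝ → ENNReal, Measurable g ∧ (∀ x, lmax ν f x ≤ g x) ∧
        ∫⁻ x in Icc (0 : ℝ) 1, g x ^ q ≤ C * (∫⁻ z, f z ^ p) ^ (q / p))
    {f : ℝ → ENNReal} (hf : Measurable f) (hfp : ∫⁻ z, f z ^ p ≠ ⊤) (m : ℤ) :
    ∃ g : ℝ → ENNReal, Measurable g ∧ (∀ x ∈ Ico (m : ℝ) (m + 1), lmax ν f x ≤ g x) ∧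
      ∫⁻ x in Ico (m : ℝ) (m + 1), g x ^ q ≤
        C * (∫⁻ z in Ico (m : ℝ) (m + 6), f z ^ p) ^ (q / p) := by
  set F : ℝ → ENNReal := (Ico (m : ℝ) (m + 6)).indicator f with hF
  have hFm : Measurable F := hf.indicator measurableSet_Ico
  have hInt : ∫⁻ z, F (z + m) ^ p = ∫⁻ z in Ico (m : ℝ) (m + 6), f z ^ p := by
    rw [lintegral_add_right_eq_self (fun z => F z ^ p), ← lintegral_indicator measurableSet_Ico]
    congr with z
    by_cases hz : z ∈ Ico (m : ℝ) (m + 6)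
    · rw [hF, indicator_of_mem hz, indicator_of_mem hz]
    · rw [hF, indicator_of_notMem hz, indicator_of_notMem hz, ENNReal.zero_rpow_of_pos hp]
  obtain ⟨g, hg, hfg, hgq⟩ := H (fun z => F (z + m)) (by fun_prop)
    (hInt ▸ ne_top_of_le_ne_top hfp (setLIntegral_le_lintegral _ _))
  refine ⟨fun x => g (x - m), by fun_prop, fun x hx => le_trans ?_ (hfg (x - m)), ?_⟩
  · refine iSup_mono fun r => lintegral_mono_ae ?_
    have hae : ∀ᵐ y ∂ν, y ∈ Icc (1 : ℝ) 2 := hν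
    filter_upwards [hae] with y hy
    have h1 := mul_le_mul r.2.1 hy.1 zero_le_one (zero_le_one.trans r.2.1)
    have h2 := mul_le_mul r.2.2 hy.2 (zero_le_one.trans hy.1) zero_le_two
    have hmem : x - m + r * y + m ∈ Ico (m : ℝ) (m + 6) :=
      ⟨by linarith [hx.1], by linarith [hx.2]⟩
    rw [hF, indicator_of_mem hmem]
    exact (congrArg f (by ring)).le
  · rw [hInt] at hgq
    refine le_trans (le_of_eq ?_) ((lintegral_mono_set Ico_subset_Icc_self).trans hgq)
    rw [← lintegral_indicator measurableSet_Ico, ← lintegral_indicator measurableSet_Ico,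
      ← lintegral_sub_right_eq_self ((Ico 0 1).indicator fun x => g x ^ q) (m : ℝ)]
    congr with x
    simp only [indicator, mem_Ico, sub_nonneg, sub_lt_iff_lt_add']

theorem tsum_setLIntegral_Ico_six {F : ℝ → ENNReal} (hF : Measurable F) :
    ∑' m : ℤ, ∫⁻ z in Ico (m : ℝ) (m + 6), F z = 6 * ∫⁻ z, F z := by
  simp_rw [← lintegral_indicator measurableSet_Ico]
  rw [← lintegral_tsum fun m => (hF.indicator measurableSet_Ico).aemeasurable,
    ← lintegral_const_mul _ hF]
  congr with z
  rw [tsum_eq_sum (s := Finset.Icc (⌊z⌋ - 5) ⌊z⌋)]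
  · rw [Finset.sum_congr rfl (g := fun _ => F z)]
    · simp
    · intro m hm
      rw [Finset.mem_Icc] at hm
      have := Int.floor_lt.1 (show ⌊z⌋ < m + 6 by omega)
      push_cast at this
      exact indicator_of_mem (mem_Ico.2 ⟨Int.le_floor.1 hm.2, this⟩) _
  · intro m hm
    refine indicator_of_notMem (fun hz => hm ?_) _
    have h1 := Int.le_floor.2 hz.1
    have h2 : ⌊z⌋ < m + 6 := Int.floor_lt.2 (by exact_mod_cast hz.2)
    rw [Finset.mem_Icc]
    omega

theorem lintegral_eq_tsum_Ico_int (F : ℝ → ENNReal) :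
    ∫⁻ x, F x = ∑' m : ℤ, ∫⁻ x in Ico (m : ℝ) (m + 1), F x := by
  rw [← lintegral_iUnion (fun _ => measurableSet_Ico) (pairwise_disjoint_Ico_intCast ℝ),
    iUnion_Ico_intCast, setLIntegral_univ]

theorem tsum_rpow_le_rpow_tsum {ι : Type*} (N : ι → ENNReal) {a : ℝ} (ha : 1 ≤ a) :
    ∑' i, N i ^ a ≤ (∑' i, N i) ^ a := by
  have hsplit : ∀ t : ENNReal, t ^ a = t ^ (a - 1) * t := fun t => by
    conv_lhs => rw [show a = (a - 1) + 1 by ring,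
      ENNReal.rpow_add_of_nonneg _ _ (by linarith) zero_le_one, ENNReal.rpow_one]
  rw [hsplit (∑' i, N i), ← ENNReal.tsum_mul_left]
  refine ENNReal.tsum_le_tsum fun i => ?_
  rw [hsplit]
  exact mul_le_mul' (ENNReal.rpow_le_rpow (ENNReal.le_tsum i) (by linarith)) le_rfl

theorem exists_lmax_bound_global (hν : ν (Icc 1 2)ᶜ = 0) (hp : 0 < p) (hpq : p ≤ q)
    (H : ∀ f : ℝ → ENNReal, Measurable f → ∫⁻ z, f z ^ p ≠ ⊤ →
      ∃ g : ℝ → ENNReal, Measurable g ∧ (∀ x, lmax ν f x ≤ g x) ∧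
        ∫⁻ x in Icc (0 : ℝ) 1, g x ^ q ≤ C * (∫⁻ z, f z ^ p) ^ (q / p))
    {f : ℝ → ENNReal} (hf : Measurable f) (hfp : ∫⁻ z, f z ^ p ≠ ⊤) :
    ∫⁻ x, lmax ν f x ^ q ≤ C * (6 * ∫⁻ z, f z ^ p) ^ (q / p) := by
  choose g _ hfg hgq using exists_lmax_bound_local hν hp H hf hfp
  rw [lintegral_eq_tsum_Ico_int]
  calc _ ≤ ∑' m : ℤ, C * (∫⁻ z in Ico (m : ℝ) (m + 6), f z ^ p) ^ (q / p) := by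
        refine ENNReal.tsum_le_tsum fun m => le_trans ?_ (hgq m)
        exact setLIntegral_mono' measurableSet_Ico fun x hx =>
          ENNReal.rpow_le_rpow (hfg m x hx) (by linarith)
    _ ≤ _ := by
        rw [ENNReal.tsum_mul_left, ← tsum_setLIntegral_Ico_six (hf.pow_const p)]
        gcongr
        exact tsum_rpow_le_rpow_tsum _ ((one_le_div hp).2 hpq)

theorem enorm_restrictedMax_le (f : ℝ → ℝ) (x : ℝ) :
    ‖restrictedMax ν f x‖ₑ ≤ lmax ν (fun z => ‖f z‖ₑ) x := by
  rcases eq_or_ne (lmax ν (fun z => ‖f z‖ₑ) x) ⊤ with h | h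
  · simp [h]
  have h0 : ∀ r : Icc (1 : ℝ) 2, 0 ≤ ∫ y, |f (x + (r : ℝ) * y)| ∂ν := fun r =>
    integral_nonneg fun y => abs_nonneg _
  rw [restrictedMax, Real.enorm_eq_ofReal (Real.iSup_nonneg h0), ← ENNReal.ofReal_toReal h]
  refine ENNReal.ofReal_le_ofReal (Real.iSup_le (fun r => ?_) ENNReal.toReal_nonneg)
  rw [← ENNReal.ofReal_le_iff_le_toReal h, ← Real.enorm_eq_ofReal (h0 r)]
  refine (enorm_integral_le_lintegral_enorm _).trans ?_
  simp_rw [← Real.norm_eq_abs, enorm_norm]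
  exact le_iSup (fun r : Icc (1 : ℝ) 2 => ∫⁻ y, ‖f (x + (r : ℝ) * y)‖ₑ ∂ν) r

theorem boundedLpLq_of_lmax_bound (hν : ν (Icc 1 2)ᶜ = 0) (hp : 0 < p) (hpq : p ≤ q) (hC : C ≠ ⊤)
    (H : ∀ f : ℝ → ENNReal, Measurable f → ∫⁻ z, f z ^ p ≤ 1 →
      ∃ g : ℝ → ENNReal, Measurable g ∧ (∀ x, lmax ν f x ≤ g x) ∧
        ∫⁻ x in Icc (0 : ℝ) 1, g x ^ q ≤ C) :
    BoundedLpLq ν p q := by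
  have hq : 0 < q := hp.trans_le hpq
  set K : ENNReal := C ^ q⁻¹ * 6 ^ p⁻¹ with hK
  have hKt : K ≠ ⊤ := ENNReal.mul_ne_top (ENNReal.rpow_ne_top_of_nonneg (by positivity) hC)
    (ENNReal.rpow_ne_top_of_nonneg (by positivity) (by simp))
  refine ⟨K.toReal + 1, by positivity, fun f hf => ?_⟩
  have hp' : ENNReal.ofReal p ≠ 0 := by simpa using hp
  have hq' : ENNReal.ofReal q ≠ 0 := by simpa using hq
  rw [eLpNorm_eq_lintegral_rpow_enorm_toReal hp' ENNReal.ofReal_ne_top,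
    eLpNorm_eq_lintegral_rpow_enorm_toReal hq' ENNReal.ofReal_ne_top,
    ENNReal.toReal_ofReal hp.le, ENNReal.toReal_ofReal hq.le, one_div, one_div]
  rcases eq_or_ne (∫⁻ z, ‖f z‖ₑ ^ p) ⊤ with hS | hS
  · rw [hS, ENNReal.top_rpow_of_pos (by positivity), ENNReal.mul_top]
    · exact le_top
    · simpa using by positivity
  have hfe : Measurable fun z => ‖f z‖ₑ := hf.enorm
  have hglob := exists_lmax_bound_global hν hp hpq
    (fun _ hf' hfp => exists_lmax_bound_scaled hp hq hC H hf' hfp) hfe hS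
  calc (∫⁻ x, ‖restrictedMax ν f x‖ₑ ^ q) ^ q⁻¹
      ≤ (C * (6 * ∫⁻ z, ‖f z‖ₑ ^ p) ^ (q / p)) ^ q⁻¹ := by
        refine ENNReal.rpow_le_rpow (le_trans (lintegral_mono fun x => ?_) hglob) (by positivity)
        exact ENNReal.rpow_le_rpow (enorm_restrictedMax_le f x) hq.le
    _ = K * (∫⁻ z, ‖f z‖ₑ ^ p) ^ p⁻¹ := by
        rw [ENNReal.mul_rpow_of_nonneg _ _ (by positivity), ← ENNReal.rpow_mul,
          show q / p * q⁻¹ = p⁻¹ by field_simp, ENNReal.mul_rpow_of_nonneg _ _ (by positivity),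
          ← mul_assoc]
    _ ≤ _ := by
        gcongr
        rw [← ENNReal.ofReal_toReal hKt]
        exact ENNReal.ofReal_le_ofReal (by simp)

end

theorem IsSelection.measure_compl_Icc {s : ℝ} {E B : ℕ → Finset ℕ} {ν : Measure ℝ} {φ : ℕ → ℕ}
    (h : IsSelection s E B)
    (hν : ∀ U, IsOpen U → ν U ≤ Filter.liminf (fun n => levelMeasure s E (φ n) U) Filter.atTop) :
    ν (Icc 1 2)ᶜ = 0 := by
  refine le_antisymm ((hν _ isClosed_Icc.isOpen_compl).trans ?_) zero_le
  simp [h.levelMeasure_compl_Icc]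

theorem exists_dual_exponent {s d θ ξ p₀ p q : ℝ} (hs0 : 0 < s) (hs1 : s < 1) (hd : 2 ≤ d)
    (hθ : 0 < θ) (hξ : 0 ≤ ξ)
    (hp₀ : p₀ = ((2 + d) * θ + d * ξ) / ((1 + d) * θ + (d - 1) * ξ))
    (hp : p₀ < p) (hq : q ≤ p / (p₀ - 1)) :
    ∃ τ : ℝ, 0 ≤ τ ∧ τ < 1 ∧ τ * ξ < (1 - τ) * θ ∧ d + 2 * τ < p * (d + 2 * τ - 1) ∧
      q < p * ((d + 2 * τ - 1) / s) := by
  have hsum : 0 < θ + ξ := by linarith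
  obtain ⟨σ, hσ⟩ : ∃ σ, σ = θ / (θ + ξ) := ⟨_, rfl⟩
  have hσ0 : 0 < σ := hσ ▸ div_pos hθ hsum
  have hσ1 : σ ≤ 1 := hσ ▸ (div_le_one hsum).2 (by linarith)
  have hden : 0 < (1 + d) * θ + (d - 1) * ξ := by nlinarith
  have hb : 0 < d + 2 * σ - 1 := by linarith
  have hp₀σ : p₀ = (d + 2 * σ) / (d + 2 * σ - 1) := by
    have h1 : d + 2 * σ = ((2 + d) * θ + d * ξ) / (θ + ξ) := by
      rw [hσ]; field_simp; ring
    have h2 : d + 2 * σ - 1 = ((1 + d) * θ + (d - 1) * ξ) / (θ + ξ) := by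
      rw [hσ]; field_simp; ring
    rw [h2, h1, hp₀, div_div_div_cancel_right₀ hsum.ne']
  have hp₀1 : p₀ - 1 = 1 / (d + 2 * σ - 1) := by
    rw [hp₀σ, div_sub_one hb.ne']; ring
  have hppos : 0 < p := lt_trans (hp₀σ ▸ by positivity) hp
  have hpσ : d + 2 * σ < p * (d + 2 * σ - 1) := by rwa [hp₀σ, div_lt_iff₀ hb] at hp
  have hqσ : q < p * ((d + 2 * σ - 1) / s) := by
    rw [hp₀1, div_div_eq_mul_div, div_one] at hq
    refine hq.trans_lt (mul_lt_mul_of_pos_left ?_ hppos)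
    rw [lt_div_iff₀ hs0]
    nlinarith
  have ev0 : ∀ᶠ τ in nhdsWithin σ (Iio σ), 0 < τ := nhdsWithin_le_nhds (lt_mem_nhds hσ0)
  have evp : ∀ᶠ τ in nhdsWithin σ (Iio σ), d + 2 * τ < p * (d + 2 * τ - 1) :=
    nhdsWithin_le_nhds (ContinuousAt.eventually_lt (by fun_prop) (by fun_prop) hpσ)
  have evq : ∀ᶠ τ in nhdsWithin σ (Iio σ), q < p * ((d + 2 * τ - 1) / s) :=
    nhdsWithin_le_nhds (ContinuousAt.eventually_lt (by fun_prop) (by fun_prop) hqσ)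
  obtain ⟨τ, ⟨⟨hτ0, hτp⟩, hτq⟩, hτσ⟩ :=
    (((ev0.and evp).and evq).and eventually_mem_nhdsWithin).exists
  refine ⟨τ, hτ0.le, lt_of_lt_of_le hτσ hσ1, ?_, hτp, hτq⟩
  have : τ * (θ + ξ) < θ := by rwa [mem_Iio, hσ, lt_div_iff₀ hsum] at hτσ
  linarith

theorem stmt0 (s : ℝ) (hs : s ∈ Ioo (1/2 : ℝ) 1)
    (d : ℕ) (hd : (d : ℤ) = 2 * ⌈1 / (2 - 2*s) - 1⌉)
    (θ₀ ξ₀ p₀ : ℝ)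
    (hθ₀ : θ₀ = ((d : ℝ) * s + 1 - d) / 2)
    (hξ₀ : ξ₀ = (d : ℝ) + 1 - ((d : ℝ) + 2) * s)
    (hp₀ : p₀ = ((2 + (d : ℝ)) * θ₀ + (d : ℝ) * ξ₀) /
      ((1 + (d : ℝ)) * θ₀ + ((d : ℝ) - 1) * ξ₀)) :
    ∃ (A : Set ℝ) (ν : Measure ℝ), IsCompact A ∧ A ⊆ Icc 1 2 ∧
      IsProbabilityMeasure ν ∧ msupport ν = A ∧ IsAhlforsRegular ν s ∧
      ∀ p q : ℝ, p₀ < p → p ≤ q → q ≤ p / (p₀ - 1) → BoundedLpLq ν p q := by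
  obtain ⟨hs2, hs1⟩ := hs
  have hs0 : 0 < s := by linarith
  have ht : 0 < 2 - 2 * s := by linarith
  set n := ⌈1 / (2 - 2 * s) - 1⌉ with hn
  have hdn : (d : ℝ) = 2 * n := by exact_mod_cast hd
  have hd_even : Even d := by
    rw [← Int.even_coe_nat, hd]
    exact even_two_mul n
  have hn_le : 1 ≤ n := Int.ceil_pos.2 (by
    rw [sub_pos, lt_div_iff₀ ht]
    linarith)
  have hd2 : 2 ≤ d := by omega
  have hd2' : (2 : ℝ) ≤ d := by exact_mod_cast hd2
  have hn_lt : (n : ℝ) < 1 / (2 - 2 * s) := by linarith [Int.ceil_lt_add_one (1 / (2 - 2 * s) - 1)]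
  have hn_ge : 1 / (2 - 2 * s) ≤ n + 1 := by linarith [Int.le_ceil (1 / (2 - 2 * s) - 1)]
  rw [lt_div_iff₀ ht] at hn_lt
  rw [div_le_iff₀ ht] at hn_ge
  have hθ_lt : (d : ℝ) * (1 - s) < 1 := by rw [hdn]; linarith
  have hξ_ge : 1 ≤ ((d : ℝ) + 2) * (1 - s) := by rw [hdn]; linarith
  have hθpos : 0 < θ₀ := by rw [hθ₀]; linarith
  have hξ_nonneg : 0 ≤ ξ₀ := by rw [hξ₀]; linarith
  obtain ⟨C, hC, hB⟩ := exists_corrBound_uniform d (d + 2) (by omega) (by omega) hs0.le hs1.le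
    (C₀ := 8) (by norm_num)
  obtain ⟨E, B, h, hEB⟩ := exists_selection hs0.le hs1.le hB
  obtain ⟨ν, φ, hprob, hφ, hν⟩ := h.exists_limit hs0.le hs1.le
  refine ⟨msupport ν, ν, isCompact_Icc.of_isClosed_subset (isClosed_msupport ν)
    (h.msupport_subset hν), h.msupport_subset hν, hprob, rfl,
    h.isAhlforsRegular hs0.le hs1.le hφ hν, fun p q hp hpq hq => ?_⟩
  obtain ⟨τ, hτ0, hτ1, hτ, hτp, hτq⟩ :=
    exists_dual_exponent hs0 hs1 hd2' hθpos hξ_nonneg hp₀ hp hq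
  obtain ⟨Q, hQ, c, hc, hD⟩ := h.exists_dualBound hs0.le hs1 (by omega) hd_even hC hEB hθ_lt hξ_ge
    hτ0 hτ1.le (by
      rw [hθ₀, hξ₀] at hτ
      linarith)
  have hb : 1 < (d : ℝ) + 2 * τ := by linarith
  have hppos : 0 < p := by
    by_contra hcon
    nlinarith
  have hbp : (d + 2 * τ) / s < p * ((d + 2 * τ - 1) / s) := by
    rw [← mul_div_assoc]
    gcongr
  obtain ⟨q', hq', hq'p⟩ := exists_between (max_lt hτq hbp)
  have hbq' := (le_max_right _ _).trans_lt hq'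
  have h1q' : 1 ≤ q' := by
    refine le_trans ?_ hbq'.le
    rw [le_div_iff₀ hs0]
    linarith
  have : Nonempty (Icc (1 : ℝ) 2) := ⟨⟨1, by norm_num⟩⟩
  have hu := TopologicalSpace.denseRange_denseSeq (Icc (1 : ℝ) 2)
  obtain ⟨K, hK, hres⟩ := h.exists_restricted_bound hs0 hs1.le hν hb hc hQ hD hbq'
    (u := fun i => TopologicalSpace.denseSeq (Icc (1 : ℝ) 2) i) fun i => Subtype.prop _
  obtain ⟨L, hL, hbound⟩ := exists_lmax_bound_of_restricted hu hK hres hppos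
    (div_nonneg (by linarith) hs0.le) ((le_max_left _ _).trans hq'.le) h1q' hq'p
  exact boundedLpLq_of_lmax_bound (h.measure_compl_Icc hν) hppos hpq hL hbound
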